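/- Let p be an odd prime and G = C₄ × C_p × C_p. Then for every K ∈ Sup₂^min(G_r), the S-ring V(K,G) is a CI-S-ring. -/

import Mathlib

open scoped Pointwise

noncomputable section

namespace Paper

/-- The element `∑_{x ∈ X} x` of the integer group ring `ℤG`. -/
def sumElems {G : Type*} [Group G] [Finite G] (X : Set G) : MonoidAlgebra ℤ G :=
  ∑ x ∈ X.toFinite.toFinset, MonoidAlgebra.single x (1 : ℤ)

/-- A Schur ring (S-ring) over a finite group `G`, described by the partition of `G`
into its basic sets: the partition contains `{1}`, is closed under taking inverses,
and its `ℤ`-span inside the group ring `ℤG` is closed under multiplication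
(hence is a subring of `ℤG`). -/
structure SRing (G : Type*) [Group G] [Finite G] where
  basic : Set (Set G)
  nonempty : ∀ X ∈ basic, X.Nonempty
  cover : ∀ g : G, ∃! X, X ∈ basic ∧ g ∈ X
  one_mem : ({1} : Set G) ∈ basic
  inv_mem : ∀ X ∈ basic, X⁻¹ ∈ basic
  mul_mem : ∀ a b : MonoidAlgebra ℤ G,
    a ∈ Submodule.span ℤ (sumElems '' basic) →
    b ∈ Submodule.span ℤ (sumElems '' basic) →
    a * b ∈ Submodule.span ℤ (sumElems '' basic)

namespace SRing

/-- The `ℤ`-module underlying an S-ring. -/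
def span {G : Type*} [Group G] [Finite G] (A : SRing G) :
    Submodule ℤ (MonoidAlgebra ℤ G) :=
  Submodule.span ℤ (sumElems '' A.basic)

/-- A set `X ⊆ G` is an `𝒜`-set if `∑_{x ∈ X} x ∈ 𝒜`. -/
def IsASet {G : Type*} [Group G] [Finite G] (A : SRing G) (X : Set G) : Prop :=
  sumElems X ∈ A.span

/-- A subgroup which is an `𝒜`-set is an `𝒜`-subgroup. -/
def IsASubgroup {G : Type*} [Group G] [Finite G] (A : SRing G) (H : Subgroup G) : Prop :=
  A.IsASet (H : Set G)

end SRing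

/-- The arc set `R(X) = {(g, xg) : x ∈ X, g ∈ G}` of the Cayley digraph `Cay(G, X)`. -/
def Rel {G : Type*} [Group G] (X : Set G) : Set (G × G) := {p | p.2 * p.1⁻¹ ∈ X}

/-- `f : G ≃ G'` is an isomorphism from the S-ring `A` over `G` to the S-ring `B`
over `G'` if `{R(X)^f : X ∈ 𝒮(A)} = {R(Y) : Y ∈ 𝒮(B)}`. -/
def IsSRingIso {G G' : Type*} [Group G] [Finite G] [Group G'] [Finite G']
    (A : SRing G) (B : SRing G') (f : G ≃ G') : Prop :=
  (fun X => Prod.map f f '' Rel X) '' A.basic = Rel '' B.basic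

/-- The automorphism group `Aut(𝒜)` of an S-ring, as a set of permutations of `G`. -/
def SRing.autSet {G : Type*} [Group G] [Finite G] (A : SRing G) : Set (Equiv.Perm G) :=
  {f | ∀ X ∈ A.basic, Prod.map f f '' Rel X = Rel X}

/-- The set `Iso(𝒜)` of isomorphisms from `𝒜` onto S-rings over the same group `G`. -/
def SRing.isoSet {G : Type*} [Group G] [Finite G] (A : SRing G) : Set (Equiv.Perm G) :=
  {f | ∃ B : SRing G, IsSRingIso A B f}

/-- `Aut(G)` as a set of permutations of `G`. -/
def autPerm (G : Type*) [Group G] : Set (Equiv.Perm G) :=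
  Set.range fun φ : G ≃* G => (φ.toEquiv : Equiv.Perm G)

/-- A CI-S-ring: `Aut(𝒜)·Aut(G) = Iso(𝒜)`. -/
def SRing.IsCI {G : Type*} [Group G] [Finite G] (A : SRing G) : Prop :=
  A.autSet * autPerm G = A.isoSet

/-- The orbits on `G` of a set of automorphisms of `G`. -/
def setOrbits {G : Type*} [Group G] (Δ : Set (MulAut G)) : Set (Set G) :=
  Set.range fun g : G => (fun φ : MulAut G => φ g) '' Δ

/-- An S-ring is cyclotomic if its basic sets are exactly the orbits of some
subgroup `K ≤ Aut(G)`. -/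
def SRing.IsCyclotomic {G : Type*} [Group G] [Finite G] (A : SRing G) : Prop :=
  ∃ K : Subgroup (MulAut G), A.basic = setOrbits (K : Set (MulAut G))

/-- `Aut_G(𝒜) = Aut(𝒜) ∩ Aut(G)`, as a set of automorphisms of `G`. -/
def SRing.autGSet {G : Type*} [Group G] [Finite G] (A : SRing G) : Set (MulAut G) :=
  {φ | (φ.toEquiv : Equiv.Perm G) ∈ A.autSet}

/-- A (cyclotomic) S-ring is Cayley minimal if `Aut_G(𝒜)` is the only subgroup of
`Aut(G)` whose orbits on `G` coincide with those of `Aut_G(𝒜)`. -/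
def SRing.IsCayleyMinimal {G : Type*} [Group G] [Finite G] (A : SRing G) : Prop :=
  ∀ K : Subgroup (MulAut G),
    setOrbits (K : Set (MulAut G)) = setOrbits A.autGSet →
    (K : Set (MulAut G)) = A.autGSet

/-- `rad(X) = {g ∈ G : gX = Xg = X}`. -/
def rad {G : Type*} [Group G] (X : Set G) : Set G := {g | {g} * X = X ∧ X * {g} = X}

/-- The class `𝓔_c` of finite abelian groups all of whose Sylow subgroups are
elementary abelian or isomorphic to `C₄`. -/
def InEc (G : Type*) [CommGroup G] [Finite G] : Prop :=
  ∀ p : ℕ, p.Prime → ∀ P : Sylow p G,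
    (∀ x : ↥(P : Subgroup G), x ^ p = 1) ∨
    Nonempty (↥(P : Subgroup G) ≃* Multiplicative (ZMod 4))

/-- A finite group `G` is a `DCI`-group if any two Cayley digraphs over `G` that are
isomorphic as digraphs are Cayley isomorphic. -/
def IsDCIGroup (G : Type*) [Group G] : Prop :=
  ∀ S T : Set G,
    (∃ f : G ≃ G, ∀ g h : G, h * g⁻¹ ∈ S ↔ f h * (f g)⁻¹ ∈ T) →
    ∃ φ : G ≃* G, ⇑φ '' S = T

/-- The subgroup `G_r ≤ Sym(G)` of right translations of `G`. -/
def rightTranslations (G : Type*) [Group G] : Subgroup (Equiv.Perm G) where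
  carrier := Set.range fun g : G => Equiv.mulRight g
  one_mem' := ⟨1, by ext x; simp⟩
  mul_mem' := by
    rintro _ _ ⟨a, rfl⟩ ⟨b, rfl⟩
    exact ⟨b * a, by ext x; simp [mul_assoc]⟩
  inv_mem' := by
    rintro _ ⟨a, rfl⟩
    exact ⟨a⁻¹, by ext x; simp⟩

/-- The basic sets of the S-ring `V(K, G)`: the orbits of the stabilizer `K_e`
of the identity on `G`. -/
def VBasic {G : Type*} [Group G] (K : Subgroup (Equiv.Perm G)) : Set (Set G) :=
  Set.range fun g : G => MulAction.orbit (MulAction.stabilizer K (1 : G)) g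

/-- A subgroup `R ≤ Sym(G)` is regular if for all `g, h ∈ G` there is a
unique `r ∈ R` with `r(g) = h`. -/
def IsRegularSubgroup {G : Type*} [Group G] (R : Subgroup (Equiv.Perm G)) : Prop :=
  ∀ g h : G, ∃! r : R, (r : Equiv.Perm G) g = h

/-- `K ∈ Sup(G_r)`. -/
def InSup {G : Type*} [Group G] (K : Subgroup (Equiv.Perm G)) : Prop :=
  rightTranslations G ≤ K

/-- `K ∈ Sup₂(G_r)`, i.e. `K ≥ G_r` and `K = K^{(2)} = Aut(V(K,G))`. -/
def InSup2 {G : Type*} [Group G] [Finite G] (K : Subgroup (Equiv.Perm G)) : Prop :=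
  InSup K ∧
    (K : Set (Equiv.Perm G)) =
      {f : Equiv.Perm G | ∀ X ∈ VBasic K, Prod.map (⇑f) (⇑f) '' Rel X = Rel X}

/-- `K₁ ⪯_G K₂`: `K₁ ≤ K₂` and every regular subgroup of `K₂` isomorphic to `G`
is conjugate in `K₂` to a subgroup of `K₁`. -/
def GComplete {G : Type*} [Group G] (K₁ K₂ : Subgroup (Equiv.Perm G)) : Prop :=
  K₁ ≤ K₂ ∧ ∀ R : Subgroup (Equiv.Perm G), R ≤ K₂ → IsRegularSubgroup R →
    Nonempty (↥R ≃* G) → ∃ k ∈ K₂, ∀ r ∈ R, k * r * k⁻¹ ∈ K₁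

/-- `K ∈ Sup₂^min(G_r)`: a minimal element of `Sup₂(G_r)` with respect to `⪯_G`. -/
def InSup2Min {G : Type*} [Group G] [Finite G] (K : Subgroup (Equiv.Perm G)) : Prop :=
  InSup2 K ∧ ∀ K' : Subgroup (Equiv.Perm G), InSup2 K' → GComplete K' K → K' = K

/-- The basic sets of the restriction `𝒜_U` of `𝒜` to an `𝒜`-subgroup `U`:
the basic sets of `𝒜` contained in `U`, viewed inside `U`. -/
def restrictBasic {G : Type*} [Group G] [Finite G] (A : SRing G) (U : Subgroup G) :
    Set (Set ↥U) :=
  {Y : Set ↥U | Subtype.val '' Y ∈ A.basic}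

/-- The basic sets of the quotient S-ring `𝒜_{G/L}`: the images of the basic
sets of `𝒜` under the canonical epimorphism `G → G/L`. -/
def quotBasic {G : Type*} [CommGroup G] [Finite G] (A : SRing G) (L : Subgroup G) :
    Set (Set (G ⧸ L)) :=
  (fun X => QuotientGroup.mk '' X) '' A.basic

/-- The basic sets of the S-ring `𝒜_S` on the section `S = U/L`: the images under
the canonical epimorphism `U → U/L` of the basic sets of `𝒜` contained in `U`. -/
def secBasic {G : Type*} [CommGroup G] [Finite G] (A : SRing G) (U L : Subgroup G) :
    Set (Set (↥U ⧸ L.subgroupOf U)) :=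
  {Z | ∃ X ∈ A.basic, X ⊆ (U : Set G) ∧
    Z = QuotientGroup.mk '' (Subtype.val ⁻¹' X : Set ↥U)}

/-- The set of bijections of `H ⧸ N` induced by members of `Δ ⊆ Sym(H)`
permuting the `N`-cosets. -/
def inducedOnQuot {H : Type*} [CommGroup H] (N : Subgroup H) (Δ : Set (Equiv.Perm H)) :
    Set (Equiv.Perm (H ⧸ N)) :=
  {σ | ∃ f ∈ Δ, ∀ x : H, σ (QuotientGroup.mk x) = QuotientGroup.mk (f x)}

/-- The canonical (injective) homomorphism `U/L → G/L` for `L ≤ U ≤ G`. -/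
def secIncl {G : Type*} [CommGroup G] (U L : Subgroup G) :
    (↥U ⧸ L.subgroupOf U) →* G ⧸ L :=
  QuotientGroup.map (L.subgroupOf U) L U.subtype (fun _ hx => hx)

/-- The set of bijections of the section `S = U/L` induced by members of
`Δ ⊆ Sym(G/L)` preserving `S` (i.e. permuting the `L`-cosets contained in `U`). -/
def inducedOnSec {G : Type*} [CommGroup G] (U L : Subgroup G)
    (Δ : Set (Equiv.Perm (G ⧸ L))) : Set (Equiv.Perm (↥U ⧸ L.subgroupOf U)) :=
  {σ | ∃ φ ∈ Δ, ∀ x : ↥U,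
    φ (QuotientGroup.mk (x : G) : G ⧸ L) = secIncl U L (σ (QuotientGroup.mk x))}

/-- The basic sets of the S-ring `(ℤL ⊗ 𝒜_V) ≀_{(V×L)/V} ℤ(U/V)` over `U`,
where `Lu, V ≤ U` and `𝒜_V` is the restriction of `𝒜_U` to `V`. -/
def tensorWreathBasic {U : Type*} [CommGroup U] [Finite U] (AU : SRing U)
    (Lu V : Subgroup U) : Set (Set U) :=
  {Z | (∃ l ∈ Lu, ∃ X ∈ AU.basic, X ⊆ (V : Set U) ∧ Z = l • X) ∨
       (∃ u : U, u ∉ Lu ⊔ V ∧ Z = u • (V : Set U))}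

/-- Condition (CA): `𝒜_S = ℤS`. -/
def CondCA {G : Type*} [CommGroup G] [Finite G] (A : SRing G) (U L : Subgroup G) : Prop :=
  ∀ AS : SRing (↥U ⧸ L.subgroupOf U), AS.basic = secBasic A U L →
    AS.basic = Set.range fun s => ({s} : Set (↥U ⧸ L.subgroupOf U))

/-- Condition (CA'): `𝒜_U` or `𝒜_{G/L}` is cyclotomic and `𝒜_S` is Cayley minimal. -/
def CondCA' {G : Type*} [CommGroup G] [Finite G] (A : SRing G) (U L : Subgroup G) : Prop :=
  ((∀ AU : SRing ↥U, AU.basic = restrictBasic A U → AU.IsCyclotomic) ∨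
   (∀ AQ : SRing (G ⧸ L), AQ.basic = quotBasic A L → AQ.IsCyclotomic)) ∧
  (∀ AS : SRing (↥U ⧸ L.subgroupOf U), AS.basic = secBasic A U L → AS.IsCayleyMinimal)

/-- Condition (CA''): `U ≅ C_{4p}`, `L ≅ C₂` and
`𝒜_U = (ℤL ⊗ 𝒜_V) ≀_{(V×L)/V} ℤ(U/V)` for an `𝒜_U`-subgroup `V` of order `p`. -/
def CondCA'' {G : Type*} [CommGroup G] [Finite G] (p : ℕ) (A : SRing G)
    (U L : Subgroup G) : Prop :=
  Nat.card ↥U = 4 * p ∧ IsCyclic ↥U ∧ Nat.card ↥L = 2 ∧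
  ∀ AU : SRing ↥U, AU.basic = restrictBasic A U →
    ∃ V : Subgroup ↥U, AU.IsASubgroup V ∧ Nat.card ↥V = p ∧
      AU.basic = tensorWreathBasic AU (L.subgroupOf U) V

/-- `𝒜 = 𝒜_{G₁} ⊗ 𝒜_{G₂}` for `G = G₁ × G₂` (internally). -/
def IsTensorDecomp {G : Type*} [CommGroup G] [Finite G] (A : SRing G)
    (G₁ G₂ : Subgroup G) : Prop :=
  A.IsASubgroup G₁ ∧ A.IsASubgroup G₂ ∧ G₁ ⊓ G₂ = ⊥ ∧ G₁ ⊔ G₂ = ⊤ ∧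
  A.basic = {Z | ∃ X ∈ A.basic, ∃ Y ∈ A.basic,
    X ⊆ (G₁ : Set G) ∧ Y ⊆ (G₂ : Set G) ∧ Z = X * Y}

/-- `𝒜` is the tensor product of two S-rings over proper nontrivial subgroups of `G`. -/
def TensorConclusion {G : Type*} [CommGroup G] [Finite G] (A : SRing G) : Prop :=
  ∃ G₁ G₂ : Subgroup G, G₁ ≠ ⊥ ∧ G₁ ≠ ⊤ ∧ G₂ ≠ ⊥ ∧ G₂ ≠ ⊤ ∧ IsTensorDecomp A G₁ G₂

/-- `𝒜` is a nontrivial `S = U/L`-wreath product satisfying one of the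
conditions (CA), (CA'), (CA''). -/
def WreathConclusion {G : Type*} [CommGroup G] [Finite G] (p : ℕ) (A : SRing G) : Prop :=
  ∃ U L : Subgroup G, L ≤ U ∧ A.IsASubgroup U ∧ A.IsASubgroup L ∧ L ≠ ⊥ ∧ U ≠ ⊤ ∧
    (∀ X ∈ A.basic, ¬ X ⊆ (U : Set G) → (L : Set G) ⊆ rad X) ∧
    (CondCA A U L ∨ CondCA' A U L ∨ CondCA'' p A U L)


/-- The elements of a group acting on `X` that move `x` within its orbit under a central
element `z`. -/
def blockStabilizer {N X : Type*} [Group N] [MulAction N X] (z : N)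
    (hz : ∀ n : N, n * z = z * n) (x : X) : Subgroup N where
  carrier := {n | ∃ k : ℤ, n • x = z ^ k • x}
  one_mem' := ⟨0, by simp⟩
  mul_mem' := by
    rintro a b ⟨k, hk⟩ ⟨l, hl⟩
    refine ⟨k + l, ?_⟩
    have h : a * z ^ l = z ^ l * a := (show Commute a z from hz a).zpow_right l
    rw [mul_smul, hl, ← mul_smul, h, mul_smul, hk, ← mul_smul, ← zpow_add, add_comm]
  inv_mem' := by
    rintro a ⟨k, hk⟩
    refine ⟨-k, ?_⟩
    have h : a * z ^ (-k) = z ^ (-k) * a := (show Commute a z from hz a).zpow_right _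
    rw [inv_smul_eq_iff, ← mul_smul, h, mul_smul, hk, ← mul_smul, ← zpow_add]
    simp

theorem mem_blockStabilizer {N X : Type*} [Group N] [MulAction N X] {z : N}
    {hz : ∀ n : N, n * z = z * n} {x : X} {n : N} :
    n ∈ blockStabilizer z hz x ↔ ∃ k : ℤ, n • x = z ^ k • x := Iff.rfl

theorem blockStabilizer_index {p : ℕ} (hp : p.Prime) {N X : Type*} [Group N] [Finite N]
    [MulAction N X] [MulAction.IsPretransitive N X] (hX : Nat.card X = p ^ 2)
    {z : N} (hz : ∀ n : N, n * z = z * n) (hzp : z ^ p = 1) {x : X} (hzx : z • x ≠ x) :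
    (blockStabilizer z hz x).index = p := by
  set B := blockStabilizer z hz x with hB
  have hle : MulAction.stabilizer N x ≤ B := fun n hn => ⟨0, by simpa using hn⟩
  have hst : (MulAction.stabilizer N x).index = p ^ 2 := by
    rw [MulAction.index_stabilizer, MulAction.orbit_eq_univ, Set.ncard_univ, hX]
  have hmul := Subgroup.relIndex_mul_index hle
  rw [hst] at hmul
  have hdvd : B.index ∣ p ^ 2 := ⟨_, by rw [← hmul, mul_comm]⟩
  obtain ⟨i, hi, hBi⟩ := (Nat.dvd_prime_pow hp).1 hdvd
  interval_cases i
  · exfalso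
    have htop : B = ⊤ := Subgroup.index_eq_one.1 (by simpa using hBi)
    have hsurj : Function.Surjective (fun g : Subgroup.zpowers z => (g : N) • x) := by
      intro y
      obtain ⟨n, rfl⟩ := MulAction.exists_smul_eq N x y
      obtain ⟨k, hk⟩ := mem_blockStabilizer.1 (show n ∈ B by rw [htop]; trivial)
      exact ⟨⟨z ^ k, k, rfl⟩, hk.symm⟩
    have h1 := Nat.card_le_card_of_surjective _ hsurj
    rw [hX, Nat.card_zpowers] at h1
    have h2 := Nat.le_of_dvd hp.pos (orderOf_dvd_of_pow_eq_one hzp)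
    nlinarith [hp.two_le]
  · simpa using hBi
  · exfalso
    rw [hBi] at hmul
    have h1 : (MulAction.stabilizer N x).relIndex B = 1 :=
      Nat.eq_of_mul_eq_mul_right (pow_pos hp.pos 2) (by simpa using hmul)
    rw [Subgroup.relIndex_eq_one] at h1
    exact hzx (h1 (show z ∈ B from ⟨1, by simp⟩))

theorem blockStabilizer_normal {p : ℕ} (hp : p.Prime) {N X : Type*} [Group N] [Finite N]
    (hN : IsPGroup p N)
    [MulAction N X] [MulAction.IsPretransitive N X] (hX : Nat.card X = p ^ 2)
    {z : N} (hz : ∀ n : N, n * z = z * n) (hzp : z ^ p = 1) {x : X} (hzx : z • x ≠ x) :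
    (blockStabilizer z hz x).Normal := by
  have hi := blockStabilizer_index hp hX hz hzp hzx
  have := Fact.mk hp
  apply Subgroup.normal_of_index_eq_minFac_card
  rw [hi]
  obtain ⟨k, hk⟩ := IsPGroup.iff_card.1 hN
  have : k ≠ 0 := by
    rintro rfl
    have h1 := Subgroup.index_dvd_card (blockStabilizer z hz x)
    rw [hi, hk] at h1
    exact hp.one_lt.ne' (by simpa using h1)
  rw [hk, hp.pow_minFac this]

theorem exists_zpow_smul_of_exists {p : ℕ} (hp : p.Prime) {N X : Type*} [Group N]
    {Q : Subgroup N} [Finite Q] (hQ : IsPGroup p Q)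
    [MulAction N X] (htr : ∀ x y : X, ∃ q ∈ Q, q • x = y) (hX : Nat.card X = p ^ 2)
    {z : N} (hzQ : z ∈ Q) (hz : ∀ n ∈ Q, n * z = z * n) (hzp : z ^ p = 1)
    (hzx : ∀ x : X, z • x ≠ x) {n : N} (hn : n ∈ Q) {x : X} (hnx : ∃ k : ℤ, n • x = z ^ k • x)
    (y : X) : ∃ k : ℤ, n • y = z ^ k • y := by
  have : MulAction.IsPretransitive Q X :=
    ⟨fun x y => let ⟨q, hq, h⟩ := htr x y; ⟨⟨q, hq⟩, h⟩⟩
  have hz' : ∀ n : Q, n * ⟨z, hzQ⟩ = ⟨z, hzQ⟩ * n := fun n => Subtype.ext (hz n n.2)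
  have hnorm := blockStabilizer_normal (x := x) hp hQ hX hz' (Subtype.ext (by simpa using hzp))
    (hzx x)
  obtain ⟨q, hq, rfl⟩ := htr x y
  have h1 : (⟨n, hn⟩ : Q) ∈ blockStabilizer (⟨z, hzQ⟩ : Q) hz' x := hnx
  obtain ⟨k, hk⟩ := hnorm.conj_mem _ h1 ⟨q, hq⟩⁻¹
  refine ⟨k, ?_⟩
  have h2 : (q⁻¹ * n * q⁻¹⁻¹) • x = z ^ k • x := hk
  have h3 : q * z ^ k = z ^ k * q := (show Commute q z from hz q hq).zpow_right k
  rw [inv_inv, mul_smul, mul_smul, inv_smul_eq_iff] at h2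
  rw [h2, ← mul_smul, h3, mul_smul]

theorem exists_pow_mul_zpow_smul {p : ℕ} (hp : p.Prime) {N X : Type*} [Group N]
    {Q : Subgroup N} [Finite Q] (hQ : IsPGroup p Q)
    [MulAction N X] (htr : ∀ x y : X, ∃ q ∈ Q, q • x = y) (hX : Nat.card X = p ^ 2)
    {z : N} (hzQ : z ∈ Q) (hz : ∀ n ∈ Q, n * z = z * n) (hzp : z ^ p = 1)
    (hzx : ∀ x : X, z • x ≠ x) {n q : N} (hn : n ∈ Q) (hq : q ∈ Q) {x : X}
    (hnx : ¬ ∃ k : ℤ, n • x = z ^ k • x) :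
    ∃ k : ℕ, ∃ j : ℤ, (n ^ k * q) • x = z ^ j • x := by
  have : MulAction.IsPretransitive Q X :=
    ⟨fun x y => let ⟨q, hq, h⟩ := htr x y; ⟨⟨q, hq⟩, h⟩⟩
  have hz' : ∀ n : Q, n * ⟨z, hzQ⟩ = ⟨z, hzQ⟩ * n := fun n => Subtype.ext (hz n n.2)
  have hzp' : (⟨z, hzQ⟩ : Q) ^ p = 1 := Subtype.ext (by simpa using hzp)
  have hnorm := blockStabilizer_normal (x := x) hp hQ hX hz' hzp' (hzx x)
  have hidx := blockStabilizer_index (x := x) hp hX hz' hzp' (hzx x)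
  set B := blockStabilizer (⟨z, hzQ⟩ : Q) hz' x
  have := Fact.mk hp
  have h1 : (QuotientGroup.mk ⟨n, hn⟩ : Q ⧸ B) ≠ 1 := by
    intro h
    exact hnx ((QuotientGroup.eq_one_iff _).1 h)
  have h2 : (QuotientGroup.mk ⟨q, hq⟩ : Q ⧸ B)⁻¹ ∈
      Submonoid.powers (QuotientGroup.mk ⟨n, hn⟩ : Q ⧸ B) :=
    mem_powers_of_prime_card (p := p) (by rw [← hidx]; rfl) h1
  obtain ⟨k, hk⟩ := h2
  refine ⟨k, ?_⟩
  have h3 : (⟨n, hn⟩ : Q) ^ k * ⟨q, hq⟩ ∈ B := by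
    rw [← QuotientGroup.eq_one_iff, QuotientGroup.mk_mul, QuotientGroup.mk_pow]
    change (QuotientGroup.mk ⟨n, hn⟩ : Q ⧸ B) ^ k = _ at hk
    rw [hk, inv_mul_cancel]
  exact h3

theorem eq_of_smul_eq_of_commute {N X : Type*} [Group N] [MulAction N X] [FaithfulSMul N X]
    {P : Subgroup N} (htr : ∀ x y : X, ∃ g ∈ P, g • x = y) {c d : N}
    (hc : ∀ g ∈ P, c * g = g * c) (hd : ∀ g ∈ P, d * g = g * d) {x : X} (h : c • x = d • x) :
    c = d := by
  apply eq_of_smul_eq_smul (α := X)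
  intro y
  obtain ⟨g, hg, rfl⟩ := htr x y
  rw [← mul_smul, ← mul_smul, hc g hg, hd g hg, mul_smul, mul_smul, h]

theorem mem_of_commute_of_transitive {N X : Type*} [Group N] [MulAction N X] [FaithfulSMul N X]
    [Nonempty X] {P : Subgroup N} (hcomm : ∀ g ∈ P, ∀ h ∈ P, g * h = h * g)
    (htr : ∀ x y : X, ∃ g ∈ P, g • x = y) {c : N} (hc : ∀ g ∈ P, c * g = g * c) : c ∈ P := by
  obtain ⟨x⟩ := ‹Nonempty X›
  obtain ⟨g, hg, h⟩ := htr x (c • x)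
  rw [eq_of_smul_eq_of_commute htr hc (hcomm g hg) h.symm]
  exact hg

theorem commute_of_forall_exists_zpow_smul {N X : Type*} [Group N] [MulAction N X]
    [FaithfulSMul N X] {z a b : N} (ha : a * z = z * a) (hb : b * z = z * b)
    (ha' : ∀ y : X, ∃ k : ℤ, a • y = z ^ k • y) (hb' : ∀ y : X, ∃ k : ℤ, b • y = z ^ k • y) :
    a * b = b * a := by
  apply eq_of_smul_eq_smul (α := X)
  intro y
  obtain ⟨k, hk⟩ := ha' y
  obtain ⟨l, hl⟩ := hb' y
  have h1 : a * z ^ l = z ^ l * a := (show Commute a z from ha).zpow_right l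
  have h2 : b * z ^ k = z ^ k * b := (show Commute b z from hb).zpow_right k
  rw [mul_smul, mul_smul, hl, hk, ← mul_smul, h1, mul_smul, hk, ← mul_smul b, h2, mul_smul, hl,
    ← mul_smul, ← mul_smul, ← zpow_add, ← zpow_add, add_comm]

theorem not_dvd_ncard_of_sylow {p : ℕ} {N X : Type*} [Group N] [Finite N]
    [MulAction N X] [Finite X] [Nonempty X] {S : Subgroup N} (hidx : ¬ p ∣ S.index)
    (htr : ∀ x y : X, ∃ g ∈ S, g • x = y) (α : N ≃* N) {x x' : X}
    (h : ∀ n ∈ S, n • x = x → α n • x' = x') :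
    ¬ p ∣ {y | ∃ n : N, n • x = x ∧ α n • x' = y}.ncard := by
  intro hdvd
  set H := MulAction.stabilizer N x with hH
  set M := H.map α.toMonoidHom with hM
  have hset : {y | ∃ n : N, n • x = x ∧ α n • x' = y} = MulAction.orbit M x' := by
    ext y
    constructor
    · rintro ⟨n, hn, rfl⟩
      exact ⟨⟨α n, n, hn, rfl⟩, rfl⟩
    · rintro ⟨⟨_, n, hn, rfl⟩, rfl⟩
      exact ⟨n, hn, rfl⟩
  rw [hset, ← MulAction.index_stabilizer] at hdvd
  have hle : ((S ⊓ H).map α.toMonoidHom).subgroupOf M ≤ MulAction.stabilizer M x' := by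
    rintro ⟨_, _⟩ ⟨n, ⟨hn, hnx⟩, rfl⟩
    exact h n hn hnx
  have h1 := hdvd.trans (Subgroup.index_dvd_of_le hle)
  have h2 : (((S ⊓ H).map α.toMonoidHom).subgroupOf M).index = (S ⊓ H).relIndex H :=
    Subgroup.relIndex_map_map_of_injective _ _ α.injective
  rw [h2] at h1
  have hN : MulAction.orbit N x = Set.univ :=
    Set.eq_univ_of_forall fun y => let ⟨g, _, hg⟩ := htr x y; ⟨g, hg⟩
  have hS : MulAction.orbit S x = Set.univ :=
    Set.eq_univ_of_forall fun y => let ⟨g, hgS, hg⟩ := htr x y; ⟨⟨g, hgS⟩, hg⟩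
  have h3 : H.index = Nat.card X := by
    rw [hH, MulAction.index_stabilizer, hN, Set.ncard_univ]
  have h4 : (S ⊓ H).relIndex S = Nat.card X := by
    rw [Subgroup.inf_relIndex_left, ← Set.ncard_univ, ← hS, ← MulAction.index_stabilizer]
    rfl
  have h5 := Subgroup.relIndex_mul_index (inf_le_left : S ⊓ H ≤ S)
  have h6 := Subgroup.relIndex_mul_index (inf_le_right : S ⊓ H ≤ H)
  rw [← h6, h3, h4, mul_comm] at h5
  have h7 := Nat.eq_of_mul_eq_mul_right Nat.card_pos h5
  exact hidx (h7 ▸ h1)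

theorem exists_twisted_fixed_or_not_dvd {p : ℕ} (hp : p.Prime) (hodd : Odd p) {N X : Type*}
    [Group N] [Finite N] [MulAction N X] [FaithfulSMul N X] (hX : Nat.card X = p ^ 2)
    {P : Subgroup N} (hexp : ∀ g ∈ P, g ^ p = 1) (hcomm : ∀ g ∈ P, ∀ h ∈ P, g * h = h * g)
    (htr : ∀ x y : X, ∃ g ∈ P, g • x = y) (α : N ≃* N) (hαP : ∀ g ∈ P, α g = g)
    (hα : ∀ n, α (α (α (α n))) = n) :
    (∃ z ∈ P, z ≠ 1 ∧ ∀ x x' : X, ∃ n : N, n • x = x ∧ α n • x' = z • x') ∨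
      ∃ x x' : X, ¬ p ∣ {y | ∃ n : N, n • x = x ∧ α n • x' = y}.ncard := by
  have := Fact.mk hp
  have hXpos : 0 < Nat.card X := by rw [hX]; exact pow_pos hp.pos 2
  have hXne : Nonempty X := (Nat.card_pos_iff.1 hXpos).1
  have hXfin : Finite X := (Nat.card_pos_iff.1 hXpos).2
  have hPp : IsPGroup p P := fun g => ⟨1, Subtype.ext (by simpa using hexp g g.2)⟩
  obtain ⟨T, hPT⟩ := hPp.exists_le_sylow
  obtain ⟨S, hPS, hS, hidx⟩ : ∃ S : Subgroup N, P ≤ S ∧ IsPGroup p S ∧ ¬ p ∣ S.index :=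
    ⟨T, hPT, T.isPGroup', T.not_dvd_index⟩
  have htrS : ∀ x y : X, ∃ g ∈ S, g • x = y := fun x y =>
    let ⟨g, hg, h⟩ := htr x y; ⟨g, hPS hg, h⟩
  have hfree : ∀ g ∈ P, ∀ x : X, g • x = x → g = 1 := fun g hg x h =>
    eq_of_smul_eq_of_commute htr (hcomm g hg) (d := 1) (by simp) (by simpa using h)
  by_cases hSP : S ≤ P
  · right
    have x := Classical.choice hXne
    refine ⟨x, x, not_dvd_ncard_of_sylow hidx htrS α ?_⟩
    intro n hn hnx
    simp [hfree n (hSP hn) x hnx]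
  -- a central element of the Sylow subgroup
  have hSnt : Nontrivial S := by
    rw [Subgroup.nontrivial_iff_exists_ne_one]
    by_contra! hcon
    exact hSP fun g hg => by rw [hcon g hg]; exact P.one_mem
  obtain ⟨z, hzS, hz, hz1⟩ : ∃ z ∈ S, (∀ n ∈ S, n * z = z * n) ∧ z ≠ 1 := by
    have := hS.center_nontrivial
    obtain ⟨⟨z, hz⟩, hz1⟩ := exists_ne (1 : Subgroup.center S)
    refine ⟨z, z.2, fun n hn => congrArg Subtype.val (Subgroup.mem_center_iff.1 hz ⟨n, hn⟩), ?_⟩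
    intro h
    exact hz1 (Subtype.ext (Subtype.ext h))
  have hzP : z ∈ P := mem_of_commute_of_transitive hcomm htr fun g hg => (hz g (hPS hg)).symm
  have hzp := hexp z hzP
  have hzx : ∀ x : X, z • x ≠ x := fun x h => hz1 (hfree z hzP x h)
  have hαz := hαP z hzP
  -- the image of the Sylow subgroup
  set S' := S.map α.toMonoidHom with hS'
  have hS'p : IsPGroup p S' := hS.map _
  have hPS' : P ≤ S' := fun g hg => ⟨g, hPS hg, hαP g hg⟩
  have htrS' : ∀ x y : X, ∃ g ∈ S', g • x = y := fun x y =>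
    let ⟨g, hg, h⟩ := htr x y; ⟨g, hPS' hg, h⟩
  have hz' : ∀ n ∈ S', n * z = z * n := by
    rintro _ ⟨n, hn, rfl⟩
    change α n * z = z * α n
    rw [← hαz, ← map_mul, hz n hn, map_mul, hαz]
  by_cases hcase : ∀ x : X, ∀ n ∈ S, n • x = x → ∀ y : X, ∃ k : ℤ, α n • y = z ^ k • y
  · by_cases hb : ∃ x x' : X, ∀ n ∈ S, n • x = x → α n • x' = x'
    · obtain ⟨x, x', h⟩ := hb
      exact Or.inr ⟨x, x', not_dvd_ncard_of_sylow hidx htrS α h⟩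
    left
    push Not at hb
    refine ⟨z, hzP, hz1, fun x x' => ?_⟩
    obtain ⟨n, hn, hnx, hne⟩ := hb x x'
    obtain ⟨k, hk⟩ := hcase x n hn hnx x'
    have hzk : z ^ k ≠ 1 := fun h => hne (by rw [hk, h, one_smul])
    have horder : orderOf z = p := orderOf_eq_prime hzp hz1
    have hcard : Nat.card (Subgroup.zpowers z) = p := by rw [Nat.card_zpowers, horder]
    obtain ⟨j, hj⟩ : (⟨z, Subgroup.mem_zpowers z⟩ : Subgroup.zpowers z) ∈
        Submonoid.powers (⟨z ^ k, k, rfl⟩ : Subgroup.zpowers z) :=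
      mem_powers_of_prime_card hcard fun h => hzk (congrArg Subtype.val h)
    have hj' : (z ^ k) ^ j = z := congrArg Subtype.val hj
    have hc : Commute (α n) (z ^ k) :=
      (show Commute (α n) z from hz' _ ⟨n, hn, rfl⟩).zpow_right k
    have hpow : ∀ i : ℕ, (α n) ^ i • x' = (z ^ k) ^ i • x' := by
      intro i
      induction i with
      | zero => simp
      | succ i ih =>
        rw [pow_succ', mul_smul, ih, ← mul_smul, (hc.pow_right i).eq, mul_smul, hk, ← mul_smul,
          ← pow_succ]
    have hfix : ∀ i : ℕ, n ^ i • x = x := by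
      intro i
      induction i with
      | zero => simp
      | succ i ih => rw [pow_succ, mul_smul, hnx, ih]
    exact ⟨n ^ j, hfix j, by rw [map_pow, hpow, hj']⟩
  · exfalso
    push Not at hcase
    obtain ⟨x, n, hn, hnx, y, hny⟩ := hcase
    have hny' : ¬ ∃ k : ℤ, α n • y = z ^ k • y := by
      rintro ⟨k, hk⟩
      exact hny k hk
    obtain ⟨m₀, hm₀S, hm₀P, hm₀⟩ : ∃ m ∈ S, m ∉ P ∧ ∀ g ∈ P, m * g * m⁻¹ ∈ P := by
      have hnil := hS.isNilpotent
      have hlt : P.subgroupOf S < ⊤ := by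
        rw [lt_top_iff_ne_top, Ne, Subgroup.subgroupOf_eq_top]
        exact hSP
      have h1 := Group.normalizerCondition_of_isNilpotent (G := S) _ hlt
      obtain ⟨m, hm, hmP⟩ := SetLike.exists_of_lt h1
      refine ⟨m, m.2, hmP, fun g hg => ?_⟩
      exact (Subgroup.mem_normalizer_iff.1 hm ⟨g, hPS hg⟩).1 hg
    obtain ⟨h, hhP, hh⟩ := htr x (m₀ • x)
    obtain ⟨m, hmS, hmP, hm, hmx⟩ :
        ∃ m ∈ S, m ∉ P ∧ (∀ g ∈ P, m * g * m⁻¹ ∈ P) ∧ m • x = x := by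
      refine ⟨h⁻¹ * m₀, S.mul_mem (S.inv_mem (hPS hhP)) hm₀S, fun hmem => ?_, fun g hg => ?_, ?_⟩
      · exact hm₀P (by simpa using P.mul_mem hhP hmem)
      · have := P.mul_mem (P.mul_mem (P.inv_mem hhP) (hm₀ g hg)) hhP
        simpa [mul_assoc] using this
      · rw [mul_smul, inv_smul_eq_iff, hh]
    have hαm : α m = m := by
      have hc : m⁻¹ * α m ∈ P := by
        apply mem_of_commute_of_transitive hcomm htr
        intro g hg
        have h1 := hαP _ (hm g hg)
        rw [map_mul, map_mul, map_inv, hαP g hg] at h1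
        have h2 : α m * g = m * g * m⁻¹ * α m := by rw [← h1]; group
        rw [mul_assoc, h2]; group
      obtain ⟨c, hcP, hc⟩ : ∃ c ∈ P, α m = m * c := ⟨_, hc, by group⟩
      have h4 : c ^ 4 = 1 := by
        have := hα m
        simp only [hc, map_mul, hαP c hcP] at this
        have h5 : m * c ^ 4 = m := by
          simpa only [pow_succ, pow_zero, one_mul, mul_assoc] using this
        simpa using h5
      have hcop : Nat.Coprime 4 p := by
        rw [show 4 = 2 ^ 2 by norm_num]
        exact Nat.Coprime.pow_left 2 (Nat.coprime_two_left.2 hodd)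
      have h1 : orderOf c = 1 := Nat.eq_one_of_dvd_coprimes hcop
        (orderOf_dvd_of_pow_eq_one h4) (orderOf_dvd_of_pow_eq_one (hexp c hcP))
      rw [hc, orderOf_eq_one_iff.1 h1, mul_one]
    have hmblk := exists_zpow_smul_of_exists hp hS htrS hX hzS hz hzp hzx hmS (x := x)
      ⟨0, by simpa using hmx⟩
    have hnblk := exists_zpow_smul_of_exists hp hS htrS hX hzS hz hzp hzx hn (x := x)
      ⟨0, by simpa using hnx⟩
    have hmn := commute_of_forall_exists_zpow_smul (hz m hmS) (hz n hn) hmblk hnblk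
    refine hmP (mem_of_commute_of_transitive hcomm htr fun g hg => ?_)
    obtain ⟨k, hk⟩ := exists_pow_mul_zpow_smul hp hS'p htrS' hX (hPS' hzP) hz' hzp hzx
      (show α n ∈ S' from ⟨n, hn, rfl⟩) (hPS' hg) hny'
    have hmem : α n ^ k * g ∈ S' := S'.mul_mem (S'.pow_mem ⟨n, hn, rfl⟩ k) (hPS' hg)
    have hblk := exists_zpow_smul_of_exists hp hS'p htrS' hX (hPS' hzP) hz' hzp hzx hmem hk
    have h1 := commute_of_forall_exists_zpow_smul (hz m hmS) (hz' _ hmem) hmblk hblk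
    have h2 : m * (n ^ k * g) = n ^ k * g * m := by
      apply α.injective
      rw [map_mul, map_mul _ _ m, map_mul, hαm, hαP g hg, map_pow, h1]
    have h3 : m * n ^ k = n ^ k * m := (show Commute m n from hmn).pow_right k
    rw [← mul_assoc, h3, mul_assoc, mul_assoc] at h2
    exact mul_left_cancel h2

theorem exists_twisted_fixed_or_not_dvd_of_kernel {p : ℕ} (hp : p.Prime) (hodd : Odd p)
    {N X : Type*} [Group N] [Finite N] [MulAction N X] (hX : Nat.card X = p ^ 2)
    {P : Subgroup N} (hexp : ∀ g ∈ P, g ^ p = 1) (hcomm : ∀ g ∈ P, ∀ h ∈ P, g * h = h * g)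
    (htr : ∀ x y : X, ∃ g ∈ P, g • x = y) (α : N ≃* N) (hαP : ∀ g ∈ P, α g = g)
    (hα : ∀ n, α (α (α (α n))) = n)
    (hker : ∀ n : N, (∀ x : X, n • x = x) → ∀ x : X, α n • x = x) :
    (∃ z ∈ P, z ≠ 1 ∧ ∀ x x' : X, ∃ n : N, n • x = x ∧ α n • x' = z • x') ∨
      ∃ x x' : X, ¬ p ∣ {y | ∃ n : N, n • x = x ∧ α n • x' = y}.ncard := by
  set φ := MulAction.toPermHom N X with hφ
  have hmem : ∀ n : N, n ∈ φ.ker ↔ ∀ x : X, n • x = x := by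
    intro n
    rw [MonoidHom.mem_ker, Equiv.ext_iff]
    rfl
  have hmap : φ.ker.map α.toMonoidHom = φ.ker := by
    apply le_antisymm
    · rintro _ ⟨n, hn, rfl⟩
      exact (hmem _).2 (hker n ((hmem n).1 hn))
    · intro n hn
      refine ⟨α (α (α n)), ?_, hα n⟩
      exact (hmem _).2 (hker _ (hker _ (hker _ ((hmem n).1 hn))))
  let _ : MulAction (N ⧸ φ.ker) X := MulAction.compHom X (QuotientGroup.kerLift φ)
  have hsmul : ∀ (n : N) (x : X), (QuotientGroup.mk n : N ⧸ φ.ker) • x = n • x :=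
    fun _ _ => rfl
  have hfaith : FaithfulSMul (N ⧸ φ.ker) X := by
    constructor
    intro a b h
    apply QuotientGroup.kerLift_injective φ
    ext x
    exact h x
  let α' : N ⧸ φ.ker ≃* N ⧸ φ.ker := QuotientGroup.congr _ _ α hmap
  have hα'mk : ∀ n : N, α' (QuotientGroup.mk n) = QuotientGroup.mk (α n) := fun _ => rfl
  have key := exists_twisted_fixed_or_not_dvd hp hodd (N := N ⧸ φ.ker) (X := X) hX
    (P := P.map (QuotientGroup.mk' φ.ker)) ?_ ?_ ?_ α' ?_ ?_
  · rcases key with ⟨_, ⟨z, hz, rfl⟩, hz1, h⟩ | ⟨x, x', h⟩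
    · refine Or.inl ⟨z, hz, ?_, fun x x' => ?_⟩
      · rintro rfl
        exact hz1 (map_one _)
      · obtain ⟨n, h1, h2⟩ := h x x'
        obtain ⟨n, rfl⟩ := QuotientGroup.mk_surjective n
        exact ⟨n, h1, h2⟩
    · refine Or.inr ⟨x, x', ?_⟩
      convert h using 5 with y
      constructor
      · rintro ⟨n, h1, h2⟩
        exact ⟨QuotientGroup.mk n, h1, h2⟩
      · rintro ⟨n, h1, h2⟩
        obtain ⟨n, rfl⟩ := QuotientGroup.mk_surjective n
        exact ⟨n, h1, h2⟩
  · rintro _ ⟨g, hg, rfl⟩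
    rw [← map_pow, hexp g hg, map_one]
  · rintro _ ⟨g, hg, rfl⟩ _ ⟨h, hh, rfl⟩
    rw [← map_mul, hcomm g hg h hh, map_mul]
  · intro x y
    obtain ⟨g, hg, h⟩ := htr x y
    exact ⟨_, ⟨g, hg, rfl⟩, h⟩
  · rintro _ ⟨g, hg, rfl⟩
    exact congrArg _ (hαP g hg)
  · intro n
    obtain ⟨n, rfl⟩ := QuotientGroup.mk_surjective n
    simp only [hα'mk, hα]

/-- Frobenius relation for a permutation preserving the arc set of a Cayley digraph over an
abelian group. -/
theorem card_pow_fiber_eq {H : Type*} [CommGroup H] [Finite H] {q : ℕ} (hq : q.Prime)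
    (k : Equiv.Perm H) {X : Set H} (hX : ∀ a b : H, b * a⁻¹ ∈ X ↔ k b * (k a)⁻¹ ∈ X) (a b : H) :
    (({x | x ∈ X ∧ x ^ q = k b * (k a)⁻¹}.ncard : ℕ) : ZMod q) =
      ({x | x ∈ X ∧ x ^ q = b * a⁻¹}.ncard : ℕ) := by
  classical
  have := Fact.mk hq
  have := Fintype.ofFinite H
  let Comm : MonoidAlgebra (ZMod q) H → Prop := fun c =>
    ∀ a b : H, c.coeff (k b * (k a)⁻¹) = c.coeff (b * a⁻¹)
  have hmul_apply : ∀ (c d : MonoidAlgebra (ZMod q) H) (a b : H),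
      (c * d).coeff (b * a⁻¹) = ∑ y : H, c.coeff (b * y⁻¹) * d.coeff (y * a⁻¹) := by
    intro c d a b
    rw [MonoidAlgebra.coeff_mul_apply_right, Finsupp.sum_fintype _ _ (by simp),
      ← Equiv.sum_comp (Equiv.mulRight a⁻¹)]
    refine Finset.sum_congr rfl fun y _ => ?_
    simp
  have hmul : ∀ c d, Comm c → Comm d → Comm (c * d) := by
    intro c d hc hd a b
    rw [hmul_apply, hmul_apply, ← Equiv.sum_comp k]
    exact Finset.sum_congr rfl fun y _ => by rw [hc, hd]
  have hpow : ∀ c, Comm c → ∀ n : ℕ, Comm (c ^ (n + 1)) := by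
    intro c hc n
    induction n with
    | zero => simpa using hc
    | succ n ih => rw [pow_succ]; exact hmul _ _ ih hc
  let c : MonoidAlgebra (ZMod q) H := ∑ x ∈ X.toFinset, MonoidAlgebra.single x 1
  have hc_apply : ∀ y, c.coeff y = if y ∈ X then 1 else 0 := by
    intro y
    simp [c, MonoidAlgebra.coeff_sum, Finsupp.single_apply]
  have hc : Comm c := by
    intro a b
    rw [hc_apply, hc_apply]
    exact if_congr (hX a b).symm rfl rfl
  have hcq : ∀ y, (c ^ q).coeff y = ({x | x ∈ X ∧ x ^ q = y}.ncard : ℕ) := by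
    intro y
    have hchar : CharP (MonoidAlgebra (ZMod q) H) q :=
      charP_of_injective_algebraMap (algebraMap (ZMod q) (MonoidAlgebra (ZMod q) H)).injective q
    have hexp : ExpChar (MonoidAlgebra (ZMod q) H) q := ExpChar.prime hq
    rw [sum_pow_char q]
    simp only [MonoidAlgebra.single_pow, one_pow, MonoidAlgebra.coeff_sum, MonoidAlgebra.coeff_single,
      Finsupp.coe_finsetSum, Finset.sum_apply, Finsupp.single_apply]
    rw [Finset.sum_boole, Set.ncard_eq_toFinset_card']
    congr 2
    ext x
    simp
  have h := hpow c hc (q - 1) a b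
  rw [Nat.sub_add_cancel hq.one_le] at h
  rwa [hcq, hcq] at h

theorem exists_isPGroup_conj {p : ℕ} (hp : p.Prime) {M : Type*} [Group M] [Finite M]
    {C A B : Subgroup M} (hA : A ≤ C) (hB : B ≤ C) (hAp : IsPGroup p A) (hBp : IsPGroup p B) :
    ∃ S ≤ C, IsPGroup p S ∧ A ≤ S ∧ ∃ c ∈ C, ∀ b ∈ B, c * b * c⁻¹ ∈ S := by
  have := Fact.mk hp
  have hA' : IsPGroup p (A.subgroupOf C) :=
    hAp.of_equiv (Subgroup.subgroupOfEquivOfLe hA).symm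
  have hB' : IsPGroup p (B.subgroupOf C) :=
    hBp.of_equiv (Subgroup.subgroupOfEquivOfLe hB).symm
  obtain ⟨S, hS⟩ := hA'.exists_le_sylow
  obtain ⟨T, hT⟩ := hB'.exists_le_sylow
  obtain ⟨c, hc⟩ := MulAction.exists_smul_eq C T S
  refine ⟨(S : Subgroup C).map C.subtype, Subgroup.map_subtype_le _, S.isPGroup'.map _, ?_, c, c.2,
    ?_⟩
  · intro a ha
    exact ⟨⟨a, hA ha⟩, hS (show (⟨a, hA ha⟩ : C) ∈ A.subgroupOf C from ha), rfl⟩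
  · intro b hb
    refine ⟨c * ⟨b, hB hb⟩ * c⁻¹, ?_, rfl⟩
    rw [← hc]
    have h1 : (⟨b, hB hb⟩ : C) ∈ T := hT (show (⟨b, hB hb⟩ : C) ∈ B.subgroupOf C from hb)
    exact Subgroup.smul_mem_pointwise_smul _ (MulAut.conj c) (T : Subgroup C) h1

/-- A permutation group is two-closed if it contains every permutation that agrees with one of its
members at each pair of points. -/
def TwoClosed {G : Type*} (K : Subgroup (Equiv.Perm G)) : Prop :=
  ∀ f : Equiv.Perm G, (∀ a b, ∃ k ∈ K, k a = f a ∧ k b = f b) → f ∈ K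

/-- A regular permutation representation of `G` on itself. -/
def IsRegularRep {G : Type*} [Group G] (ρ : G →* Equiv.Perm G) : Prop :=
  ∀ a, Function.Bijective fun u => ρ u a

/-- Some member of `K` conjugates the image of `ρ` into the translations. -/
def ConjIntoTranslations {G : Type*} [Group G] (K : Subgroup (Equiv.Perm G))
    (ρ : G →* Equiv.Perm G) : Prop :=
  ∃ k ∈ K, ∀ u, ∃ g, k * ρ u * k⁻¹ = Equiv.mulLeft g

/-- The representation `ρ` conjugated by `k`. -/
def conjRep {G : Type*} [Group G] (k : Equiv.Perm G) (ρ : G →* Equiv.Perm G) :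
    G →* Equiv.Perm G := (MulAut.conj k).toMonoidHom.comp ρ

@[simp]
theorem conjRep_apply {G : Type*} [Group G] (k : Equiv.Perm G) (ρ : G →* Equiv.Perm G) (u : G) :
    conjRep k ρ u = k * ρ u * k⁻¹ := rfl

theorem IsRegularRep.conjRep {G : Type*} [Group G] {ρ : G →* Equiv.Perm G} (h : IsRegularRep ρ)
    (k : Equiv.Perm G) : IsRegularRep (conjRep k ρ) := fun a =>
  k.bijective.comp (h (k⁻¹ a))

theorem ConjIntoTranslations.of_conjRep {G : Type*} [Group G] {K : Subgroup (Equiv.Perm G)}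
    {ρ : G →* Equiv.Perm G} {k : Equiv.Perm G} (hk : k ∈ K)
    (h : ConjIntoTranslations K (Paper.conjRep k ρ)) : ConjIntoTranslations K ρ := by
  obtain ⟨l, hl, h⟩ := h
  refine ⟨l * k, K.mul_mem hl hk, fun u => ?_⟩
  obtain ⟨g, hg⟩ := h u
  exact ⟨g, by rw [← hg]; simp [mul_assoc]⟩

theorem conjRep_mem {G : Type*} [Group G] {K : Subgroup (Equiv.Perm G)}
    {ρ : G →* Equiv.Perm G} (h : ∀ u, ρ u ∈ K) {k : Equiv.Perm G} (hk : k ∈ K) (u : G) :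
    conjRep k ρ u ∈ K := K.mul_mem (K.mul_mem hk (h u)) (K.inv_mem hk)

theorem eq_mulLeft_of_commute {G : Type*} [CommGroup G] {f : Equiv.Perm G}
    (h : ∀ g, f * Equiv.mulLeft g = Equiv.mulLeft g * f) : f = Equiv.mulLeft (f 1) := by
  ext g
  have := Equiv.ext_iff.1 (h g) 1
  simpa [mul_comm] using this

theorem IsRegularRep.eq_of_commute {G : Type*} [CommGroup G] {ρ : G →* Equiv.Perm G}
    (hρ : IsRegularRep ρ) {f : Equiv.Perm G} (h : ∀ u, f * ρ u = ρ u * f) : ∃ v, f = ρ v := by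
  obtain ⟨v, hv⟩ := (hρ 1).2 (f 1)
  refine ⟨v, ?_⟩
  ext g
  obtain ⟨u, rfl⟩ := (hρ 1).2 g
  have h1 := Equiv.ext_iff.1 (h u) 1
  simp only [Equiv.Perm.mul_apply] at h1
  change f (ρ u 1) = ρ v (ρ u 1)
  rw [h1, ← Equiv.Perm.mul_apply (ρ v), ← map_mul, mul_comm, map_mul, Equiv.Perm.mul_apply]
  exact congrArg _ hv.symm

theorem IsRegularRep.injective {G : Type*} [Group G] {ρ : G →* Equiv.Perm G}
    (hρ : IsRegularRep ρ) : Function.Injective ρ := fun u v h =>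
  (hρ 1).1 (by simp only [h])

/-- If a member of `K` conjugates all translations into the image of `ρ`, its inverse conjugates
the image of `ρ` into the translations. -/
theorem conjIntoTranslations_of_forall {G : Type*} [CommGroup G] {K : Subgroup (Equiv.Perm G)}
    {ρ : G →* Equiv.Perm G} {y : Equiv.Perm G} (hy : y ∈ K)
    (h : ∀ v, ∃ u, y * Equiv.mulLeft v * y⁻¹ = ρ u) : ConjIntoTranslations K ρ := by
  refine ⟨y⁻¹, K.inv_mem hy, fun u => ⟨_, eq_mulLeft_of_commute fun v => ?_⟩⟩
  obtain ⟨w, hw⟩ := h v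
  have h1 : Equiv.mulLeft v = y⁻¹ * ρ w * y := by rw [← hw]; group
  have h2 : ρ u * ρ w = ρ w * ρ u := by rw [← map_mul, mul_comm, map_mul]
  calc y⁻¹ * ρ u * y⁻¹⁻¹ * Equiv.mulLeft v = y⁻¹ * (ρ u * ρ w) * y := by rw [h1]; group
    _ = Equiv.mulLeft v * (y⁻¹ * ρ u * y⁻¹⁻¹) := by rw [h2, h1]; group

/-- `X` is a set of differences preserved by every member of `K`. -/
def DiffInvariant {G : Type*} [Group G] (K : Subgroup (Equiv.Perm G)) (X : Set G) : Prop :=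
  ∀ k ∈ K, ∀ a b, b * a⁻¹ ∈ X → k b * (k a)⁻¹ ∈ X

theorem DiffInvariant.iff {G : Type*} [Group G] {K : Subgroup (Equiv.Perm G)} {X : Set G}
    (h : DiffInvariant K X) {k : Equiv.Perm G} (hk : k ∈ K) (a b : G) :
    b * a⁻¹ ∈ X ↔ k b * (k a)⁻¹ ∈ X :=
  ⟨h k hk a b, fun h1 => by simpa using h k⁻¹ (K.inv_mem hk) _ _ h1⟩

theorem DiffInvariant.inv {G : Type*} [Group G] {K : Subgroup (Equiv.Perm G)} {X : Set G}
    (h : DiffInvariant K X) : DiffInvariant K X⁻¹ := fun k hk a b hab => by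
  have := h k hk b a (by simpa using hab)
  simpa using this

/-- The permutation induced on a quotient by a member of a group preserving the cosets. -/
def quotPerm {G : Type*} [CommGroup G] {K : Subgroup (Equiv.Perm G)} {L : Subgroup G}
    (hL : DiffInvariant K (L : Set G)) {k : Equiv.Perm G} (hk : k ∈ K) : Equiv.Perm (G ⧸ L) :=
  Quotient.congr k fun a b => by
    have h1 := hL.iff hk b a
    rw [QuotientGroup.leftRel_apply, QuotientGroup.leftRel_apply, ← L.inv_mem_iff,
      ← L.inv_mem_iff (x := (k a)⁻¹ * k b)]
    simpa [mul_comm] using h1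

@[simp]
theorem quotPerm_mk {G : Type*} [CommGroup G] {K : Subgroup (Equiv.Perm G)} {L : Subgroup G}
    (hL : DiffInvariant K (L : Set G)) {k : Equiv.Perm G} (hk : k ∈ K) (a : G) :
    quotPerm hL hk (QuotientGroup.mk a) = QuotientGroup.mk (k a) := rfl

/-- The orbital of `x`: the images of `x` under the members of `K` fixing `1`. -/
def orbital {G : Type*} [Group G] (K : Subgroup (Equiv.Perm G)) (x : G) : Set G :=
  {g | ∃ k ∈ K, k 1 = 1 ∧ k x = g}

theorem mem_orbital_self {G : Type*} [Group G] (K : Subgroup (Equiv.Perm G)) (x : G) :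
    x ∈ orbital K x := ⟨1, K.one_mem, rfl, rfl⟩

theorem orbital_diffInvariant {G : Type*} [CommGroup G] {K : Subgroup (Equiv.Perm G)}
    (hK : ∀ g, Equiv.mulLeft g ∈ K) (x : G) : DiffInvariant K (orbital K x) := by
  rintro k hk a b ⟨l, hl, h1, h2⟩
  refine ⟨Equiv.mulLeft (k a)⁻¹ * k * Equiv.mulLeft a * l,
    K.mul_mem (K.mul_mem (K.mul_mem (hK _) hk) (hK _)) hl, ?_, ?_⟩
  · simp [h1]
  · simp [h2, mul_comm]

theorem perm_apply_inv {α : Type*} (k : Equiv.Perm α) (x : α) : k (k⁻¹ x) = x :=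
  k.apply_symm_apply x

theorem perm_inv_apply {α : Type*} (k : Equiv.Perm α) (x : α) : k⁻¹ (k x) = x :=
  k.symm_apply_apply x

/-- A splitting of `G` as an extension of a cyclic group of order four, generated by `t`, by an
elementary abelian group of order `p ^ 2`, the kernel of `χ`. -/
structure Frame (p : ℕ) (G : Type*) [CommGroup G] where
  χ : G → ZMod 4
  χ_mul : ∀ a b, χ (a * b) = χ a + χ b
  t : G
  χ_t : χ t = 1
  t_pow : t ^ 4 = 1
  pow_eq_one : ∀ u, χ u = 0 → u ^ p = 1
  card_ker : Nat.card {u // χ u = 0} = p ^ 2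

namespace Frame

variable {p : ℕ} {G : Type*} [CommGroup G] (F : Frame p G)

@[simp]
theorem χ_one : F.χ 1 = 0 := by
  have := F.χ_mul 1 1
  simpa using this

@[simp]
theorem χ_inv (a : G) : F.χ a⁻¹ = -F.χ a := by
  have := F.χ_mul a a⁻¹
  rw [mul_inv_cancel, χ_one] at this
  exact eq_neg_of_add_eq_zero_right this.symm

@[simp]
theorem χ_pow (a : G) (n : ℕ) : F.χ (a ^ n) = n * F.χ a := by
  induction n with
  | zero => simp
  | succ n ih => rw [pow_succ, F.χ_mul, ih]; push_cast; ring

/-- The kernel of `χ`. -/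
def ker : Subgroup G where
  carrier := {u | F.χ u = 0}
  one_mem' := F.χ_one
  mul_mem' := by
    intro a b ha hb
    change F.χ (a * b) = 0
    rw [F.χ_mul, show F.χ a = 0 from ha, show F.χ b = 0 from hb, add_zero]
  inv_mem' := by
    intro a ha
    change F.χ a⁻¹ = 0
    rw [F.χ_inv, show F.χ a = 0 from ha, neg_zero]

theorem mem_ker {u : G} : u ∈ F.ker ↔ F.χ u = 0 := Iff.rfl

theorem card_ker' : Nat.card F.ker = p ^ 2 := F.card_ker

theorem div_mem_ker {a b : G} (h : F.χ b = F.χ a) : b * a⁻¹ ∈ F.ker := by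
  rw [mem_ker, F.χ_mul, χ_inv, h, add_neg_cancel]

theorem exists_ker_mul {a b : G} (h : F.χ b = F.χ a) : ∃ u ∈ F.ker, b = u * a :=
  ⟨b * a⁻¹, F.div_mem_ker h, by simp⟩

theorem exists_pow_t_mul (a : G) : ∃ n : ℕ, ∃ u ∈ F.ker, a = F.t ^ n * u := by
  obtain ⟨u, hu, h⟩ := F.exists_ker_mul (a := F.t ^ (F.χ a).val) (b := a) (by simp [F.χ_t])
  exact ⟨_, u, hu, by rw [mul_comm]; exact h⟩

theorem pow_mul_mem_of_odd (hodd : Odd p) {M : Subgroup G} {u : G} (hu : u ∈ F.ker)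
    (h : u ^ 4 ∈ M) : u ∈ M := by
  have hcop : Nat.Coprime 4 p := by
    rw [show 4 = 2 ^ 2 by norm_num]
    exact Nat.Coprime.pow_left 2 (Nat.coprime_two_left.2 hodd)
  have h1 : u ^ p ∈ M := by rw [F.pow_eq_one u hu]; exact M.one_mem
  have h2 := Nat.isCoprime_iff_coprime.2 hcop
  obtain ⟨a, b, hab⟩ := h2
  have h3 : u = (u ^ 4) ^ a * (u ^ p) ^ b := by
    rw [← zpow_natCast, ← zpow_natCast, ← zpow_mul, ← zpow_mul, ← zpow_add]
    conv_lhs => rw [← zpow_one u, ← hab]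
    congr 1
    push_cast
    ring
  rw [h3]
  exact M.mul_mem (M.zpow_mem h _) (M.zpow_mem h1 _)

theorem t_pow_sq (hodd : Odd p) (j : ℕ) : ((F.t ^ j) ^ p) ^ p = F.t ^ j := by
  obtain ⟨k, rfl⟩ := hodd
  rw [← pow_mul, ← pow_mul,
    show j * ((2 * k + 1) * (2 * k + 1)) = 4 * (j * (k * k + k)) + j by ring, pow_add, pow_mul,
    F.t_pow, one_pow, one_mul]

/-- Every member of `K` shifts `χ` by a constant. -/
def Shifts (K : Subgroup (Equiv.Perm G)) : Prop := ∀ k ∈ K, ∃ a, ∀ ω, F.χ (k ω) = F.χ ω + a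

theorem Shifts.eq_of_fix {F : Frame p G} {K : Subgroup (Equiv.Perm G)} (h : F.Shifts K)
    {k : Equiv.Perm G} (hk : k ∈ K) {x y : G} (hx : F.χ (k x) = F.χ x) :
    F.χ (k y) = F.χ y := by
  obtain ⟨a, ha⟩ := h k hk
  have h1 := ha x
  rw [hx] at h1
  rw [ha y, show a = 0 by simpa using h1, add_zero]

theorem Shifts.diff {F : Frame p G} {K : Subgroup (Equiv.Perm G)} (h : F.Shifts K)
    {k : Equiv.Perm G} (hk : k ∈ K) (x y : G) :
    F.χ (k x) - F.χ (k y) = F.χ x - F.χ y := by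
  obtain ⟨a, ha⟩ := h k hk
  rw [ha x, ha y]
  ring

/-- The elements `l` of the kernel such that every pair `(a, b)` at `χ`-distance `j` can be moved to
`(a, l * b)` by a member of `K`. -/
def linkSubgroup (K : Subgroup (Equiv.Perm G)) (j : ZMod 4) : Subgroup G where
  carrier := {l | F.χ l = 0 ∧ ∀ a b, F.χ b = F.χ a + j → ∃ k ∈ K, k a = a ∧ k b = l * b}
  one_mem' := ⟨F.χ_one, fun a b _ => ⟨1, K.one_mem, rfl, by simp⟩⟩
  mul_mem' := by
    rintro x y ⟨hx, hx'⟩ ⟨hy, hy'⟩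
    refine ⟨by rw [F.χ_mul, hx, hy, add_zero], fun a b hab => ?_⟩
    obtain ⟨k, hk, h1, h2⟩ := hy' a b hab
    obtain ⟨l, hl, h3, h4⟩ := hx' a (y * b) (by rw [F.χ_mul, hy, zero_add, hab])
    exact ⟨l * k, K.mul_mem hl hk, by simp [h1, h3], by simp [h2, h4, mul_assoc]⟩
  inv_mem' := by
    rintro x ⟨hx, hx'⟩
    refine ⟨by rw [F.χ_inv, hx, neg_zero], fun a b hab => ?_⟩
    obtain ⟨k, hk, h1, h2⟩ := hx' a (x⁻¹ * b) (by rw [F.χ_mul, F.χ_inv, hx, neg_zero, zero_add, hab])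
    refine ⟨k⁻¹, K.inv_mem hk, ?_, ?_⟩
    · rw [Equiv.Perm.inv_eq_iff_eq, h1]
    · rw [Equiv.Perm.inv_eq_iff_eq, h2, mul_inv_cancel_left]

theorem linkSubgroup_le (K : Subgroup (Equiv.Perm G)) (j : ZMod 4) :
    F.linkSubgroup K j ≤ F.ker := fun _ h => h.1

/-- It suffices to move pairs whose second entry is a fixed point. -/
theorem mem_linkSubgroup_of_right {K : Subgroup (Equiv.Perm G)} (hK : ∀ g, Equiv.mulLeft g ∈ K)
    {j : ZMod 4} {l b₀ : G} (hl : F.χ l = 0)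
    (h : ∀ a, F.χ b₀ = F.χ a + j → ∃ k ∈ K, k a = a ∧ k b₀ = l * b₀) :
    l ∈ F.linkSubgroup K j := by
  refine ⟨hl, fun a b hab => ?_⟩
  obtain ⟨k, hk, h1, h2⟩ := h (b₀ * b⁻¹ * a) (by
    rw [F.χ_mul, F.χ_mul, F.χ_inv, hab]; ring)
  refine ⟨Equiv.mulLeft (b₀ * b⁻¹)⁻¹ * k * Equiv.mulLeft (b₀ * b⁻¹),
    K.mul_mem (K.mul_mem (hK _) hk) (hK _), ?_, ?_⟩
  · simp only [Equiv.Perm.mul_apply, Equiv.coe_mulLeft, h1]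
    group
  · simp only [Equiv.Perm.mul_apply, Equiv.coe_mulLeft, inv_mul_cancel_right, h2]
    simp [mul_comm, mul_left_comm]

theorem linkSubgroup_diffInvariant {K : Subgroup (Equiv.Perm G)}
    (hK : ∀ g, Equiv.mulLeft g ∈ K) (hχ : F.Shifts K) (j : ZMod 4) :
    DiffInvariant K (F.linkSubgroup K j : Set G) := by
  intro k hk a b hab
  have h0 : F.χ (k b * (k a)⁻¹) = 0 := by
    rw [F.χ_mul, F.χ_inv, ← sub_eq_add_neg, hχ.diff hk, sub_eq_add_neg, ← F.χ_inv, ← F.χ_mul]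
    exact hab.1
  refine F.mem_linkSubgroup_of_right hK (b₀ := k a) h0 fun c hc => ?_
  obtain ⟨l, hl, h1, h2⟩ := hab.2 (k⁻¹ c) a (by
    have h3 := hχ.diff hk a (k⁻¹ c)
    rw [perm_apply_inv, hc] at h3
    rw [← sub_eq_iff_eq_add', ← h3]; ring)
  refine ⟨k * l * k⁻¹, K.mul_mem (K.mul_mem hk hl) (K.inv_mem hk), ?_, ?_⟩
  · rw [Equiv.Perm.mul_apply, Equiv.Perm.mul_apply, h1, perm_apply_inv]
  · rw [Equiv.Perm.mul_apply, Equiv.Perm.mul_apply, perm_inv_apply, h2]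
    simp

theorem exists_not_dvd_orbital_of_bot [Finite G] (hp : p.Prime) (hodd : Odd p)
    {K : Subgroup (Equiv.Perm G)} (hK : ∀ g, Equiv.mulLeft g ∈ K) (hχ : F.Shifts K) (j : ℕ)
    (hbot : F.linkSubgroup K j = ⊥) :
    ∃ x, F.χ x = j ∧ ¬ p ∣ (orbital K x).ncard := by
  let N : Subgroup (Equiv.Perm G) :=
    { carrier := {k | k ∈ K ∧ ∀ ω, F.χ (k ω) = F.χ ω}
      one_mem' := ⟨K.one_mem, fun _ => rfl⟩
      mul_mem' := fun {a b} ha hb => ⟨K.mul_mem ha.1 hb.1, fun ω => by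
        rw [Equiv.Perm.mul_apply, ha.2, hb.2]⟩
      inv_mem' := fun {a} ha => ⟨K.inv_mem ha.1, fun ω => by
        rw [← ha.2 (a⁻¹ ω), perm_apply_inv]⟩ }
  have hN : ∀ u ∈ F.ker, Equiv.mulLeft u ∈ N := fun u hu =>
    ⟨hK u, fun ω => by simp [F.χ_mul, show F.χ u = 0 from hu]⟩
  let X := {u // F.χ u = 0}
  let _ : MulAction N X :=
    { smul := fun n x => ⟨n.1 x.1, by rw [n.2.2, x.2]⟩
      one_smul := fun _ => rfl
      mul_smul := fun _ _ _ => rfl }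
  have hsmul : ∀ (n : N) (x : X), ((n • x : X) : G) = n.1 x.1 := fun _ _ => rfl
  let s : Equiv.Perm G := Equiv.mulLeft (F.t ^ j)
  have hs4 : s ^ 4 = 1 := by
    simp only [s, Equiv.pow_mulLeft, ← pow_mul, mul_comm j 4]
    ext x
    simp [pow_mul, F.t_pow]
  have hsK : s ∈ K := hK _
  have hconj : ∀ n ∈ N, s⁻¹ * n * s ∈ N := fun n hn =>
    ⟨K.mul_mem (K.mul_mem (K.inv_mem hsK) hn.1) hsK, fun ω => by
      simp [s, F.χ_mul, hn.2]⟩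
  have hconj' : ∀ n ∈ N, s * n * s⁻¹ ∈ N := fun n hn =>
    ⟨K.mul_mem (K.mul_mem hsK hn.1) (K.inv_mem hsK), fun ω => by
      simp [s, F.χ_mul, hn.2]⟩
  let α : N ≃* N :=
    { toFun := fun n => ⟨s⁻¹ * n * s, hconj n n.2⟩
      invFun := fun n => ⟨s * n * s⁻¹, hconj' n n.2⟩
      left_inv := fun n => Subtype.ext (by simp [mul_assoc])
      right_inv := fun n => Subtype.ext (by simp [mul_assoc])
      map_mul' := fun a b => Subtype.ext (by simp [mul_assoc]) }
  have hα : ∀ (n : N) (x : G), (α n).1 x = (F.t ^ j)⁻¹ * n.1 (F.t ^ j * x) := fun n x => by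
    simp [α, s]
  let P : Subgroup N :=
    { carrier := {n | ∃ u, F.χ u = 0 ∧ n.1 = Equiv.mulLeft u}
      one_mem' := ⟨1, F.χ_one, by simp⟩
      mul_mem' := by
        rintro a b ⟨u, hu, h⟩ ⟨v, hv, h'⟩
        exact ⟨u * v, by rw [F.χ_mul, hu, hv, add_zero], by simp [h, h']⟩
      inv_mem' := by
        rintro a ⟨u, hu, h⟩
        exact ⟨u⁻¹, by rw [F.χ_inv, hu, neg_zero], by simp [h]⟩ }
  have key := exists_twisted_fixed_or_not_dvd_of_kernel hp hodd (N := N) (X := X) F.card_ker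
    (P := P) ?_ ?_ ?_ α ?_ ?_ ?_
  · rcases key with ⟨z, ⟨u, hu, hzu⟩, hz1, h⟩ | ⟨x, x', h⟩
    · exfalso
      have hmem : u ∈ F.linkSubgroup K j := by
        refine F.mem_linkSubgroup_of_right hK (b₀ := F.t ^ j) hu fun a ha => ?_
        have ha0 : F.χ a = 0 := by simpa [F.χ_t] using ha
        obtain ⟨n, h1, h2⟩ := h ⟨a, ha0⟩ ⟨1, F.χ_one⟩
        refine ⟨n, n.2.1, congrArg Subtype.val h1, ?_⟩
        have h3 := congrArg Subtype.val h2
        rw [hsmul, hsmul, hα, hzu] at h3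
        simp only [mul_one, Equiv.coe_mulLeft, inv_mul_eq_iff_eq_mul] at h3
        rw [h3, mul_comm]
      rw [hbot, Subgroup.mem_bot] at hmem
      apply hz1
      apply Subtype.ext
      rw [hzu, hmem]
      simp
    · refine ⟨F.t ^ j * x' * x.1⁻¹, by simp [F.χ_mul, F.χ_t, x.2, x'.2], ?_⟩
      convert h using 2
      rw [← Set.ncard_image_of_injective (f := fun y : X => F.t ^ j * y.1 * x.1⁻¹) _
        (fun a b hab => Subtype.ext (by simpa using hab))]
      congr 1
      ext g
      constructor
      · rintro ⟨k, hk, h1, rfl⟩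
        let n₀ : Equiv.Perm G := Equiv.mulLeft x.1 * k * Equiv.mulLeft x.1⁻¹
        have hn₀ : n₀ ∈ N := by
          have hn₀K : n₀ ∈ K := K.mul_mem (K.mul_mem (hK _) hk) (hK _)
          refine ⟨hn₀K, fun ω => hχ.eq_of_fix hn₀K (x := x.1) ?_⟩
          simp [n₀, h1]
        refine ⟨α ⟨n₀, hn₀⟩ • x', ⟨⟨n₀, hn₀⟩, Subtype.ext ?_, rfl⟩, ?_⟩
        · rw [hsmul]
          simp [n₀, h1]
        · simp only [hsmul, hα]
          simp [n₀, mul_comm, mul_left_comm]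
      · rintro ⟨_, ⟨n, h1, rfl⟩, rfl⟩
        have h1' : n.1 x.1 = x.1 := congrArg Subtype.val h1
        refine ⟨Equiv.mulLeft x.1⁻¹ * n * Equiv.mulLeft x.1,
          K.mul_mem (K.mul_mem (hK _) n.2.1) (hK _), ?_, ?_⟩
        · simp [h1']
        · simp only [hsmul, hα]
          simp [mul_comm]
  · rintro n ⟨u, hu, h⟩
    apply Subtype.ext
    rw [Subgroup.coe_pow, h, Equiv.pow_mulLeft]
    simp [F.pow_eq_one u hu]
  · rintro a ⟨u, hu, h⟩ b ⟨v, hv, h'⟩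
    apply Subtype.ext
    rw [Subgroup.coe_mul, Subgroup.coe_mul, h, h', ← Equiv.mulLeft_mul, mul_comm u, Equiv.mulLeft_mul]
  · intro x y
    have hu : F.χ (y.1 * x.1⁻¹) = 0 := by simp [F.χ_mul, x.2, y.2]
    refine ⟨⟨Equiv.mulLeft (y.1 * x.1⁻¹), hN _ hu⟩, ⟨_, hu, rfl⟩, Subtype.ext ?_⟩
    rw [hsmul]
    simp
  · rintro n ⟨u, hu, h⟩
    apply Subtype.ext
    ext x
    rw [hα, h]
    simp [mul_left_comm]
  · intro n
    apply Subtype.ext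
    have : (α (α (α (α n)))).1 = (s ^ 4)⁻¹ * n.1 * s ^ 4 := by
      simp [α, pow_succ, mul_assoc]
    rw [this, hs4]
    simp
  · intro n hn x
    have hn' : ∀ a, F.χ a = 0 → n.1 a = a := fun a ha => congrArg Subtype.val (hn ⟨a, ha⟩)
    apply Subtype.ext
    rw [hsmul, hα, inv_mul_eq_iff_eq_mul]
    set b := F.t ^ j * x.1
    have hb : F.χ b = j := by simp [b, F.χ_mul, F.χ_t, x.2]
    have hmem : n.1 b * b⁻¹ ∈ F.linkSubgroup K j := by
      refine F.mem_linkSubgroup_of_right hK (b₀ := b) (F.div_mem_ker (n.2.2 b)) fun a ha => ?_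
      have ha0 : F.χ a = 0 := by simpa [hb] using ha
      exact ⟨n, n.2.1, hn' a ha0, by simp⟩
    rw [hbot, Subgroup.mem_bot] at hmem
    exact mul_inv_eq_one.1 hmem

end Frame

namespace Frame

variable {p : ℕ} {G : Type*} [CommGroup G] (F : Frame p G)

theorem orbital_χ {F : Frame p G} {K : Subgroup (Equiv.Perm G)} (hχ : F.Shifts K) {x g : G}
    (hg : g ∈ orbital K x) : F.χ g = F.χ x := by
  obtain ⟨k, hk, h1, rfl⟩ := hg
  exact hχ.eq_of_fix hk (x := 1) (by rw [h1])

theorem exists_not_dvd_orbital [Finite G] (hp : p.Prime) (hodd : Odd p)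
    {K : Subgroup (Equiv.Perm G)} (hK : ∀ g, Equiv.mulLeft g ∈ K) (hχ : F.Shifts K) (j : ℕ)
    (hne : F.linkSubgroup K j ≠ F.ker) :
    ∃ x, F.χ x = j ∧
      ¬ p ∣ ((QuotientGroup.mk : G → G ⧸ F.linkSubgroup K j) '' orbital K x).ncard := by
  by_cases hbot : F.linkSubgroup K j = ⊥
  · obtain ⟨x, hx, h⟩ := F.exists_not_dvd_orbital_of_bot hp hodd hK hχ j hbot
    refine ⟨x, hx, ?_⟩
    rwa [Set.ncard_image_of_injective]
    intro a b hab
    have h1 := QuotientGroup.eq.1 hab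
    rw [hbot, Subgroup.mem_bot] at h1
    exact inv_mul_eq_one.1 h1
  set L := F.linkSubgroup K j with hL
  have hle : L ≤ F.ker := F.linkSubgroup_le K j
  have hidx : L.relIndex F.ker ≤ p := by
    have h1 := Subgroup.card_mul_index (L.subgroupOf F.ker)
    rw [F.card_ker'] at h1
    have h2 : Nat.card (L.subgroupOf F.ker) = Nat.card L :=
      Nat.card_congr (Subgroup.subgroupOfEquivOfLe hle).toEquiv
    rw [h2] at h1
    obtain ⟨i, hi, h3⟩ := (Nat.dvd_prime_pow hp).1 (Dvd.intro _ h1)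
    have h4 : i ≠ 0 := by
      rintro rfl
      exact hbot (Subgroup.card_eq_one.1 (by simpa using h3))
    have h5 : p ≤ Nat.card L := h3 ▸ Nat.le_self_pow h4 p
    rw [Subgroup.relIndex]
    nlinarith [hp.pos]
  refine ⟨F.t ^ j, by simp [F.χ_t], fun hdvd => hne (le_antisymm hle ?_)⟩
  set S : Set (G ⧸ L) := QuotientGroup.mk '' orbital K (F.t ^ j) with hS
  set T : Set (G ⧸ L) := QuotientGroup.mk '' {g | F.χ g = j} with hT
  have hST : S ⊆ T := Set.image_mono fun g hg => by
    change F.χ g = j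
    rw [orbital_χ hχ hg]
    simp [F.χ_t]
  have hTle : T.ncard ≤ p := by
    let f : F.ker ⧸ L.subgroupOf F.ker → G ⧸ L := fun q =>
      QuotientGroup.mk (F.t ^ j) *
        QuotientGroup.map (L.subgroupOf F.ker) L F.ker.subtype (fun _ h => h) q
    have hsub : T ⊆ Set.range f := by
      rintro _ ⟨g, hg, rfl⟩
      obtain ⟨u, hu, rfl⟩ := F.exists_ker_mul (a := F.t ^ j) (b := g)
        (by rw [show F.χ g = j from hg]; simp [F.χ_t])
      refine ⟨QuotientGroup.mk ⟨u, hu⟩, ?_⟩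
      change QuotientGroup.mk (F.t ^ j) * QuotientGroup.mk u = _
      rw [← QuotientGroup.mk_mul, mul_comm]
    calc T.ncard ≤ (Set.range f).ncard := Set.ncard_le_ncard hsub (Set.toFinite _)
      _ ≤ Nat.card (F.ker ⧸ L.subgroupOf F.ker) := by
        rw [← Set.image_univ, ← Set.ncard_univ]
        exact Set.ncard_image_le Set.finite_univ
      _ ≤ p := hidx
  have hSpos : 0 < S.ncard :=
    (Set.ncard_pos (Set.toFinite _)).2 ⟨_, _, mem_orbital_self K _, rfl⟩
  have hSeq : S = T := Set.eq_of_subset_of_ncard_le hST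
    (hTle.trans (Nat.le_of_dvd hSpos hdvd)) (Set.toFinite _)
  have horb : ∀ g, F.χ g = j → g ∈ orbital K (F.t ^ j) := by
    intro g hg
    have h1 : (QuotientGroup.mk g : G ⧸ L) ∈ S := by rw [hSeq]; exact ⟨g, hg, rfl⟩
    obtain ⟨o, ⟨k, hk, h2, rfl⟩, h3⟩ := h1
    have h4 := QuotientGroup.eq.1 h3
    have h5 : F.χ (k (F.t ^ j)) = F.χ 1 + j := by
      rw [orbital_χ hχ ⟨k, hk, h2, rfl⟩]
      simp [F.χ_t]
    obtain ⟨l, hl, h6, h7⟩ := h4.2 1 (k (F.t ^ j)) h5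
    exact ⟨l * k, K.mul_mem hl hk, by simp [h2, h6], by simp [h7]⟩
  intro u hu
  refine F.mem_linkSubgroup_of_right hK (b₀ := 1) hu fun a ha => ?_
  have ha' : F.χ a⁻¹ = j := by
    rw [F.χ_one] at ha
    rw [F.χ_inv]
    exact neg_eq_of_add_eq_zero_right ha.symm
  obtain ⟨k, hk, h1, h2⟩ := horb a⁻¹ ha'
  obtain ⟨l, hl, h3, h4⟩ := horb (u * a⁻¹) (by
    rw [F.χ_mul, ha', show F.χ u = 0 from hu, zero_add])
  refine ⟨Equiv.mulLeft a * l * k⁻¹ * Equiv.mulLeft a⁻¹,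
    K.mul_mem (K.mul_mem (K.mul_mem (hK _) hl) (K.inv_mem hk)) (hK _), ?_, ?_⟩
  · have h5 : k⁻¹ 1 = 1 := by rw [Equiv.Perm.inv_eq_iff_eq, h1]
    simp only [Equiv.Perm.mul_apply, Equiv.coe_mulLeft, inv_mul_cancel, h5, h3, mul_one]
  · have h5 : k⁻¹ a⁻¹ = F.t ^ j := by rw [Equiv.Perm.inv_eq_iff_eq, h2]
    simp only [Equiv.Perm.mul_apply, Equiv.coe_mulLeft, mul_one, h5, h4]
    rw [mul_comm u, mul_inv_cancel_left]

/-- The elements whose translation commutes with `K` modulo `L`. -/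
def commSubgroup {K : Subgroup (Equiv.Perm G)} (L : Subgroup G) : Subgroup G where
  carrier := {g | ∀ k ∈ K, ∀ a, k (g * a) * (g * k a)⁻¹ ∈ L}
  one_mem' := fun k _ a => by simp
  mul_mem' := by
    intro g h hg hh k hk a
    have h1 := L.mul_mem (hg k hk (h * a)) (hh k hk a)
    have h2 : k (g * h * a) * (g * h * k a)⁻¹ =
        k (g * (h * a)) * (g * k (h * a))⁻¹ * (k (h * a) * (h * k a)⁻¹) := by
      rw [mul_assoc g h a]
      generalize k (g * (h * a)) = x
      generalize k (h * a) = y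
      apply Additive.ofMul.injective
      simp only [ofMul_mul, ofMul_inv]
      abel
    rw [h2]
    exact h1
  inv_mem' := by
    intro g hg k hk a
    have h1 := L.inv_mem (hg k hk (g⁻¹ * a))
    rw [mul_inv_cancel_left] at h1
    convert h1 using 1
    simp [mul_comm, mul_left_comm]

theorem mem_commSubgroup_link [Finite G] (hp : p.Prime) (hodd : Odd p)
    {K : Subgroup (Equiv.Perm G)} (hK : ∀ g, Equiv.mulLeft g ∈ K) (hχ : F.Shifts K) (j : ℕ) :
    F.t ^ j ∈ commSubgroup (K := K) (F.linkSubgroup K j) := by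
  by_cases hne : F.linkSubgroup K j = F.ker
  · intro k hk a
    rw [hne]
    apply F.div_mem_ker
    have h1 := hχ.diff hk (F.t ^ j * a) a
    rw [F.χ_mul, ← sub_eq_zero]
    rw [F.χ_mul] at h1
    linear_combination h1
  have hL := F.linkSubgroup_diffInvariant hK hχ j
  obtain ⟨x, hx, hdvd⟩ := F.exists_not_dvd_orbital hp hodd hK hχ j hne
  set L := F.linkSubgroup K j
  rw [← F.t_pow_sq hodd j]
  refine Subgroup.pow_mem _ (fun k hk a => ?_) p
  set X : Set (G ⧸ L) := QuotientGroup.mk '' orbital K x with hX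
  have hO := orbital_diffInvariant hK x
  have hXdir : ∀ l (hl : l ∈ K), ∀ a b : G ⧸ L, b * a⁻¹ ∈ X →
      quotPerm hL hl b * (quotPerm hL hl a)⁻¹ ∈ X := by
    intro l hl a b hab
    obtain ⟨a, rfl⟩ := QuotientGroup.mk_surjective a
    obtain ⟨o, ho, h1⟩ := hab
    have h2 : b = QuotientGroup.mk (o * a) := by
      rw [QuotientGroup.mk_mul, h1, inv_mul_cancel_right]
    subst h2
    exact ⟨_, hO l hl a (o * a) (by simpa using ho), rfl⟩
  have hinv : ∀ y, quotPerm hL (K.inv_mem hk) (quotPerm hL hk y) = y := by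
    intro y
    obtain ⟨y, rfl⟩ := QuotientGroup.mk_surjective y
    rw [quotPerm_mk, quotPerm_mk, perm_inv_apply]
  have hXiff : ∀ a b : G ⧸ L, b * a⁻¹ ∈ X ↔
      quotPerm hL hk b * (quotPerm hL hk a)⁻¹ ∈ X := fun a b =>
    ⟨hXdir k hk a b, fun h => by simpa only [hinv] using hXdir k⁻¹ (K.inv_mem hk) _ _ h⟩
  have hfr := card_pow_fiber_eq hp (quotPerm hL hk) hXiff (QuotientGroup.mk a)
    (QuotientGroup.mk ((F.t ^ j) ^ p * a))
  have hpow : ∀ y ∈ X, y ^ p = QuotientGroup.mk ((F.t ^ j) ^ p) := by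
    rintro _ ⟨o, ho, rfl⟩
    have h1 : F.χ o = F.χ (F.t ^ j) := by rw [orbital_χ hχ ho, hx]; simp [F.χ_t]
    obtain ⟨u, hu, rfl⟩ := F.exists_ker_mul h1
    rw [← QuotientGroup.mk_pow, mul_pow, F.pow_eq_one u hu, one_mul]
  have hright : {y | y ∈ X ∧ y ^ p =
      (QuotientGroup.mk ((F.t ^ j) ^ p * a) : G ⧸ L) * (QuotientGroup.mk a)⁻¹} = X := by
    ext y
    refine ⟨fun h => h.1, fun h => ⟨h, ?_⟩⟩
    rw [hpow y h, QuotientGroup.mk_mul, mul_inv_cancel_right]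
  rw [hright] at hfr
  have hXne : ((X.ncard : ℕ) : ZMod p) ≠ 0 := by
    rwa [Ne, ZMod.natCast_eq_zero_iff]
  rw [← hfr, Ne, ZMod.natCast_eq_zero_iff] at hXne
  have hne' := Set.nonempty_of_ncard_ne_zero fun h => hXne (by rw [h]; exact dvd_zero p)
  obtain ⟨y, hyX, hy⟩ := hne'
  rw [hpow y hyX, quotPerm_mk, quotPerm_mk, eq_mul_inv_iff_mul_eq, ← QuotientGroup.mk_mul,
    QuotientGroup.eq] at hy
  rwa [mul_comm]

theorem rep_div_mem_link [Finite G] (hp : p.Prime) (hodd : Odd p)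
    {K : Subgroup (Equiv.Perm G)} (hK : ∀ g, Equiv.mulLeft g ∈ K) (hχ : F.Shifts K)
    {ρ : G →* Equiv.Perm G} (hρ : IsRegularRep ρ) (hρK : ∀ u, ρ u ∈ K)
    (hρχ : ∀ u ω, F.χ (ρ u ω) = F.χ u + F.χ ω) (j : ℕ) (ω : G) :
    ρ (F.t ^ j) ω * (F.t ^ j * ω)⁻¹ ∈ F.linkSubgroup K j := by
  have hL := F.linkSubgroup_diffInvariant hK hχ j
  have hcomm := F.mem_commSubgroup_link hp hodd hK hχ j
  set L := F.linkSubgroup K j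
  set s := F.t ^ j with hs
  set n : Equiv.Perm G := Equiv.mulLeft s⁻¹ * ρ s with hn
  have hnK : n ∈ K := K.mul_mem (hK _) (hρK _)
  have hn_apply : ∀ x, n x = s⁻¹ * ρ s x := fun x => rfl
  obtain ⟨v, hv⟩ := (hρ ω).2 (n ω)
  change ρ v ω = n ω at hv
  have hvker : v ∈ F.ker := by
    have h1 := congrArg F.χ hv
    rw [hρχ, hn_apply, F.χ_mul, hρχ, F.χ_inv] at h1
    rw [mem_ker]
    linear_combination h1
  have htrans : ∀ {a b c : G}, a * b⁻¹ ∈ L → b * c⁻¹ ∈ L → a * c⁻¹ ∈ L := fun h1 h2 => by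
    simpa [mul_assoc] using L.mul_mem h1 h2
  have h1 : ∀ i : ℕ, (n ^ i) ω * (ρ (v ^ i) ω)⁻¹ ∈ L := by
    intro i
    induction i with
    | zero => simp
    | succ i ih =>
      have h2 := hL n hnK _ _ ih
      rw [← Equiv.Perm.mul_apply, ← pow_succ'] at h2
      refine htrans h2 ?_
      have h3 : n (ρ (v ^ i) ω) = s⁻¹ * ρ (v ^ i) (ρ s ω) := by
        rw [hn_apply, ← Equiv.Perm.mul_apply, ← map_mul, mul_comm s (v ^ i), map_mul,
          Equiv.Perm.mul_apply]
      have h4 : ρ (v ^ (i + 1)) ω = ρ (v ^ i) (s⁻¹ * ρ s ω) := by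
        rw [pow_succ, map_mul, Equiv.Perm.mul_apply, hv, hn_apply]
      have h5 := (commSubgroup (K := K) L).inv_mem hcomm (ρ (v ^ i)) (hρK _) (ρ s ω)
      have h6 := L.inv_mem h5
      rw [h3, h4]
      simpa using h6
  have h2 : ∀ i : ℕ, (n ^ i) ω * (s⁻¹ ^ i * ρ (s ^ i) ω)⁻¹ ∈ L := by
    intro i
    induction i with
    | zero => simp
    | succ i ih =>
      have h2 := hL n hnK _ _ ih
      rw [← Equiv.Perm.mul_apply, ← pow_succ'] at h2
      refine htrans h2 ?_
      have h5 := (commSubgroup (K := K) L).pow_mem ((commSubgroup (K := K) L).inv_mem hcomm) i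
        (ρ s) (hρK _) (ρ (s ^ i) ω)
      rw [← Equiv.Perm.mul_apply, ← map_mul, ← pow_succ'] at h5
      rw [hn_apply, pow_succ' s⁻¹]
      convert h5 using 1
      generalize ρ s (s⁻¹ ^ i * ρ (s ^ i) ω) = x
      generalize ρ (s ^ (i + 1)) ω = y
      apply Additive.ofMul.injective
      simp only [ofMul_mul, ofMul_inv, ofMul_pow]
      abel
  have h3 : ∀ u : G, ρ u ω * ω⁻¹ ∈ L ↔ u ∈ ({
      carrier := {u | ρ u ω * ω⁻¹ ∈ L}
      one_mem' := by simp
      mul_mem' := by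
        intro a b ha hb
        have h4 := hL (ρ a) (hρK a) _ _ hb
        rw [← Equiv.Perm.mul_apply, ← map_mul] at h4
        exact htrans h4 ha
      inv_mem' := by
        intro a ha
        have h4 := hL (ρ a⁻¹) (hρK _) (ρ a ω) ω (by simpa using L.inv_mem ha)
        rw [← Equiv.Perm.mul_apply, ← map_mul] at h4
        simpa using h4 } : Subgroup G) := fun u => Iff.rfl
  have h4 : v ^ 4 ∈ ({u | ρ u ω * ω⁻¹ ∈ L} : Set G) := by
    have h5 := L.inv_mem (h1 4)
    have h6 : s ^ 4 = 1 := by rw [hs, ← pow_mul, mul_comm, pow_mul, F.t_pow, one_pow]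
    have h7 := h2 4
    rw [inv_pow, h6, map_one] at h7
    exact htrans (by simpa using h5) (by simpa using h7)
  have h5 := (h3 v).2 (F.pow_mul_mem_of_odd hodd hvker ((h3 _).1 h4))
  rw [hv, hn_apply] at h5
  convert h5 using 1
  generalize ρ s ω = x
  apply Additive.ofMul.injective
  simp only [ofMul_mul, ofMul_inv]
  abel

end Frame

namespace Frame

variable {p : ℕ} {G : Type*} [CommGroup G] (F : Frame p G)

/-- The section of `χ` with image the powers of `t`. -/
def lift (c : ZMod 4) : G := F.t ^ c.val

theorem lift_add (a b : ZMod 4) : F.lift (a + b) = F.lift a * F.lift b := by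
  rw [lift, ZMod.val_add, ← pow_eq_pow_mod _ F.t_pow, pow_add, lift, lift]

@[simp]
theorem lift_one : F.lift 1 = F.t := by
  rw [lift, show (1 : ZMod 4).val = 1 from rfl, pow_one]

@[simp]
theorem χ_lift (c : ZMod 4) : F.χ (F.lift c) = c := by
  rw [lift, χ_pow, F.χ_t, mul_one, ZMod.natCast_zmod_val]

theorem exists_conjRep_t [Finite G] (hp : p.Prime) (hodd : Odd p)
    {K : Subgroup (Equiv.Perm G)} (h2 : TwoClosed K) (hK : ∀ g, Equiv.mulLeft g ∈ K)
    (hχ : F.Shifts K) {ρ : G →* Equiv.Perm G} (hρ : IsRegularRep ρ) (hρK : ∀ u, ρ u ∈ K)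
    (hρχ : ∀ u ω, F.χ (ρ u ω) = F.χ u + F.χ ω) :
    ∃ y ∈ K, (∀ ω, F.χ (y ω) = F.χ ω) ∧ conjRep y ρ F.t = Equiv.mulLeft F.t := by
  let f : Equiv.Perm G :=
    { toFun := fun ω => F.lift (F.χ ω) * ρ (F.lift (F.χ ω))⁻¹ ω
      invFun := fun ω => ρ (F.lift (F.χ ω)) ((F.lift (F.χ ω))⁻¹ * ω)
      left_inv := fun ω => by
        have h : F.χ (F.lift (F.χ ω) * ρ (F.lift (F.χ ω))⁻¹ ω) = F.χ ω := by
          rw [F.χ_mul, hρχ, χ_inv, χ_lift]; ring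
        beta_reduce
        rw [h, inv_mul_cancel_left, ← Equiv.Perm.mul_apply, ← map_mul, mul_inv_cancel, map_one,
          Equiv.Perm.one_apply]
      right_inv := fun ω => by
        have h : F.χ (ρ (F.lift (F.χ ω)) ((F.lift (F.χ ω))⁻¹ * ω)) = F.χ ω := by
          simp [F.χ_mul, hρχ]
        beta_reduce
        rw [h, ← Equiv.Perm.mul_apply, ← map_mul, inv_mul_cancel, map_one, Equiv.Perm.one_apply,
          mul_inv_cancel_left] }
  have hf : ∀ ω, f ω = F.lift (F.χ ω) * ρ (F.lift (F.χ ω))⁻¹ ω := fun _ => rfl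
  have hfχ : ∀ ω, F.χ (f ω) = F.χ ω := fun ω => by
    rw [hf, F.χ_mul, hρχ, χ_inv, χ_lift]; ring
  refine ⟨f, h2 f fun a b => ?_, hfχ, ?_⟩
  · obtain ⟨c, hc⟩ : ∃ c, F.χ a = c := ⟨_, rfl⟩
    obtain ⟨m, hm⟩ : ∃ m, F.χ b = c + m := ⟨F.χ b - c, by ring⟩
    set k : Equiv.Perm G := Equiv.mulLeft (F.lift c) * ρ (F.lift c)⁻¹ with hk
    have hkK : k ∈ K := K.mul_mem (hK _) (hρK _)
    have hka : k a = f a := by rw [hf, hc]; rfl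
    obtain ⟨b₀, hb₀⟩ : ∃ b₀, b₀ = ρ (F.lift (c + m))⁻¹ b := ⟨_, rfl⟩
    have hl := F.rep_div_mem_link hp hodd hK hχ hρ hρK hρχ m.val b₀
    rw [ZMod.natCast_zmod_val, show F.t ^ m.val = F.lift m from rfl] at hl
    have hfb : f b = F.lift c * (F.lift m * b₀) := by
      rw [hf, hm, ← hb₀, F.lift_add, mul_assoc]
    have hkb : k b = F.lift c * ρ (F.lift m) b₀ := by
      rw [hb₀, ← Equiv.Perm.mul_apply (ρ _), ← map_mul, F.lift_add, mul_inv, mul_comm (F.lift m),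
        inv_mul_cancel_right]
      rfl
    have hfk : f b = (ρ (F.lift m) b₀ * (F.lift m * b₀)⁻¹)⁻¹ * k b := by
      rw [hfb, hkb]
      generalize ρ (F.lift m) b₀ = x
      apply Additive.ofMul.injective
      simp only [ofMul_mul, ofMul_inv]
      abel
    obtain ⟨l, hlK, h3, h4⟩ := ((F.linkSubgroup K m).inv_mem hl).2 (f a) (k b) (by
      rw [← hka, ← sub_eq_iff_eq_add', hχ.diff hkK, hm, hc]; ring)
    exact ⟨l * k, K.mul_mem hlK hkK, by rw [Equiv.Perm.mul_apply, hka, h3],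
      by rw [Equiv.Perm.mul_apply, h4, hfk]⟩
  · rw [conjRep_apply, mul_inv_eq_iff_eq_mul]
    ext ω
    rw [Equiv.Perm.mul_apply, Equiv.Perm.mul_apply, Equiv.coe_mulLeft, hf, hf, hρχ, F.χ_t,
      F.lift_add, F.lift_one, mul_inv, mul_comm F.t⁻¹, map_mul, Equiv.Perm.mul_apply,
      ← Equiv.Perm.mul_apply (ρ F.t⁻¹), ← map_mul, inv_mul_cancel, map_one, Equiv.Perm.one_apply,
      mul_assoc]

end Frame

/-- Two permutations of order dividing `n` that raise a function to `ℤ/n` by one are conjugate by a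
permutation built from their powers. -/
theorem exists_twist {α : Type*} {n : ℕ} [NeZero n] {s r : Equiv.Perm α} (hs : s ^ n = 1)
    (hr : r ^ n = 1) (c : α → ZMod n) (hcs : ∀ ω, c (s ω) = c ω + 1)
    (hcr : ∀ ω, c (r ω) = c ω + 1) :
    ∃ f : Equiv.Perm α, (∀ ω, f ω = (s ^ (c ω).val * (r ^ (c ω).val)⁻¹) ω) ∧ f * r = s * f ∧
      ∀ (q : Equiv.Perm α), q ^ n = 1 → (∀ ω, c (q ω) = c ω + 1) → ∀ (i : ℕ) ω,
        c ((s ^ i * (q ^ i)⁻¹) ω) = c ω := by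
  have hpow : ∀ q : Equiv.Perm α, (∀ ω, c (q ω) = c ω + 1) → ∀ (i : ℕ) ω,
      c ((q ^ i) ω) = c ω + i := by
    intro q hq i ω
    induction i with
    | zero => simp
    | succ i ih =>
      rw [pow_succ', Equiv.Perm.mul_apply, hq, ih]
      push_cast
      ring
  have hpow' : ∀ q : Equiv.Perm α, (∀ ω, c (q ω) = c ω + 1) → ∀ (i : ℕ) ω,
      c ((q ^ i)⁻¹ ω) = c ω - i := by
    intro q hq i ω
    have := hpow q hq i ((q ^ i)⁻¹ ω)
    rw [perm_apply_inv] at this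
    rw [this]
    ring
  have hc : ∀ {a b : Equiv.Perm α}, (∀ ω, c (a ω) = c ω + 1) → (∀ ω, c (b ω) = c ω + 1) →
      ∀ (i : ℕ) ω, c ((a ^ i * (b ^ i)⁻¹) ω) = c ω := by
    intro a b ha hb i ω
    rw [Equiv.Perm.mul_apply, hpow a ha, hpow' b hb, sub_add_cancel]
  let f : Equiv.Perm α :=
    { toFun := fun ω => (s ^ (c ω).val * (r ^ (c ω).val)⁻¹) ω
      invFun := fun ω => (r ^ (c ω).val * (s ^ (c ω).val)⁻¹) ω
      left_inv := fun ω => by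
        beta_reduce
        rw [hc hcs hcr, ← Equiv.Perm.mul_apply]
        simp
      right_inv := fun ω => by
        beta_reduce
        rw [hc hcr hcs, ← Equiv.Perm.mul_apply]
        simp }
  have hadd : ∀ q : Equiv.Perm α, q ^ n = 1 → ∀ a : ZMod n, q ^ (a + 1).val = q ^ a.val * q := by
    intro q hq a
    rw [ZMod.val_add, ← pow_eq_pow_mod _ hq, pow_add]
    rcases eq_or_ne n 1 with rfl | hn
    · rw [pow_one] at hq
      simp [hq]
    · have := Fact.mk (show 1 < n by have := NeZero.pos n; omega)
      rw [ZMod.val_one, pow_one]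
  refine ⟨f, fun _ => rfl, ?_, fun q _ hq i ω => hc hcs hq i ω⟩
  ext ω
  change (s ^ (c (r ω)).val * (r ^ (c (r ω)).val)⁻¹) (r ω) =
    s ((s ^ (c ω).val * (r ^ (c ω).val)⁻¹) ω)
  rw [hcr, hadd s hs, hadd r hr, ← pow_succ, pow_succ', ← pow_succ r, pow_succ' r, mul_inv_rev]
  simp [Equiv.Perm.mul_apply]

theorem mem_of_zpow_mem {G : Type*} [Group G] {p : ℕ} (hp : p.Prime) {M : Subgroup G} {z : G}
    (hz : z ^ p = 1) {k : ℤ} (hk : ¬ (p : ℤ) ∣ k) (h : z ^ k ∈ M) : z ∈ M := by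
  obtain ⟨a, b, hab⟩ :=
    ((Nat.prime_iff_prime_int.1 hp).coprime_iff_not_dvd.2 hk).symm
  have h1 : z = (z ^ k) ^ a * (z ^ p) ^ b := by
    rw [← zpow_natCast, ← zpow_mul, ← zpow_mul, ← zpow_add, mul_comm k, mul_comm (p : ℤ), hab,
      zpow_one]
  rw [h1, hz, one_zpow, mul_one]
  exact M.zpow_mem h a

namespace Frame

variable {p : ℕ} {G : Type*} [CommGroup G] (F : Frame p G)

theorem zpow_t_eq_one {b : ℤ} (h : F.χ (F.t ^ b) = 0) : F.t ^ b = 1 := by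
  have h4 : F.t ^ (4 : ℤ) = 1 := by exact_mod_cast F.t_pow
  obtain ⟨n, hn⟩ : ∃ n : ℕ, F.t ^ b = F.t ^ n := by
    refine ⟨(b % 4).toNat, ?_⟩
    rw [← zpow_natCast, Int.toNat_of_nonneg (Int.emod_nonneg _ (by norm_num))]
    conv_lhs => rw [← Int.emod_add_mul_ediv b 4, zpow_add, zpow_mul, h4, one_zpow, mul_one]
  rw [hn] at h ⊢
  rw [χ_pow, F.χ_t, mul_one, ZMod.natCast_eq_zero_iff] at h
  obtain ⟨m, rfl⟩ := h
  rw [pow_mul, F.t_pow, one_pow]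

theorem ker_eq_sup [Finite G] (hp : p.Prime) {z g : G} (hz : z ∈ F.ker) (hz1 : z ≠ 1)
    (hg : g ∈ F.ker) (hgz : g ∉ Subgroup.zpowers z) :
    Subgroup.zpowers z ⊔ Subgroup.zpowers g = F.ker := by
  have hle : Subgroup.zpowers z ⊔ Subgroup.zpowers g ≤ F.ker :=
    sup_le (by simpa using hz) (by simpa using hg)
  have hcz : Nat.card (Subgroup.zpowers z) = p := by
    rw [Nat.card_zpowers]
    exact orderOf_eq_prime (hp := ⟨hp⟩) (F.pow_eq_one z hz) hz1
  have hd := Subgroup.card_dvd_of_le hle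
  have hd' := Subgroup.card_dvd_of_le (le_sup_left : Subgroup.zpowers z ≤ _ ⊔ Subgroup.zpowers g)
  rw [F.card_ker'] at hd
  rw [hcz] at hd'
  refine Subgroup.eq_of_le_of_card_ge hle ?_
  rw [F.card_ker']
  obtain ⟨i, hi, h⟩ := (Nat.dvd_prime_pow hp).1 hd
  rw [h]
  interval_cases i
  · rw [h, pow_zero] at hd'
    exact absurd (Nat.dvd_one.1 hd') hp.one_lt.ne'
  · exfalso
    have : Subgroup.zpowers z = Subgroup.zpowers z ⊔ Subgroup.zpowers g :=
      Subgroup.eq_of_le_of_card_ge le_sup_left (by rw [h, hcz, pow_one])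
    apply hgz
    rw [this]
    exact le_sup_right (a := Subgroup.zpowers z) (Subgroup.mem_zpowers g)
  · exact le_rfl

theorem exists_coord [Finite G] (hp : p.Prime) {z g : G} (hz : z ∈ F.ker) (hz1 : z ≠ 1)
    (hg : g ∈ F.ker) (hgz : g ∉ Subgroup.zpowers z) :
    ∃ c : G → ZMod p, (∀ a b, c (a * b) = c a + c b) ∧ c g = 1 ∧
      ∀ ω, c ω = 0 ↔ ω ∈ Subgroup.zpowers z ⊔ Subgroup.zpowers F.t := by
  have := Fact.mk hp
  set H := Subgroup.zpowers z ⊔ Subgroup.zpowers F.t with hH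
  have huniq : ∀ k : ℤ, g ^ k ∈ H → (k : ZMod p) = 0 := by
    intro k hk
    obtain ⟨_, ⟨a, rfl⟩, _, ⟨b, rfl⟩, hab⟩ := Subgroup.mem_sup.1 hk
    simp only at hab
    have hb : F.χ (F.t ^ b) = 0 := by
      have h1 : F.t ^ b = (z ^ a)⁻¹ * g ^ k := by rw [← hab]; simp
      rw [h1]
      exact F.ker.mul_mem (F.ker.inv_mem (F.ker.zpow_mem hz a)) (F.ker.zpow_mem hg k)
    rw [F.zpow_t_eq_one hb, mul_one] at hab
    rw [ZMod.intCast_zmod_eq_zero_iff_dvd]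
    by_contra hdvd
    exact hgz (mem_of_zpow_mem hp (F.pow_eq_one g hg) hdvd (by rw [← hab]; exact ⟨a, rfl⟩))
  have hex : ∀ ω, ∃ i : ℤ, ω * (g ^ i)⁻¹ ∈ H := by
    intro ω
    obtain ⟨n, u, hu, rfl⟩ := F.exists_pow_t_mul ω
    rw [← F.ker_eq_sup hp hz hz1 hg hgz] at hu
    obtain ⟨a, ha, _, ⟨i, rfl⟩, rfl⟩ := Subgroup.mem_sup.1 hu
    refine ⟨i, ?_⟩
    rw [← mul_assoc, mul_inv_cancel_right]
    exact H.mul_mem (H.pow_mem (le_sup_right (a := Subgroup.zpowers z)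
      (Subgroup.mem_zpowers F.t)) n) (le_sup_left (b := Subgroup.zpowers F.t) ha)
  choose e he using hex
  have hce : ∀ ω (i : ℤ), ω * (g ^ i)⁻¹ ∈ H → (e ω : ZMod p) = i := by
    intro ω i hi
    have h1 := huniq (e ω - i) (by
      have h2 := H.mul_mem (H.inv_mem (he ω)) hi
      convert h2 using 1
      rw [zpow_sub]
      apply Additive.ofMul.injective
      simp only [ofMul_mul, ofMul_inv]
      abel)
    rw [Int.cast_sub] at h1
    exact sub_eq_zero.1 h1
  refine ⟨fun ω => (e ω : ZMod p), fun a b => ?_, ?_, fun ω => ⟨fun h => ?_, fun h => ?_⟩⟩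
  · beta_reduce
    rw [hce (a * b) (e a + e b), Int.cast_add]
    have h2 := H.mul_mem (he a) (he b)
    convert h2 using 1
    rw [zpow_add]
    apply Additive.ofMul.injective
    simp only [ofMul_mul, ofMul_inv]
    abel
  · beta_reduce
    rw [hce g 1 (by simp), Int.cast_one]
  · beta_reduce at h
    rw [ZMod.intCast_zmod_eq_zero_iff_dvd] at h
    obtain ⟨m, hm⟩ := h
    have h1 := he ω
    rw [hm, zpow_mul, zpow_natCast, F.pow_eq_one g hg, one_zpow, inv_one, mul_one] at h1
    exact h1
  · beta_reduce
    rw [hce ω 0 (by simpa using h), Int.cast_zero]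

end Frame

namespace Frame

variable {p : ℕ} {G : Type*} [CommGroup G] (F : Frame p G)

theorem forall_of_ker_of_t {M : Subgroup G} (hker : F.ker ≤ M) (ht : F.t ∈ M) (g : G) : g ∈ M := by
  obtain ⟨n, u, hu, rfl⟩ := F.exists_pow_t_mul g
  exact M.mul_mem (M.pow_mem ht n) (hker hu)

theorem exists_eq_zpow_mul_of_fix [Finite G] (hp : p.Prime) {Q : Subgroup (Equiv.Perm G)}
    (hQp : IsPGroup p Q) (hQχ : ∀ q ∈ Q, ∀ ω, F.χ (q ω) = F.χ ω)
    (hQt : ∀ q ∈ Q, ∀ ω, q (F.t * ω) = F.t * q ω) (hQl : ∀ u ∈ F.ker, Equiv.mulLeft u ∈ Q) {z : G}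
    (hz : z ∈ F.ker) (hz1 : z ≠ 1) (hQz : ∀ q ∈ Q, ∀ ω, q (z * ω) = z * q ω)
    {w : Equiv.Perm G} (hw : w ∈ Q) (hw1 : w 1 = 1) (ω : G) : ∃ k : ℤ, w ω = z ^ k * ω := by
  let X := {u // F.χ u = 0}
  let _ : MulAction Q X :=
    { smul := fun n x => ⟨n.1 x.1, by rw [hQχ _ n.2, x.2]⟩
      one_smul := fun _ => rfl
      mul_smul := fun _ _ _ => rfl }
  have hsmul : ∀ (n : Q) (x : X), ((n • x : X) : G) = n.1 x.1 := fun _ _ => rfl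
  have hzpow : ∀ (k : ℤ) (x : X), (((⟨Equiv.mulLeft z, hQl z hz⟩ : Q) ^ k • x : X) : G) =
      z ^ k * x.1 := fun k x => by
    rw [hsmul, Subgroup.coe_zpow, Equiv.zpow_mulLeft, Equiv.coe_mulLeft]
  have h1 := exists_zpow_smul_of_exists hp (N := Q) (X := X) (Q := ⊤) (hQp.to_subgroup ⊤)
    (fun x y => ⟨⟨Equiv.mulLeft (y.1 * x.1⁻¹), hQl _ (F.div_mem_ker (by rw [x.2, y.2]))⟩,
      Subgroup.mem_top _, Subtype.ext (by rw [hsmul]; simp)⟩) F.card_ker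
    (z := ⟨Equiv.mulLeft z, hQl z hz⟩) (Subgroup.mem_top _)
    (fun n _ => Subtype.ext (Equiv.ext fun x => hQz n.1 n.2 x))
    (by
      apply Subtype.ext
      rw [Subgroup.coe_pow, Equiv.pow_mulLeft, F.pow_eq_one z hz]
      simp)
    (fun x h => hz1 (by
      have := congrArg Subtype.val h
      rw [hsmul] at this
      simpa using this))
    (n := ⟨w, hw⟩) (Subgroup.mem_top _) (x := ⟨1, F.χ_one⟩)
    ⟨0, Subtype.ext (by rw [hsmul, hzpow]; simpa using hw1)⟩
  obtain ⟨n, u, hu, rfl⟩ := F.exists_pow_t_mul ω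
  obtain ⟨k, hk⟩ := h1 ⟨u, hu⟩
  have hk' : w u = z ^ k * u := by
    have := congrArg Subtype.val hk
    rwa [hsmul, hzpow] at this
  have ht : ∀ n : ℕ, w (F.t ^ n * u) = F.t ^ n * w u := by
    intro n
    induction n with
    | zero => simp
    | succ n ih => rw [pow_succ', mul_assoc, hQt w hw, ih, mul_assoc]
  exact ⟨k, by rw [ht, hk', mul_left_comm]⟩

/-- A pair with distinct coordinates can be moved in its second entry alone by any power of `z`. -/
theorem exists_fix_and_zpow_mul (hp : p.Prime) {K : Subgroup (Equiv.Perm G)}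
    (hK : ∀ g, Equiv.mulLeft g ∈ K) {z : G} (hz : z ∈ F.ker) {c : G → ZMod p}
    (hc : ∀ a b, c (a * b) = c a + c b)
    (hc0 : ∀ ω, c ω = 0 ↔ ω ∈ Subgroup.zpowers z ⊔ Subgroup.zpowers F.t)
    {w : Equiv.Perm G} (hwK : w ∈ K) (hw1 : w 1 = 1) (hwz : ∀ ω, w (z * ω) = z * w ω)
    (hwt : ∀ ω, w (F.t * ω) = F.t * w ω) (hw : ∀ ω, ∃ k : ℤ, w ω = z ^ k * ω) (hne : w ≠ 1)
    {a b : G} (hab : c a ≠ c b) (e : ℤ) : ∃ κ ∈ K, κ a = a ∧ κ b = z ^ e * b := by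
  have := Fact.mk hp
  have hwH : ∀ x, c x = 0 → ∀ ω, w (x * ω) = x * w ω := by
    let M : Subgroup G :=
      { carrier := {x | ∀ ω, w (x * ω) = x * w ω}
        one_mem' := fun ω => by simp
        mul_mem' := fun {x y} hx hy ω => by rw [mul_assoc, hx, hy, mul_assoc]
        inv_mem' := fun {x} hx ω => by
          have := hx (x⁻¹ * ω)
          rw [mul_inv_cancel_left] at this
          rw [this, inv_mul_cancel_left] }
    intro x hx
    have hle : Subgroup.zpowers z ⊔ Subgroup.zpowers F.t ≤ M :=
      sup_le ((Subgroup.zpowers_le (H := M)).2 hwz) ((Subgroup.zpowers_le (H := M)).2 hwt)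
    exact hle ((hc0 x).1 hx)
  have hc1 : c 1 = 0 := by simpa using hc 1 1
  have hcpow : ∀ (d : G) (m : ℕ), c (d ^ m) = m * c d := by
    intro d m
    induction m with
    | zero => simpa using hc1
    | succ m ih => rw [pow_succ, hc, ih]; push_cast; ring
  have hcinv : ∀ d, c d⁻¹ = - c d := fun d => by
    have := hc d d⁻¹
    rw [mul_inv_cancel, hc1] at this
    exact eq_neg_of_add_eq_zero_right this.symm
  have hcz : c z = 0 := (hc0 z).2 (le_sup_left (b := Subgroup.zpowers F.t) (Subgroup.mem_zpowers z))
  -- some translate separates the displacements of `a` and `b`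
  obtain ⟨v, hv⟩ : ∃ v, w (v * a) * (v * a)⁻¹ ≠ w (v * b) * (v * b)⁻¹ := by
    by_contra! hcon
    have h1 : ∀ σ, w σ * σ⁻¹ = w (a⁻¹ * b * σ) * (a⁻¹ * b * σ)⁻¹ := by
      intro σ
      have := hcon (σ * a⁻¹)
      rwa [inv_mul_cancel_right, show σ * a⁻¹ * b = a⁻¹ * b * σ by
        rw [mul_assoc, mul_comm]] at this
    have h2 : ∀ m : ℕ, w ((a⁻¹ * b) ^ m) = (a⁻¹ * b) ^ m := by
      intro m
      induction m with
      | zero => simpa using hw1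
      | succ m ih =>
        have h3 := h1 ((a⁻¹ * b) ^ m)
        rw [ih, mul_inv_cancel, ← pow_succ'] at h3
        exact mul_inv_eq_one.1 h3.symm
    apply hne
    ext ω
    have hd : c (a⁻¹ * b) ≠ 0 := by
      rw [hc, hcinv]
      intro h
      exact hab (neg_add_eq_zero.1 h)
    obtain ⟨m, hm⟩ : ∃ m : ℕ, c ((a⁻¹ * b) ^ m) = c ω :=
      ⟨(c ω / c (a⁻¹ * b)).val, by rw [hcpow, ZMod.natCast_zmod_val, div_mul_cancel₀ _ hd]⟩
    have h3 := hwH (ω * ((a⁻¹ * b) ^ m)⁻¹) (by rw [hc, hcinv, hm, add_neg_cancel]) ((a⁻¹ * b) ^ m)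
    rwa [h2, inv_mul_cancel_right] at h3
  let M : Subgroup G :=
    { carrier := {x | c x = 0 ∧ ∃ κ ∈ K, (∀ y, c y = 0 → ∀ ω, κ (y * ω) = y * κ ω) ∧ κ a = a ∧
        κ b = x * b}
      one_mem' := ⟨hc1, 1, K.one_mem, fun _ _ _ => rfl, rfl, by simp⟩
      mul_mem' := by
        rintro x y ⟨hx, κ, hκ, h1, h2, h3⟩ ⟨hy, κ', hκ', h1', h2', h3'⟩
        refine ⟨by rw [hc, hx, hy, add_zero], κ * κ', K.mul_mem hκ hκ', fun y hy ω => ?_, ?_, ?_⟩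
        · simp only [Equiv.Perm.mul_apply]
          rw [h1' y hy, h1 y hy]
        · rw [Equiv.Perm.mul_apply, h2', h2]
        · rw [Equiv.Perm.mul_apply, h3', h1 y hy, h3, mul_comm x y, mul_assoc]
      inv_mem' := by
        rintro x ⟨hx, κ, hκ, h1, h2, h3⟩
        refine ⟨by rw [hcinv, hx, neg_zero], κ⁻¹, K.inv_mem hκ, fun y hy ω => ?_, ?_, ?_⟩
        · rw [Equiv.Perm.inv_eq_iff_eq, h1 y hy, perm_apply_inv]
        · rw [Equiv.Perm.inv_eq_iff_eq, h2]
        · rw [Equiv.Perm.inv_eq_iff_eq, h1 _ (by rw [hcinv, hx, neg_zero]), h3,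
            inv_mul_cancel_left] }
  suffices hzM : z ∈ M by
    obtain ⟨-, κ, hκ, -, h2, h3⟩ := M.zpow_mem hzM e
    exact ⟨κ, hκ, h2, h3⟩
  obtain ⟨k, hk⟩ := hw (v * a)
  obtain ⟨l, hl⟩ := hw (v * b)
  rw [hk, hl, mul_inv_cancel_right, mul_inv_cancel_right] at hv
  refine mem_of_zpow_mem hp (F.pow_eq_one z hz) (k := -k + l) ?_ ?_
  · rintro ⟨m, hm⟩
    apply hv
    have : z ^ (-k + l) = 1 := by
      rw [hm, zpow_mul, zpow_natCast, F.pow_eq_one z hz, one_zpow]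
    rw [zpow_add, zpow_neg, inv_mul_eq_one] at this
    exact this
  · refine ⟨(hc0 _).2 (le_sup_left (b := Subgroup.zpowers F.t) ⟨_, rfl⟩),
      Equiv.mulLeft (z ^ (-k) * v⁻¹) * w * Equiv.mulLeft v,
      K.mul_mem (K.mul_mem (hK _) hwK) (hK _), fun y hy ω => ?_, ?_, ?_⟩
    · simp only [Equiv.Perm.mul_apply, Equiv.coe_mulLeft]
      rw [mul_left_comm v, hwH y hy, mul_left_comm _ y]
    · simp only [Equiv.Perm.mul_apply, Equiv.coe_mulLeft, hk]
      rw [zpow_neg]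
      apply Additive.ofMul.injective
      simp only [ofMul_mul, ofMul_inv]
      abel
    · simp only [Equiv.Perm.mul_apply, Equiv.coe_mulLeft, hl]
      rw [zpow_add]
      apply Additive.ofMul.injective
      simp only [ofMul_mul, ofMul_inv]
      abel

end Frame

namespace Frame

variable {p : ℕ} {G : Type*} [CommGroup G] (F : Frame p G)

theorem conjIntoTranslations_of_isPGroup [Finite G] (hp : p.Prime) {K : Subgroup (Equiv.Perm G)}
    (h2 : TwoClosed K) (hK : ∀ g, Equiv.mulLeft g ∈ K) {ρ : G →* Equiv.Perm G}
    (hρ : IsRegularRep ρ) (hρχ : ∀ u ω, F.χ (ρ u ω) = F.χ u + F.χ ω)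
    (hρt : ρ F.t = Equiv.mulLeft F.t) {Q : Subgroup (Equiv.Perm G)} (hQK : Q ≤ K)
    (hQp : IsPGroup p Q) (hQχ : ∀ q ∈ Q, ∀ ω, F.χ (q ω) = F.χ ω)
    (hQt : ∀ q ∈ Q, ∀ ω, q (F.t * ω) = F.t * q ω) (hQl : ∀ u ∈ F.ker, Equiv.mulLeft u ∈ Q)
    (hQρ : ∀ u ∈ F.ker, ρ u ∈ Q) : ConjIntoTranslations K ρ := by
  have := Fact.mk hp
  have hker1 : 1 < Nat.card F.ker := by
    rw [F.card_ker']
    exact Nat.one_lt_pow two_ne_zero hp.one_lt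
  have hnt : Nontrivial Q := by
    have : Nontrivial F.ker := (Finite.one_lt_card_iff_nontrivial).1 hker1
    obtain ⟨u, hu⟩ := exists_ne (1 : F.ker)
    refine ⟨⟨Equiv.mulLeft u.1, hQl _ u.2⟩, 1, fun h => hu (Subtype.ext ?_)⟩
    have h1 := Equiv.ext_iff.1 (congrArg Subtype.val h) 1
    simpa using h1
  have := hQp.center_nontrivial
  obtain ⟨⟨⟨ζ, hζQ⟩, hζc⟩, hζ1⟩ := exists_ne (1 : Subgroup.center Q)
  have hζcomm : ∀ q ∈ Q, q * ζ = ζ * q := fun q hq =>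
    congrArg Subtype.val (Subgroup.mem_center_iff.1 hζc ⟨q, hq⟩)
  -- the central element is a translation lying in the image of `ρ`
  obtain ⟨z, rfl⟩ : ∃ z, ζ = Equiv.mulLeft z := by
    refine ⟨_, eq_mulLeft_of_commute fun g => ?_⟩
    let M : Subgroup G :=
      { carrier := {g | ∀ ω, ζ (g * ω) = g * ζ ω}
        one_mem' := fun ω => by simp
        mul_mem' := fun {x y} hx hy ω => by rw [mul_assoc, hx, hy, mul_assoc]
        inv_mem' := fun {x} hx ω => by
          have := hx (x⁻¹ * ω)
          rw [mul_inv_cancel_left] at this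
          rw [this, inv_mul_cancel_left] }
    exact Equiv.ext (F.forall_of_ker_of_t (M := M)
      (fun u hu ω => Equiv.ext_iff.1 (hζcomm _ (hQl u hu)).symm ω) (hQt ζ hζQ) g)
  obtain ⟨v, hv⟩ : ∃ v, Equiv.mulLeft z = ρ v := by
    refine hρ.eq_of_commute fun g => ?_
    let M : Subgroup G :=
      { carrier := {g | Equiv.mulLeft z * ρ g = ρ g * Equiv.mulLeft z}
        one_mem' := by simp
        mul_mem' := fun {x y} hx hy => by
          change _ * _ = _ * _
          rw [map_mul, ← mul_assoc, show _ = _ from hx, mul_assoc, show _ = _ from hy, mul_assoc]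
        inv_mem' := fun {x} hx => by
          change _ * _ = _ * _
          rw [map_inv, mul_inv_eq_iff_eq_mul, mul_assoc, show _ = _ from hx, inv_mul_cancel_left] }
    refine F.forall_of_ker_of_t (M := M) (fun u hu => (hζcomm _ (hQρ u hu)).symm) ?_ g
    change _ = _
    rw [hρt, ← Equiv.mulLeft_mul, mul_comm, Equiv.mulLeft_mul]
  have hz : z ∈ F.ker := by
    have := hQχ _ hζQ 1
    simpa [mem_ker] using this
  have hz1 : z ≠ 1 := fun h => hζ1 (Subtype.ext (Subtype.ext (by simp [h])))
  have hQz : ∀ q ∈ Q, ∀ ω, q (z * ω) = z * q ω := fun q hq => Equiv.ext_iff.1 (hζcomm q hq)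
  obtain ⟨g, hg, hgz⟩ : ∃ g ∈ F.ker, g ∉ Subgroup.zpowers z := by
    by_contra! hcon
    have h1 := Subgroup.card_dvd_of_le (show F.ker ≤ Subgroup.zpowers z from hcon)
    rw [F.card_ker', Nat.card_zpowers, orderOf_eq_prime (F.pow_eq_one z hz) hz1] at h1
    have := Nat.le_of_dvd hp.pos h1
    nlinarith [hp.one_lt]
  obtain ⟨h, hh⟩ := (hρ 1).2 g
  change ρ h 1 = g at hh
  have hhker : h ∈ F.ker := by
    have := hρχ h 1
    rw [hh, F.χ_one, add_zero] at this
    exact this.symm.trans hg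
  obtain ⟨c, hc, hcg, hc0⟩ := F.exists_coord hp hz hz1 hg hgz
  have hc1 : c 1 = 0 := by simpa using hc 1 1
  have hcz : c z = 0 := (hc0 z).2 (le_sup_left (b := Subgroup.zpowers F.t) (Subgroup.mem_zpowers z))
  have hct : c F.t = 0 := (hc0 _).2 (le_sup_right (a := Subgroup.zpowers z)
    (Subgroup.mem_zpowers F.t))
  have hczpow : ∀ k : ℤ, c (z ^ k) = 0 := fun k =>
    (hc0 _).2 (le_sup_left (b := Subgroup.zpowers F.t) ⟨k, rfl⟩)
  set s : Equiv.Perm G := Equiv.mulLeft g with hs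
  set r : Equiv.Perm G := ρ h with hr
  set w : Equiv.Perm G := s⁻¹ * r with hw
  have hsQ : s ∈ Q := hQl g hg
  have hrQ : r ∈ Q := hQρ h hhker
  have hwQ : w ∈ Q := Q.mul_mem (Q.inv_mem hsQ) hrQ
  have hw1 : w 1 = 1 := by
    rw [hw, Equiv.Perm.mul_apply, Equiv.Perm.inv_eq_iff_eq, hh]
    simp [hs]
  have hwω := F.exists_eq_zpow_mul_of_fix hp hQp hQχ hQt hQl hz hz1 hQz hwQ hw1
  have hcs : ∀ ω, c (s ω) = c ω + 1 := fun ω => by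
    rw [hs, Equiv.coe_mulLeft, hc, hcg, add_comm]
  have hcr : ∀ ω, c (r ω) = c ω + 1 := fun ω => by
    obtain ⟨k, hk⟩ := hwω ω
    rw [show r ω = s (w ω) by simp [hw], hcs, hk, hc, hczpow, zero_add]
  have hsp : s ^ p = 1 := by
    rw [hs, Equiv.pow_mulLeft, F.pow_eq_one g hg]; simp
  have hrp : r ^ p = 1 := by
    rw [hr, ← map_pow, F.pow_eq_one h hhker, map_one]
  obtain ⟨f, hf, hfr, hfc⟩ := exists_twist hsp hrp c hcs hcr
  have hkQ : ∀ i : ℕ, s ^ i * (r ^ i)⁻¹ ∈ Q := fun i =>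
    Q.mul_mem (Q.pow_mem hsQ i) (Q.inv_mem (Q.pow_mem hrQ i))
  have hcx : ∀ x, c x = 0 → ∀ ω, c (x * ω) = c ω := fun x hx ω => by rw [hc, hx, zero_add]
  have hfcomm : ∀ x, c x = 0 → (∀ q ∈ Q, ∀ ω, q (x * ω) = x * q ω) →
      ∀ ω, f (x * ω) = x * f ω := by
    intro x hx hqx ω
    rw [hf, hf, hcx x hx, hqx _ (hkQ _)]
  have hfK : f ∈ K := by
    by_cases hne : w = 1
    · have hsr : s = r := by
        rw [hw, inv_mul_eq_one] at hne
        exact hne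
      have : f = 1 := by
        ext ω
        rw [hf, hsr]
        simp
      rw [this]
      exact K.one_mem
    refine h2 f fun a b => ?_
    set k : Equiv.Perm G := s ^ (c a).val * (r ^ (c a).val)⁻¹ with hk
    have hka : k a = f a := (hf a).symm
    by_cases hab : c a = c b
    · exact ⟨k, hQK (hkQ _), hka, by rw [hf, ← hab]⟩
    have hckb : c (k b) = c b := hfc r hrp hcr _ b
    have hcfa : c (f a) = c a := by rw [hf]; exact hfc r hrp hcr _ a
    have hcfb : c (f b) = c b := by rw [hf]; exact hfc r hrp hcr _ b
    have hmem : f b * (k b)⁻¹ ∈ F.ker := by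
      apply F.div_mem_ker
      rw [hf, hQχ _ (hkQ _), hQχ _ (hkQ _)]
    obtain ⟨e, he⟩ : ∃ e : ℤ, f b = z ^ e * k b := by
      have h3 : c (f b * (k b)⁻¹) = 0 := by
        have := hc (f b * (k b)⁻¹) (k b)
        rw [inv_mul_cancel_right, hcfb, hckb] at this
        exact left_eq_add.1 (by rwa [add_comm])
      obtain ⟨_, ⟨e, rfl⟩, _, ⟨m, rfl⟩, h4⟩ := Subgroup.mem_sup.1 ((hc0 _).1 h3)
      simp only at h4
      have h5 : F.χ (F.t ^ m) = 0 := by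
        have h6 : F.t ^ m = (z ^ e)⁻¹ * (f b * (k b)⁻¹) := by rw [← h4]; simp
        rw [h6]
        exact F.ker.mul_mem (F.ker.inv_mem (F.ker.zpow_mem hz e)) hmem
      rw [F.zpow_t_eq_one h5, mul_one] at h4
      exact ⟨e, by rw [h4]; simp⟩
    obtain ⟨κ, hκ, h3, h4⟩ := F.exists_fix_and_zpow_mul hp hK hz hc hc0 (hQK hwQ) hw1
      (hQz w hwQ) (hQt w hwQ) hwω hne (a := f a) (b := k b) (by rwa [hcfa, hckb]) e
    exact ⟨κ * k, K.mul_mem hκ (hQK (hkQ _)), by rw [Equiv.Perm.mul_apply, hka, h3],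
      by rw [Equiv.Perm.mul_apply, h4, he]⟩
  refine conjIntoTranslations_of_forall (y := f⁻¹) (K.inv_mem hfK) fun x => ?_
  have hM : ∀ {x u}, f * ρ u = Equiv.mulLeft x * f → f⁻¹ * Equiv.mulLeft x * f⁻¹⁻¹ = ρ u :=
    fun h => by rw [inv_inv, mul_assoc, ← h, inv_mul_cancel_left]
  let M : Subgroup G :=
    { carrier := {x | ∃ u, f⁻¹ * Equiv.mulLeft x * f⁻¹⁻¹ = ρ u}
      one_mem' := ⟨1, by simp⟩
      mul_mem' := by
        rintro x y ⟨u, hu⟩ ⟨v, hv⟩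
        refine ⟨u * v, ?_⟩
        rw [map_mul, ← hu, ← hv, Equiv.mulLeft_mul]
        group
      inv_mem' := by
        rintro x ⟨u, hu⟩
        refine ⟨u⁻¹, ?_⟩
        rw [map_inv, ← hu, ← Equiv.inv_mulLeft]
        group }
  have hzM : z ∈ M := ⟨v, hM (Equiv.ext fun ω => by
    rw [← hv]
    exact hfcomm z hcz hQz ω)⟩
  have htM : F.t ∈ M := ⟨F.t, hM (Equiv.ext fun ω => by
    rw [hρt]
    exact hfcomm F.t hct hQt ω)⟩
  have hgM : g ∈ M := ⟨h, hM hfr⟩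
  refine F.forall_of_ker_of_t (M := M) ?_ htM x
  rw [← F.ker_eq_sup hp hz hz1 hg hgz]
  exact sup_le ((Subgroup.zpowers_le (H := M)).2 hzM) ((Subgroup.zpowers_le (H := M)).2 hgM)

/-- A regular representation inside a two-closed group shifting `χ`, itself shifting `χ` in the
standard way, is conjugate to the translations. -/
theorem conjIntoTranslations_of_shifts [Finite G] (hp : p.Prime) (hodd : Odd p)
    {K : Subgroup (Equiv.Perm G)} (h2 : TwoClosed K) (hK : ∀ g, Equiv.mulLeft g ∈ K)
    (hχ : F.Shifts K) {ρ : G →* Equiv.Perm G} (hρ : IsRegularRep ρ) (hρK : ∀ u, ρ u ∈ K)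
    (hρχ : ∀ u ω, F.χ (ρ u ω) = F.χ u + F.χ ω) : ConjIntoTranslations K ρ := by
  obtain ⟨y, hy, hyχ, hyt⟩ := F.exists_conjRep_t hp hodd h2 hK hχ hρ hρK hρχ
  refine .of_conjRep hy ?_
  have hχconj : ∀ {k : Equiv.Perm G} {σ : G →* Equiv.Perm G}, (∀ ω, F.χ (k ω) = F.χ ω) →
      (∀ u ω, F.χ (σ u ω) = F.χ u + F.χ ω) →
      ∀ u ω, F.χ (conjRep k σ u ω) = F.χ u + F.χ ω := by
    intro k σ hk hσ u ω
    rw [conjRep_apply, Equiv.Perm.mul_apply, Equiv.Perm.mul_apply, hk, hσ, ← hk (k⁻¹ ω),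
      perm_apply_inv]
  have hρχ' := hχconj hyχ hρχ
  have hρ' := hρ.conjRep y
  have hρK' := conjRep_mem hρK hy
  generalize conjRep y ρ = σ at hyt hρχ' hρ' hρK' ⊢
  let C : Subgroup (Equiv.Perm G) :=
    { carrier := {k | k ∈ K ∧ (∀ ω, F.χ (k ω) = F.χ ω) ∧
        k * Equiv.mulLeft F.t = Equiv.mulLeft F.t * k}
      one_mem' := ⟨K.one_mem, fun _ => rfl, by simp⟩
      mul_mem' := fun {a b} ha hb => ⟨K.mul_mem ha.1 hb.1, fun ω => by
        rw [Equiv.Perm.mul_apply, ha.2.1, hb.2.1], by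
          rw [mul_assoc, hb.2.2, ← mul_assoc, ha.2.2, mul_assoc]⟩
      inv_mem' := fun {a} ha => ⟨K.inv_mem ha.1, fun ω => by
        rw [← ha.2.1 (a⁻¹ ω), perm_apply_inv], by
          rw [inv_mul_eq_iff_eq_mul, ← mul_assoc, ha.2.2, mul_inv_cancel_right]⟩ }
  let ι : G →* Equiv.Perm G :=
    { toFun := fun g => Equiv.mulLeft g
      map_one' := by ext; simp
      map_mul' := fun a b => by ext; simp }
  have hkp : IsPGroup p F.ker := IsPGroup.of_card F.card_ker'
  have hA : F.ker.map ι ≤ C := by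
    rintro _ ⟨u, hu, rfl⟩
    refine ⟨hK u, fun ω => ?_, ?_⟩
    · simp [ι, F.χ_mul, show F.χ u = 0 from hu]
    · change Equiv.mulLeft u * _ = _ * Equiv.mulLeft u
      rw [← Equiv.mulLeft_mul, mul_comm, Equiv.mulLeft_mul]
  have hB : F.ker.map σ ≤ C := by
    rintro _ ⟨u, hu, rfl⟩
    refine ⟨hρK' u, fun ω => ?_, ?_⟩
    · rw [hρχ', show F.χ u = 0 from hu, zero_add]
    · rw [← hyt, ← map_mul, mul_comm, map_mul]
  obtain ⟨Q, hQC, hQp, hAQ, d, hd, hBQ⟩ := exists_isPGroup_conj hp hA hB (hkp.map ι) (hkp.map σ)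
  refine .of_conjRep hd.1 ?_
  refine F.conjIntoTranslations_of_isPGroup hp h2 hK (hρ'.conjRep d) (hχconj hd.2.1 hρχ') ?_
    (Q := Q) (fun q hq => (hQC hq).1) hQp (fun q hq => (hQC hq).2.1)
    (fun q hq => Equiv.ext_iff.1 (hQC hq).2.2) (fun u hu => hAQ ⟨u, hu, rfl⟩)
    (fun u hu => hBQ _ ⟨u, hu, rfl⟩)
  rw [conjRep_apply, hyt, hd.2.2, mul_inv_cancel_right]

end Frame

theorem exists_forall_mem_iff_ne : ∀ S : Finset (ZMod 4), S.card = 3 →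
    ∃ i₀, ∀ i, i ∈ S ↔ i ≠ i₀ := by decide

theorem zmod_four_eq_of_two_mul : ∀ c : ZMod 4, 2 * c = 0 → c = 0 ∨ c = 2 := by decide

theorem DiffInvariant.mul {G : Type*} [Group G] {K : Subgroup (Equiv.Perm G)} {X Y : Set G}
    (hX : DiffInvariant K X) (hY : DiffInvariant K Y) :
    DiffInvariant K {g | ∃ x ∈ X, ∃ y ∈ Y, x * y = g} := by
  rintro k hk a b ⟨x, hx, y, hy, h⟩
  refine ⟨k b * (k (y * a))⁻¹, hX k hk _ _ ?_, k (y * a) * (k a)⁻¹, hY k hk _ _ (by simpa using hy),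
    by simp⟩
  rwa [mul_inv_rev, ← mul_assoc, ← h, mul_inv_cancel_right]

/-- A regular representation meets an invariant subgroup `V` in a subgroup of the same order: the
elements displacing `ω` by an element of `V`. -/
theorem exists_subgroup_of_diffInvariant {G : Type*} [Group G] [Finite G]
    {K : Subgroup (Equiv.Perm G)} {V : Subgroup G} (hV : DiffInvariant K (V : Set G))
    {ρ : G →* Equiv.Perm G} (hρ : IsRegularRep ρ) (hρK : ∀ u, ρ u ∈ K) (ω : G) :
    ∃ A : Subgroup G, (∀ u, u ∈ A ↔ ρ u ω * ω⁻¹ ∈ V) ∧ Nat.card A = Nat.card V := by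
  refine ⟨{ carrier := {u | ρ u ω * ω⁻¹ ∈ V}
            one_mem' := by simp
            mul_mem' := ?_
            inv_mem' := ?_ }, fun u => Iff.rfl, Nat.card_congr (Equiv.ofBijective
              (fun u => ⟨ρ u.1 ω * ω⁻¹, u.2⟩) ⟨?_, ?_⟩)⟩
  · intro a b ha hb
    have h4 := hV (ρ a) (hρK a) _ _ hb
    rw [← Equiv.Perm.mul_apply, ← map_mul] at h4
    simpa using V.mul_mem h4 ha
  · intro a ha
    have h4 := hV (ρ a⁻¹) (hρK _) (ρ a ω) ω (by simpa using V.inv_mem ha)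
    rw [← Equiv.Perm.mul_apply, ← map_mul] at h4
    simpa using h4
  · intro u v huv
    apply Subtype.ext
    apply (hρ ω).1
    have := congrArg Subtype.val huv
    simpa using this
  · rintro ⟨v, hv⟩
    obtain ⟨u, hu⟩ := (hρ ω).2 (v * ω)
    refine ⟨⟨u, ?_⟩, Subtype.ext ?_⟩
    · change ρ u ω * ω⁻¹ ∈ V
      rw [show ρ u ω = v * ω from hu, mul_inv_cancel_right]
      exact hv
    · change ρ u ω * ω⁻¹ = v
      rw [show ρ u ω = v * ω from hu, mul_inv_cancel_right]

namespace Frame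

variable {p : ℕ} {G : Type*} [CommGroup G] (F : Frame p G)

theorem eq_or_eq_of_sq_eq (hodd : Odd p) {x y : G} (h : y ^ 2 = x ^ 2) :
    y = x ∨ y = F.t ^ 2 * x := by
  obtain ⟨u, hu, hd⟩ := F.exists_ker_mul (a := F.lift (F.χ (y * x⁻¹))) (b := y * x⁻¹) (by simp)
  have hsq : (y * x⁻¹) ^ 2 = 1 := by rw [mul_pow, h, inv_pow, mul_inv_cancel]
  have h2 : 2 * F.χ (y * x⁻¹) = 0 := by
    have := congrArg F.χ hsq
    rw [χ_pow, χ_one] at this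
    exact_mod_cast this
  have hu1 : u = 1 := by
    have h4 : F.lift (F.χ (y * x⁻¹)) ^ 4 = 1 := by
      rw [lift, ← pow_mul, mul_comm, pow_mul, F.t_pow, one_pow]
    have h5 := congrArg (· ^ 4) hd
    simp only [mul_pow u, h4, mul_one] at h5
    have h6 : u ^ 4 = 1 := by
      rw [← h5, show 4 = 2 * 2 by norm_num, pow_mul, hsq, one_pow]
    exact Subgroup.mem_bot.1 (F.pow_mul_mem_of_odd hodd hu (Subgroup.mem_bot.2 h6))
  rw [hu1, one_mul] at hd
  rcases zmod_four_eq_of_two_mul _ h2 with h0 | h0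
  · left
    rw [h0, lift, ZMod.val_zero, pow_zero] at hd
    exact mul_inv_eq_one.1 hd
  · right
    rw [h0, lift, show (2 : ZMod 4).val = 2 from rfl] at hd
    exact mul_inv_eq_iff_eq_mul.1 hd

theorem t_sq_ne_one : F.t ^ 2 ≠ 1 := fun h => by
  have := congrArg F.χ h
  rw [χ_pow, F.χ_t, χ_one] at this
  exact absurd this (by decide)

theorem t_sq_sq : (F.t ^ 2) ^ 2 = 1 := by rw [← pow_mul, F.t_pow]

theorem t_sq_mem_iff_even [Finite G] (hodd : Odd p) (A : Subgroup G) :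
    F.t ^ 2 ∈ A ↔ Even (Nat.card A) := by
  constructor
  · intro h
    have h1 : orderOf (⟨F.t ^ 2, h⟩ : A) = 2 :=
      orderOf_eq_prime (Subtype.ext F.t_sq_sq) fun h2 => F.t_sq_ne_one (congrArg Subtype.val h2)
    exact even_iff_two_dvd.2 (h1 ▸ orderOf_dvd_natCard _)
  · intro h
    obtain ⟨a, ha⟩ := exists_prime_orderOf_dvd_card' 2 (even_iff_two_dvd.1 h)
    have h1 : a.1 ^ 2 = 1 ^ 2 := by
      have := congrArg Subtype.val (pow_orderOf_eq_one a)
      rw [ha] at this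
      simpa using this
    rcases F.eq_or_eq_of_sq_eq hodd h1 with h2 | h2
    · have h3 : a = 1 := Subtype.ext h2
      rw [h3, orderOf_one] at ha
      omega
    · rw [mul_one] at h2
      rw [← h2]
      exact a.2

theorem odd_card_of_le_ker (hp : p.Prime) (hodd : Odd p) {T : Subgroup G}
    (hT : T ≤ F.ker) : Odd (Nat.card T) := by
  have h1 := Subgroup.card_dvd_of_le hT
  rw [F.card_ker'] at h1
  obtain ⟨i, -, h⟩ := (Nat.dvd_prime_pow hp).1 h1
  rw [h]
  exact hodd.pow

/-- The orbits of a `p`-group containing the translations by the kernel are the fibres of `χ`, or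
one fibre and the union of the three others. -/
theorem forall_χ_eq_or_of_isPGroup [Finite G] (hp : p.Prime) (hodd : Odd p)
    {Q : Subgroup (Equiv.Perm G)} (hQp : IsPGroup p Q)
    (hQl : ∀ u ∈ F.ker, Equiv.mulLeft u ∈ Q) :
    (∀ q ∈ Q, ∀ ω, F.χ (q ω) = F.χ ω) ∨
      p = 3 ∧ ∃ i₀, (∀ q ∈ Q, ∀ ω, F.χ (q ω) = i₀ ↔ F.χ ω = i₀) ∧
        ∀ a b, F.χ a ≠ i₀ → F.χ b ≠ i₀ → ∃ q ∈ Q, q a = b := by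
  classical
  have := Fact.mk hp
  let S : G → Finset (ZMod 4) := fun ω => Finset.univ.filter fun i => ∃ q ∈ Q, F.χ (q ω) = i
  have hS : ∀ ω i, i ∈ S ω ↔ ∃ q ∈ Q, F.χ (q ω) = i := fun ω i => by simp [S]
  have horb : ∀ ω a, F.χ a ∈ S ω → ∃ q ∈ Q, q ω = a := by
    intro ω a ha
    obtain ⟨q, hq, h⟩ := (hS _ _).1 ha
    exact ⟨Equiv.mulLeft (a * (q ω)⁻¹) * q, Q.mul_mem (hQl _ (F.div_mem_ker h.symm)) hq, by simp⟩
  have hcard : ∀ ω, (S ω).card * p ^ 2 = Nat.card (MulAction.orbit Q ω) := by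
    intro ω
    have h1 : Nat.card (S ω × F.ker) = (S ω).card * p ^ 2 := by
      rw [Nat.card_prod, F.card_ker', Nat.card_eq_fintype_card, Fintype.card_coe]
    rw [← h1]
    have hχm : ∀ x : S ω × F.ker, F.χ (F.lift x.1 * x.2) = x.1 := fun x => by
      rw [F.χ_mul, χ_lift, show F.χ x.2 = 0 from x.2.2, add_zero]
    refine Nat.card_congr (Equiv.ofBijective (fun x => ⟨F.lift x.1 * x.2, ?_⟩) ⟨?_, ?_⟩)
    · obtain ⟨q, hq, h⟩ := horb ω (F.lift x.1 * x.2) (by rw [hχm]; exact x.1.2)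
      exact ⟨⟨q, hq⟩, h⟩
    · intro x y hxy
      have h2 : F.lift x.1 * x.2 = F.lift y.1 * y.2 := congrArg Subtype.val hxy
      have h3 := congrArg F.χ h2
      rw [hχm, hχm] at h3
      rw [h3] at h2
      exact Prod.ext (Subtype.ext h3) (Subtype.ext (mul_left_cancel h2))
    · rintro ⟨_, ⟨q, hq⟩, rfl⟩
      obtain ⟨u, hu, h⟩ := F.exists_ker_mul (a := F.lift (F.χ (q ω))) (b := q ω) (by simp)
      refine ⟨⟨⟨F.χ (q ω), (hS _ _).2 ⟨q, hq, rfl⟩⟩, ⟨u, hu⟩⟩, Subtype.ext ?_⟩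
      change F.lift (F.χ (q ω)) * u = q ω
      rw [mul_comm]
      exact h.symm
  have hself : ∀ ω, F.χ ω ∈ S ω := fun ω => (hS _ _).2 ⟨1, Q.one_mem, rfl⟩
  have hS4 : ∀ ω, (S ω).card ≤ 4 := fun ω => by
    have := Finset.card_le_univ (S ω)
    rwa [ZMod.card] at this
  have hp3 : 3 ≤ p := by
    obtain ⟨k, rfl⟩ := hodd
    have := hp.one_lt
    omega
  by_cases hall : ∀ ω, (S ω).card = 1
  · left
    intro q hq ω
    obtain ⟨i, hi⟩ := Finset.card_eq_one.1 (hall ω)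
    have h1 := hself ω
    have h2 : F.χ (q ω) ∈ S ω := (hS _ _).2 ⟨q, hq, rfl⟩
    rw [hi, Finset.mem_singleton] at h1 h2
    rw [h1, h2]
  · right
    push Not at hall
    obtain ⟨ω, hω⟩ := hall
    have h3 : (S ω).card = 3 ∧ p = 3 := by
      obtain ⟨n, hn⟩ := hQp.card_orbit ω
      have h1 : (S ω).card ∣ p ^ n := ⟨p ^ 2, by rw [hcard, hn]⟩
      obtain ⟨m, -, hm⟩ := (Nat.dvd_prime_pow hp).1 h1
      have h4 := hS4 ω
      rw [hm] at h4 hω ⊢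
      have hm1 : m = 1 := by
        rcases m with _ | _ | m
        · simp at hω
        · rfl
        · have : p ^ 2 ≤ p ^ (m + 2) := Nat.pow_le_pow_right hp.pos (by omega)
          nlinarith
      subst hm1
      rw [pow_one] at h4 ⊢
      have : p ≠ 4 := by
        rintro rfl
        exact absurd hodd (by decide)
      omega
    refine ⟨h3.2, ?_⟩
    obtain ⟨i₀, hi⟩ := exists_forall_mem_iff_ne _ h3.1
    have hstep : ∀ q ∈ Q, ∀ a, F.χ a ≠ i₀ → F.χ (q a) ≠ i₀ := by
      intro q hq a ha
      obtain ⟨q', hq', rfl⟩ := horb ω a ((hi _).2 ha)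
      exact (hi _).1 ((hS _ _).2 ⟨q * q', Q.mul_mem hq hq', rfl⟩)
    refine ⟨i₀, fun q hq a => ⟨fun h => ?_, fun h => ?_⟩, fun a b ha hb => ?_⟩
    · by_contra hne
      exact hstep q hq a hne h
    · by_contra hne
      refine hstep q⁻¹ (Q.inv_mem hq) (q a) hne ?_
      rwa [perm_inv_apply]
    · obtain ⟨q, hq, rfl⟩ := horb ω a ((hi _).2 ha)
      obtain ⟨q', hq', rfl⟩ := horb ω b ((hi _).2 hb)
      exact ⟨q' * q⁻¹, Q.mul_mem hq' (Q.inv_mem hq), by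
        rw [Equiv.Perm.mul_apply, perm_inv_apply]⟩

end Frame

theorem cycleType_eq_of_involution {α : Type*} [Fintype α] [DecidableEq α] {σ : Equiv.Perm α}
    (h : ∀ a, σ (σ a) = a) (hf : ∀ a, σ a ≠ a) :
    σ.cycleType = Multiset.replicate (Fintype.card α / 2) 2 := by
  have h1 : σ ^ 2 = 1 := Equiv.ext fun a => by simpa [pow_two] using h a
  have h2 := Multiset.eq_replicate_card.2 (Equiv.Perm.pow_prime_eq_one_iff.1 h1)
  have h3 := σ.sum_cycleType
  have h4 : σ.support = Finset.univ := Finset.eq_univ_of_forall fun a =>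
    Equiv.Perm.mem_support.2 (hf a)
  rw [h2, Multiset.sum_replicate, h4, Finset.card_univ, smul_eq_mul] at h3
  rw [h2, ← h3, Nat.mul_div_cancel _ two_pos]

theorem exists_conj_of_involutions {α : Type*} [Finite α] {σ τ : Equiv.Perm α}
    (hσ : ∀ a, σ (σ a) = a) (hσf : ∀ a, σ a ≠ a) (hτ : ∀ a, τ (τ a) = a) (hτf : ∀ a, τ a ≠ a) :
    ∃ π : Equiv.Perm α, ∀ a, π (σ a) = τ (π a) := by
  classical
  have := Fintype.ofFinite α
  obtain ⟨π, h⟩ := isConj_iff.1 (Equiv.Perm.isConj_iff_cycleType_eq.2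
    ((cycleType_eq_of_involution hσ hσf).trans (cycleType_eq_of_involution hτ hτf).symm))
  exact ⟨π, fun a => by rw [← h]; simp⟩

/-- Two fixed point free involutions with the same invariant partition are conjugate by a
permutation preserving all parts. -/
theorem exists_conj_of_involutions_fibre {α β : Type*} [Finite α] {σ τ : Equiv.Perm α} (f : α → β)
    (hσ : ∀ a, σ (σ a) = a) (hσf : ∀ a, σ a ≠ a) (hτ : ∀ a, τ (τ a) = a) (hτf : ∀ a, τ a ≠ a)
    (hσp : ∀ a, f (σ a) = f a) (hτp : ∀ a, f (τ a) = f a) :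
    ∃ π : Equiv.Perm α, (∀ a, π (σ a) = τ (π a)) ∧ ∀ a, f (π a) = f a := by
  have key : ∀ b, ∃ π : Equiv.Perm {a // f a = b}, ∀ a, π (σ.subtypePerm
      (p := fun a => f a = b) (fun a => by simp only [hσp]) a) =
      τ.subtypePerm (p := fun a => f a = b) (fun a => by simp only [hτp]) (π a) := fun b => by
    apply exists_conj_of_involutions
    · exact fun a => Subtype.ext (hσ a)
    · exact fun a h => hσf a (congrArg Subtype.val h)
    · exact fun a => Subtype.ext (hτ a)
    · exact fun a h => hτf a (congrArg Subtype.val h)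
  choose π hπ using key
  have hval : ∀ b (a : {a // f a = b}), ((π (f a) ⟨a, rfl⟩ : {x // f x = f a}) : α) = π b a := by
    rintro _ ⟨a, rfl⟩
    rfl
  refine ⟨(Equiv.sigmaFiberEquiv f).symm.trans ((Equiv.sigmaCongrRight π).trans
    (Equiv.sigmaFiberEquiv f)), fun a => ?_, fun a => (π (f a) ⟨a, rfl⟩).2⟩
  change ((π (f (σ a)) ⟨σ a, rfl⟩ : {x // f x = f (σ a)}) : α) = τ (π (f a) ⟨a, rfl⟩)
  rw [hval (f a) ⟨σ a, hσp a⟩]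
  exact congrArg Subtype.val (hπ (f a) ⟨a, rfl⟩)

theorem zmod_four_two_mul_ne_one : ∀ c : ZMod 4, 2 * c ≠ 1 := by decide

theorem DiffInvariant.union {G : Type*} [Group G] {K : Subgroup (Equiv.Perm G)} {X Y : Set G}
    (hX : DiffInvariant K X) (hY : DiffInvariant K Y) : DiffInvariant K (X ∪ Y) :=
  fun k hk a b h => h.imp (hX k hk a b) (hY k hk a b)

/-- The elements with an odd number of square roots in `X`. -/
def oddSquares {G : Type*} [Monoid G] (X : Set G) : Set G :=
  {z | Odd (Set.ncard {x | x ∈ X ∧ x ^ 2 = z})}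

theorem DiffInvariant.oddSquares {G : Type*} [CommGroup G] [Finite G]
    {K : Subgroup (Equiv.Perm G)} {X : Set G} (hX : DiffInvariant K X) :
    DiffInvariant K (oddSquares X) := fun k hk a b h => by
  have h1 := card_pow_fiber_eq Nat.prime_two k (fun a b => hX.iff hk a b) a b
  have h2 := ZMod.natCast_eq_one_iff_odd.2 h
  exact ZMod.natCast_eq_one_iff_odd.1 (h1.trans h2)

theorem exists_sq_eq_of_mem_oddSquares {G : Type*} [Monoid G] {X : Set G} {z : G}
    (h : z ∈ oddSquares X) : ∃ x, x ^ 2 = z := by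
  by_contra hne
  push Not at hne
  have : {x | x ∈ X ∧ x ^ 2 = z} = ∅ := Set.eq_empty_of_forall_notMem fun x hx => hne x hx.2
  rw [Paper.oddSquares, Set.mem_ofPred, this, Set.ncard_empty] at h
  exact absurd h (by decide)

namespace Frame

section

variable {p : ℕ} {G : Type*} [CommGroup G] (F : Frame p G)

theorem t_sq_mul_t_sq_mul (x : G) : F.t ^ 2 * (F.t ^ 2 * x) = x := by
  rw [← mul_assoc, ← pow_two, F.t_sq_sq, one_mul]

theorem sq_mem_oddSquares_iff (hodd : Odd p) (X : Set G) (x : G) :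
    x ^ 2 ∈ oddSquares X ↔ ¬ (x ∈ X ↔ F.t ^ 2 * x ∈ X) := by
  have hne : x ≠ F.t ^ 2 * x := fun h => F.t_sq_ne_one (by simpa using h.symm)
  have hmem : ∀ y, (y ∈ X ∧ y ^ 2 = x ^ 2) ↔ (y = x ∧ x ∈ X) ∨ (y = F.t ^ 2 * x ∧
      F.t ^ 2 * x ∈ X) := by
    intro y
    constructor
    · rintro ⟨hy, h⟩
      rcases F.eq_or_eq_of_sq_eq hodd h with rfl | rfl
      · exact Or.inl ⟨rfl, hy⟩
      · exact Or.inr ⟨rfl, hy⟩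
    · rintro (⟨rfl, h⟩ | ⟨rfl, h⟩)
      · exact ⟨h, rfl⟩
      · exact ⟨h, by rw [mul_pow, F.t_sq_sq, one_mul]⟩
  rw [oddSquares, Set.mem_ofPred]
  simp only [hmem]
  by_cases h1 : x ∈ X <;> by_cases h2 : F.t ^ 2 * x ∈ X <;> simp only [h1, h2, and_true, and_false,
    or_false, false_or, iff_true, iff_false, not_true_eq_false, not_false_eq_true]
  · rw [show {y | y = x ∨ y = F.t ^ 2 * x} = {x, F.t ^ 2 * x} from rfl, Set.ncard_pair hne]
    decide
  · rw [Set.ofPred_eq_eq_singleton, Set.ncard_singleton]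
    decide
  · rw [Set.ofPred_eq_eq_singleton, Set.ncard_singleton]
    decide
  · simp

/-- The largest invariant subgroup contained in the kernel of `χ`. -/
def core (K : Subgroup (Equiv.Perm G)) : Subgroup G where
  carrier := {v | ∃ X, DiffInvariant K X ∧ v ∈ X ∧ X ⊆ F.ker}
  one_mem' := by
    refine ⟨{1}, fun k _ a b h => ?_, rfl, ?_⟩
    · rw [mul_inv_eq_one.1 h, mul_inv_cancel]
      rfl
    · rintro _ rfl
      exact F.ker.one_mem
  mul_mem' := by
    rintro v w ⟨X, hX, hv, hXk⟩ ⟨Y, hY, hw, hYk⟩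
    refine ⟨_, hX.mul hY, ⟨v, hv, w, hw, rfl⟩, ?_⟩
    rintro _ ⟨x, hx, y, hy, rfl⟩
    exact F.ker.mul_mem (hXk hx) (hYk hy)
  inv_mem' := by
    rintro v ⟨X, hX, hv, hXk⟩
    exact ⟨X⁻¹, hX.inv, by simpa using hv, fun x hx => by simpa using hXk hx⟩

variable {K : Subgroup (Equiv.Perm G)}

theorem core_le_ker : F.core K ≤ F.ker := fun _ ⟨_, _, hv, h⟩ => h hv

theorem core_diffInvariant : DiffInvariant K (F.core K : Set G) := by
  rintro k hk a b ⟨X, hX, hv, h⟩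
  exact ⟨X, hX, hX k hk a b hv, h⟩

/-- The common stabilizer of the invariant sets stable under multiplication by `t ^ 2`. -/
def sqStab (K : Subgroup (Equiv.Perm G)) : Subgroup G where
  carrier := {g | ∀ Y, DiffInvariant K Y → (∀ y ∈ Y, F.t ^ 2 * y ∈ Y) → ∀ y, y ∈ Y ↔ g * y ∈ Y}
  one_mem' := fun Y _ _ y => by rw [one_mul]
  mul_mem' := fun ha hb Y hY ht y => by
    rw [mul_assoc, ← ha Y hY ht, ← hb Y hY ht]
  inv_mem' := fun {a} ha Y hY ht y => by
    rw [ha Y hY ht (a⁻¹ * y), mul_inv_cancel_left]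

theorem t_sq_mem_sqStab : F.t ^ 2 ∈ F.sqStab K := fun Y _ ht y =>
  ⟨ht y, fun h => by simpa only [t_sq_mul_t_sq_mul] using ht _ h⟩

theorem sqStab_diffInvariant : DiffInvariant K (F.sqStab K : Set G) := by
  intro k hk a b h Y hY ht y
  obtain ⟨c, hc⟩ := k.surjective (y⁻¹ * k a)
  have h1 := hY.iff hk c a
  have h2 := hY.iff hk c b
  rw [hc, show k a * (y⁻¹ * k a)⁻¹ = y by rw [mul_inv_rev, mul_inv_cancel_left, inv_inv]] at h1
  rw [hc, show k b * (y⁻¹ * k a)⁻¹ = k b * (k a)⁻¹ * y by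
    rw [mul_inv_rev, inv_inv, mul_assoc]] at h2
  rw [← h1, ← h2, h Y hY ht (a * c⁻¹), ← mul_assoc, inv_mul_cancel_right]

end

theorem sq_eq_inv_of_mem_ker {G : Type*} [CommGroup G] (F : Frame 3 G) {v : G} (hv : v ∈ F.ker) :
    v ^ 2 = v⁻¹ := by
  rw [eq_inv_iff_mul_eq_one, ← pow_succ]
  exact F.pow_eq_one v hv

variable {G : Type*} [CommGroup G] [Finite G] (F : Frame 3 G) {K : Subgroup (Equiv.Perm G)}

theorem oddSquares_subset_ker
    (hmix : ∀ X, DiffInvariant K X → ∀ x ∈ X, F.χ x ≠ 0 → ∀ m ≠ 0, ∃ y ∈ X, F.χ y = m)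
    {X : Set G} (hX : DiffInvariant K X) : oddSquares X ⊆ F.ker := by
  intro z hz
  by_contra hne
  obtain ⟨y, hy, h1⟩ := hmix _ hX.oddSquares z hz hne 1 (by decide)
  obtain ⟨x, rfl⟩ := exists_sq_eq_of_mem_oddSquares hy
  rw [χ_pow] at h1
  exact zmod_four_two_mul_ne_one _ (by exact_mod_cast h1)

theorem mul_mem_orbital (hK : ∀ g, Equiv.mulLeft g ∈ K)
    (hmix : ∀ X, DiffInvariant K X → ∀ x ∈ X, F.χ x ≠ 0 → ∀ m ≠ 0, ∃ y ∈ X, F.χ y = m)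
    {g x : G} (hg : g ∈ F.sqStab K) (hx : x ∉ F.core K) (hgx : g * x ∉ F.core K) :
    g * x ∈ orbital K x := by
  have hodd : Odd 3 := by decide
  have hO := orbital_diffInvariant hK x
  have hS : (oddSquares (orbital K x))⁻¹ ⊆ F.ker := fun v hv => by
    simpa using F.oddSquares_subset_ker hmix hO hv
  have hSc : ∀ v ∈ (oddSquares (orbital K x))⁻¹, v ∈ F.core K := fun v hv =>
    ⟨_, hO.oddSquares.inv, hv, hS⟩
  have hOc : ∀ v ∈ orbital K x, v ∉ F.core K := by
    rintro _ ⟨k, hk, h1, rfl⟩ h2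
    apply hx
    have := F.core_diffInvariant.iff hk 1 x
    rw [h1, inv_one, mul_one, mul_one] at this
    exact this.2 h2
  have hmem : ∀ v ∈ F.ker, v ∈ (oddSquares (orbital K x))⁻¹ ↔
      ¬ (v ∈ orbital K x ↔ F.t ^ 2 * v ∈ orbital K x) := fun v hv => by
    rw [← F.sq_mem_oddSquares_iff hodd, F.sq_eq_inv_of_mem_ker hv, Set.mem_inv]
  have key := (hg _ (hO.union hO.oddSquares.inv) ?_ x).1 (Or.inl (mem_orbital_self K x))
  · exact key.resolve_right fun h => hgx (hSc _ h)
  · rintro y (hy | hy)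
    · by_cases hty : F.t ^ 2 * y ∈ orbital K x
      · exact Or.inl hty
      right
      have h1 : y ^ 2 ∈ oddSquares (orbital K x) :=
        (F.sq_mem_oddSquares_iff hodd _ _).2 fun h => hty (h.1 hy)
      have h2 : 2 * F.χ y = 0 := by
        have : F.χ (y ^ 2) = 0 := F.oddSquares_subset_ker hmix hO h1
        rw [χ_pow] at this
        exact_mod_cast this
      rcases zmod_four_eq_of_two_mul _ h2 with h0 | h0
      · exact absurd (hSc y ((hmem y h0).2 fun h => hty (h.1 hy))) (hOc y hy)
      · have hk : F.t ^ 2 * y ∈ F.ker := by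
          rw [mem_ker, F.χ_mul, χ_pow, F.χ_t, h0]
          decide
        rw [hmem _ hk, t_sq_mul_t_sq_mul]
        exact fun h => hty (h.2 hy)
    · left
      by_contra hty
      have h1 := (hmem y (hS hy)).1 hy
      have h2 : y ∉ orbital K x := fun h => hOc y h (hSc y hy)
      exact h1 (iff_of_false h2 hty)

end Frame

theorem quot_mk_eq_iff {G : Type*} [CommGroup G] {T : Subgroup G} {a b : G} :
    (QuotientGroup.mk a : G ⧸ T) = QuotientGroup.mk b ↔ b * a⁻¹ ∈ T := by
  rw [QuotientGroup.eq, mul_comm]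

namespace Frame

variable {G : Type*} [CommGroup G] [Finite G] (F : Frame 3 G) {K : Subgroup (Equiv.Perm G)}

theorem mem_of_mul_mem_sqStab (h2 : TwoClosed K) (hK : ∀ g, Equiv.mulLeft g ∈ K)
    (hmix : ∀ X, DiffInvariant K X → ∀ x ∈ X, F.χ x ≠ 0 → ∀ m ≠ 0, ∃ y ∈ X, F.χ y = m)
    {π : Equiv.Perm (G ⧸ F.core K)} {f : Equiv.Perm G} {g : G ⧸ F.core K → G}
    (hg : ∀ a, g a ∈ F.sqStab K) (hf : ∀ ω, f ω = g (QuotientGroup.mk ω) * ω)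
    (hπ : ∀ ω, (QuotientGroup.mk (f ω) : G ⧸ F.core K) = π (QuotientGroup.mk ω)) : f ∈ K := by
  refine h2 f fun a b => ?_
  by_cases hab : (QuotientGroup.mk a : G ⧸ F.core K) = QuotientGroup.mk b
  · exact ⟨_, hK (g (QuotientGroup.mk a)), (hf a).symm, by rw [hf b, hab]; rfl⟩
  · have hx : b * a⁻¹ ∉ F.core K := fun h => hab (quot_mk_eq_iff.2 h)
    have h3 : f b * (f a)⁻¹ ∉ F.core K := fun h => hab <| π.injective <| by
      rw [← hπ, ← hπ, quot_mk_eq_iff]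
      exact h
    have h4 : f b * (f a)⁻¹ = g (QuotientGroup.mk b) * (g (QuotientGroup.mk a))⁻¹ * (b * a⁻¹) := by
      rw [hf, hf, mul_inv, mul_mul_mul_comm]
    rw [h4] at h3
    obtain ⟨k, hk, hk1, hkx⟩ := F.mul_mem_orbital hK hmix
      ((F.sqStab K).mul_mem (hg (QuotientGroup.mk b)) ((F.sqStab K).inv_mem
        (hg (QuotientGroup.mk a)))) hx h3
    rw [← h4] at hkx
    refine ⟨Equiv.mulLeft (f a) * k * Equiv.mulLeft a⁻¹,
      K.mul_mem (K.mul_mem (hK _) hk) (hK _), ?_, ?_⟩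
    · simp [hk1]
    · change f a * k (a⁻¹ * b) = f b
      rw [mul_comm a⁻¹, hkx, mul_comm, inv_mul_cancel_right]

theorem exists_conjRep_t_sq (h2 : TwoClosed K) (hK : ∀ g, Equiv.mulLeft g ∈ K)
    (hmix : ∀ X, DiffInvariant K X → ∀ x ∈ X, F.χ x ≠ 0 → ∀ m ≠ 0, ∃ y ∈ X, F.χ y = m)
    {ρ : G →* Equiv.Perm G} (hρ : IsRegularRep ρ) (hρK : ∀ u, ρ u ∈ K) :
    ∃ f ∈ K, ∀ ω, conjRep f ρ (F.t ^ 2) ω * (F.t ^ 2 * ω)⁻¹ ∈ F.core K := by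
  have hodd : Odd 3 := by decide
  have hT := F.core_diffInvariant (K := K)
  have hsq : ∀ ω, ρ (F.t ^ 2) (ρ (F.t ^ 2) ω) = ω := fun ω => by
    rw [← Equiv.Perm.mul_apply, ← map_mul, ← pow_two, F.t_sq_sq, map_one]
    rfl
  have hρV : ∀ ω, ρ (F.t ^ 2) ω * ω⁻¹ ∈ F.sqStab K := fun ω => by
    obtain ⟨A, hA, hc⟩ := exists_subgroup_of_diffInvariant F.sqStab_diffInvariant hρ hρK ω
    rw [← hA, F.t_sq_mem_iff_even hodd, hc, ← F.t_sq_mem_iff_even hodd]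
    exact F.t_sq_mem_sqStab
  have hcard : ¬ Even (Nat.card (F.core K)) :=
    Nat.not_even_iff_odd.2 (F.odd_card_of_le_ker Nat.prime_three hodd F.core_le_ker)
  have hρT : ∀ ω, ρ (F.t ^ 2) ω * ω⁻¹ ∉ F.core K := fun ω => by
    obtain ⟨A, hA, hc⟩ := exists_subgroup_of_diffInvariant hT hρ hρK ω
    rw [← hA, F.t_sq_mem_iff_even hodd, hc]
    exact hcard
  have htT : F.t ^ 2 ∉ F.core K := by
    rw [F.t_sq_mem_iff_even hodd]
    exact hcard
  let q : G ⧸ F.core K → G ⧸ (F.sqStab K ⊔ F.core K) :=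
    QuotientGroup.map _ _ (MonoidHom.id G) le_sup_right
  have hq : ∀ a, q (QuotientGroup.mk a) = QuotientGroup.mk a := fun a => rfl
  obtain ⟨π, hπ, hπq⟩ := exists_conj_of_involutions_fibre
    (σ := quotPerm hT (hρK (F.t ^ 2))) (τ := quotPerm hT (hK (F.t ^ 2))) q
    (by
      rintro ⟨ω⟩
      exact congrArg QuotientGroup.mk (hsq ω))
    (by
      rintro ⟨ω⟩ h
      refine hρT ω ?_
      rw [← quot_mk_eq_iff]
      exact h.symm)
    (by
      rintro ⟨ω⟩
      exact congrArg QuotientGroup.mk (F.t_sq_mul_t_sq_mul ω))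
    (by
      rintro ⟨ω⟩ h
      refine htT ?_
      rw [← mul_inv_cancel_right (F.t ^ 2) ω, ← quot_mk_eq_iff]
      exact h.symm)
    (by
      rintro ⟨ω⟩
      refine Eq.symm (quot_mk_eq_iff.2 ?_)
      exact (le_sup_left : F.sqStab K ≤ _) (hρV ω))
    (by
      rintro ⟨ω⟩
      refine Eq.symm (quot_mk_eq_iff.2 ?_)
      change F.t ^ 2 * ω * ω⁻¹ ∈ _
      rw [mul_inv_cancel_right]
      exact (le_sup_left : F.sqStab K ≤ _) F.t_sq_mem_sqStab)
  have hex : ∀ a, ∃ g ∈ F.sqStab K, (QuotientGroup.mk g : G ⧸ F.core K) * a = π a := by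
    rintro ⟨x⟩
    obtain ⟨y, hy⟩ := QuotientGroup.mk_surjective (π (QuotientGroup.mk x))
    have h1 := hπq (QuotientGroup.mk x)
    rw [← hy, hq, hq, eq_comm, quot_mk_eq_iff] at h1
    obtain ⟨v, hv, u, hu, h⟩ := Subgroup.mem_sup.1 h1
    refine ⟨v, hv, ?_⟩
    change (QuotientGroup.mk (v * x) : G ⧸ F.core K) = π (QuotientGroup.mk x)
    rw [← hy, quot_mk_eq_iff]
    rw [mul_inv_rev, ← mul_assoc, ← h, mul_comm v, mul_inv_cancel_right]
    exact hu
  choose g hg hgπ using hex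
  have hmk : ∀ ω, (QuotientGroup.mk (g (QuotientGroup.mk ω) * ω) : G ⧸ F.core K) =
      π (QuotientGroup.mk ω) := fun ω => hgπ (QuotientGroup.mk ω)
  have hinj : Function.Injective fun ω => g (QuotientGroup.mk ω) * ω := fun a b h => by
    have h1 : (QuotientGroup.mk a : G ⧸ F.core K) = QuotientGroup.mk b := π.injective <| by
      rw [← hmk, ← hmk]
      exact congrArg _ h
    beta_reduce at h
    rw [h1] at h
    exact mul_left_cancel h
  let f : Equiv.Perm G := Equiv.ofBijective _ (Finite.injective_iff_bijective.1 hinj)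
  have hf : ∀ ω, f ω = g (QuotientGroup.mk ω) * ω := fun ω => rfl
  refine ⟨f, F.mem_of_mul_mem_sqStab h2 hK hmix hg hf hmk, fun ω => ?_⟩
  obtain ⟨η, rfl⟩ := f.surjective ω
  rw [← quot_mk_eq_iff]
  have h5 := hπ (QuotientGroup.mk η)
  rw [quotPerm_mk, ← hmk, ← hmk] at h5
  rw [conjRep_apply, Equiv.Perm.mul_apply, Equiv.Perm.mul_apply, perm_inv_apply]
  exact h5.symm

end Frame

namespace Frame

variable {p : ℕ} {G : Type*} [CommGroup G] [Finite G] (F : Frame p G)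
  {K : Subgroup (Equiv.Perm G)}

/-- Sylow's theorem applied to the two regular images of the kernel of `χ`. -/
theorem exists_conjRep_ker_mem (hp : p.Prime) (hK : ∀ g, Equiv.mulLeft g ∈ K)
    {ρ : G →* Equiv.Perm G} (hρK : ∀ u, ρ u ∈ K) :
    ∃ Q ≤ K, IsPGroup p Q ∧ (∀ u ∈ F.ker, Equiv.mulLeft u ∈ Q) ∧
      ∃ c ∈ K, ∀ u ∈ F.ker, conjRep c ρ u ∈ Q := by
  let ι : G →* Equiv.Perm G :=
    { toFun := Equiv.mulLeft
      map_one' := Equiv.ext fun x => by simp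
      map_mul' := fun a b => Equiv.ext fun x => by simp }
  have hkp : IsPGroup p F.ker := IsPGroup.of_card F.card_ker'
  obtain ⟨Q, hQ, hQp, h1, c, hc, h2⟩ := exists_isPGroup_conj hp (C := K) (A := F.ker.map ι)
    (B := F.ker.map ρ) (by rintro _ ⟨u, -, rfl⟩; exact hK u)
    (by rintro _ ⟨u, -, rfl⟩; exact hρK u) (hkp.map ι) (hkp.map ρ)
  exact ⟨Q, hQ, hQp, fun u hu => h1 ⟨u, hu, rfl⟩, c, hc, fun u hu => h2 _ ⟨u, hu, rfl⟩⟩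

theorem exists_conjRep_ker (hp : p.Prime) (hodd : Odd p) (h2 : TwoClosed K)
    (hK : ∀ g, Equiv.mulLeft g ∈ K) {ρ : G →* Equiv.Perm G} (hρ : IsRegularRep ρ)
    (hρK : ∀ u, ρ u ∈ K) :
    ∃ k ∈ K, ∀ u ∈ F.ker, ∀ ω, F.χ (conjRep k ρ u ω) = F.χ ω := by
  obtain ⟨Q, hQ, hQp, hQl, c, hc, hQρ⟩ := F.exists_conjRep_ker_mem hp hK hρK
  rcases F.forall_χ_eq_or_of_isPGroup hp hodd hQp hQl with h | ⟨rfl, i₀, hi, hmv⟩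
  · exact ⟨c, hc, fun u hu ω => h _ (hQρ u hu) ω⟩
  have hmix : ∀ X, DiffInvariant K X → ∀ x ∈ X, F.χ x ≠ 0 → ∀ m ≠ 0, ∃ y ∈ X, F.χ y = m := by
    intro X hX x hx hx0 m hm
    obtain ⟨q, hq, h⟩ := hmv (x * F.lift i₀) (F.lift (i₀ + m)) (by simpa [F.χ_mul] using hx0)
      (by simpa using hm)
    refine ⟨q (x * F.lift i₀) * (q (F.lift i₀))⁻¹, hX q (hQ hq) _ _ (by simpa using hx), ?_⟩
    rw [F.χ_mul, χ_inv, (hi q hq _).2 (F.χ_lift i₀), h, χ_lift]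
    ring
  obtain ⟨f, hf, hft⟩ := F.exists_conjRep_t_sq h2 hK hmix hρ hρK
  have hT := F.core_diffInvariant (K := K)
  have hσK := conjRep_mem hρK hf
  let K₀ : Subgroup (Equiv.Perm G) :=
    { carrier := {k | k ∈ K ∧ ∀ ω, k (F.t ^ 2 * ω) * (F.t ^ 2 * k ω)⁻¹ ∈ F.core K}
      one_mem' := ⟨K.one_mem, fun ω => by simp⟩
      mul_mem' := by
        rintro k l ⟨hk, h3⟩ ⟨hl, h4⟩
        refine ⟨K.mul_mem hk hl, fun ω => ?_⟩
        have := (F.core K).mul_mem (hT k hk _ _ (h4 ω)) (h3 (l ω))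
        rwa [← mul_assoc, inv_mul_cancel_right] at this
      inv_mem' := by
        rintro k ⟨hk, h3⟩
        refine ⟨K.inv_mem hk, fun ω => ?_⟩
        have := (F.core K).inv_mem (h3 (k⁻¹ ω))
        rw [perm_apply_inv, mul_inv_rev, inv_inv] at this
        refine (hT.iff hk _ _).2 ?_
        rwa [perm_apply_inv] }
  have hσ₀ : ∀ u, conjRep f ρ u ∈ K₀ := fun u => by
    refine ⟨hσK u, fun ω => ?_⟩
    have h3 := (F.core K).inv_mem (hT _ (hσK u) _ _ (hft ω))
    have h4 := (F.core K).mul_mem h3 (hft (conjRep f ρ u ω))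
    rw [← Equiv.Perm.mul_apply, ← Equiv.Perm.mul_apply, ← map_mul, ← map_mul, mul_comm u,
      mul_inv_rev, inv_inv, ← mul_assoc, inv_mul_cancel_right] at h4
    exact h4
  have hl₀ : ∀ g, Equiv.mulLeft g ∈ K₀ := fun g =>
    ⟨hK g, fun ω => by
      rw [Equiv.coe_mulLeft]
      beta_reduce
      rw [mul_left_comm g, mul_inv_cancel]
      exact (F.core K).one_mem⟩
  obtain ⟨Q', hQ', hQp', hQl', c', hc', hQρ'⟩ := F.exists_conjRep_ker_mem hp hl₀ hσ₀
  rcases F.forall_χ_eq_or_of_isPGroup hp hodd hQp' hQl' with h | ⟨-, i₁, hi₁, hmv₁⟩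
  · exact ⟨c' * f, K.mul_mem hc'.1 hf, fun u hu ω => by
      rw [← h _ (hQρ' u hu) ω]
      simp [mul_assoc]⟩
  · exfalso
    obtain ⟨q, hq, h⟩ := hmv₁ (F.lift (i₁ + 2)) (F.lift (i₁ + 1))
      (by rw [χ_lift]; simpa using (by decide : (2 : ZMod 4) ≠ 0))
      (by rw [χ_lift]; simpa using (by decide : (1 : ZMod 4) ≠ 0))
    have h3 : F.χ _ = 0 := F.core_le_ker ((hQ' hq).2 (F.lift (i₁ + 2)))
    rw [h, F.χ_mul, χ_inv, F.χ_mul, χ_lift, χ_pow, F.χ_t, (hi₁ q hq _).2] at h3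
    · ring_nf at h3
      exact absurd h3 (by decide)
    · rw [F.χ_mul, χ_lift, χ_pow, F.χ_t, add_left_comm, show ((2 : ℕ) : ZMod 4) * 1 + 2 = 0 from by
        decide, add_zero]

end Frame

set_option maxRecDepth 100000 in
theorem zmod_four_regular : ∀ σ : ZMod 4 → ZMod 4,
    (∀ i, σ i ≠ i) → (∀ i, σ (σ i) ≠ i) → (∀ i, σ (σ (σ (σ i))) = i) →
    ((∀ i, σ i = i + 1) ∨ ∀ i, σ i = i - 1) ∨
      (∀ i, σ (σ i + 1) = σ (i + 1) + 1) ∨ ∀ i, σ (σ i + 1) = σ (i + 1) - 1 := by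
  decide

theorem ConjIntoTranslations.mono {G : Type*} [Group G] {K L : Subgroup (Equiv.Perm G)}
    {ρ : G →* Equiv.Perm G} (hKL : K ≤ L) (h : ConjIntoTranslations K ρ) :
    ConjIntoTranslations L ρ := by
  obtain ⟨k, hk, h⟩ := h
  exact ⟨k, hKL hk, h⟩

namespace Frame

variable {p : ℕ} {G : Type*} [CommGroup G] [Finite G] (F : Frame p G)
  {K : Subgroup (Equiv.Perm G)} {ρ : G →* Equiv.Perm G}

theorem exists_rep_eq_of_χ_eq (hρ : IsRegularRep ρ)
    (hker : ∀ u ∈ F.ker, ∀ ω, F.χ (ρ u ω) = F.χ ω) {a b : G} (h : F.χ a = F.χ b) :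
    ∃ u ∈ F.ker, ρ u a = b := by
  have hinj : Function.Injective fun u : F.ker =>
      (⟨ρ u a * a⁻¹, F.div_mem_ker (hker u u.2 a)⟩ : F.ker) := fun u v huv => by
    have := congrArg Subtype.val huv
    exact Subtype.ext ((hρ a).1 (mul_right_cancel this))
  obtain ⟨u, hu⟩ := (Finite.injective_iff_surjective.1 hinj) ⟨b * a⁻¹, F.div_mem_ker h.symm⟩
  exact ⟨u, u.2, mul_right_cancel (congrArg Subtype.val hu)⟩

theorem mem_ker_of_χ_eq (hρ : IsRegularRep ρ)
    (hker : ∀ u ∈ F.ker, ∀ ω, F.χ (ρ u ω) = F.χ ω) {u a : G} (h : F.χ (ρ u a) = F.χ a) :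
    u ∈ F.ker := by
  obtain ⟨v, hv, h⟩ := F.exists_rep_eq_of_χ_eq hρ hker h.symm
  rwa [← (hρ a).1 h]

theorem χ_rep_congr (hρ : IsRegularRep ρ)
    (hker : ∀ u ∈ F.ker, ∀ ω, F.χ (ρ u ω) = F.χ ω) (v : G) {a b : G} (h : F.χ a = F.χ b) :
    F.χ (ρ v a) = F.χ (ρ v b) := by
  obtain ⟨u, hu, rfl⟩ := F.exists_rep_eq_of_χ_eq hρ hker h
  rw [← Equiv.Perm.mul_apply, ← map_mul, mul_comm, map_mul, Equiv.Perm.mul_apply, hker u hu]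

theorem exists_conjRep_shift (hK : ∀ g, Equiv.mulLeft g ∈ K) (hρ : IsRegularRep ρ)
    (hρK : ∀ u, ρ u ∈ K) (hker : ∀ u ∈ F.ker, ∀ ω, F.χ (ρ u ω) = F.χ ω) :
    ∃ k ∈ K, (∀ u ∈ F.ker, ∀ ω, F.χ (conjRep k ρ u ω) = F.χ ω) ∧
      ((∀ ω, F.χ (conjRep k ρ F.t ω) = F.χ ω + 1) ∨
        ∀ ω, F.χ (conjRep k ρ F.t ω) = F.χ ω - 1) := by
  let σ : ZMod 4 → ZMod 4 := fun i => F.χ (ρ F.t (F.lift i))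
  have hσ : ∀ ω, F.χ (ρ F.t ω) = σ (F.χ ω) := fun ω =>
    F.χ_rep_congr hρ hker _ (by rw [χ_lift])
  have hσ2 : ∀ ω, F.χ (ρ (F.t ^ 2) ω) = σ (σ (F.χ ω)) := fun ω => by
    rw [← hσ ω, ← hσ, ← Equiv.Perm.mul_apply, ← map_mul, pow_two]
  have h1 : ∀ i, σ i ≠ i := fun i hi => by
    have := F.mem_ker_of_χ_eq hρ hker (u := F.t) (a := F.lift i) (by rw [hσ, χ_lift, hi])
    rw [mem_ker, F.χ_t] at this
    exact absurd this (by decide)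
  have h2 : ∀ i, σ (σ i) ≠ i := fun i hi => by
    have := F.mem_ker_of_χ_eq hρ hker (u := F.t ^ 2) (a := F.lift i) (by rw [hσ2, χ_lift, hi])
    rw [mem_ker, χ_pow, F.χ_t] at this
    exact absurd this (by decide)
  have h4 : ∀ i, σ (σ (σ (σ i))) = i := fun i => by
    have h3 := hσ2 (ρ (F.t ^ 2) (F.lift i))
    rw [hσ2 (F.lift i), ← Equiv.Perm.mul_apply, ← map_mul, ← pow_two, F.t_sq_sq, map_one,
      Equiv.Perm.one_apply, χ_lift] at h3
    exact h3.symm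
  rcases zmod_four_regular σ h1 h2 h4 with h | h
  · exact ⟨1, K.one_mem, by simpa using hker,
      h.imp (fun h ω => (hσ ω).trans (h _)) fun h ω => (hσ ω).trans (h _)⟩
  · have hk : ∀ ω, F.χ ((ρ F.t * Equiv.mulLeft F.t) ω) = σ (F.χ ω + 1) := fun ω => by
      rw [Equiv.Perm.mul_apply, hσ, Equiv.coe_mulLeft, F.χ_mul, F.χ_t, add_comm]
    refine ⟨ρ F.t * Equiv.mulLeft F.t, K.mul_mem (hρK _) (hK _), fun u hu ω => ?_,
      h.imp (fun h ω => ?_) fun h ω => ?_⟩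
    all_goals
      obtain ⟨η, rfl⟩ := (ρ F.t * Equiv.mulLeft F.t).surjective ω
      rw [conjRep_apply, Equiv.Perm.mul_apply, Equiv.Perm.mul_apply _ (ρ _),
        perm_inv_apply, hk, hk]
    · rw [hker u hu]
    · rw [hσ, h]
    · rw [hσ, h]

theorem conjIntoTranslations_of_χ_rep (F : Frame p G) (hp : p.Prime) (hodd : Odd p) (h2 : TwoClosed K)
    (hK : ∀ g, Equiv.mulLeft g ∈ K) (hρ : IsRegularRep ρ) (hρK : ∀ u, ρ u ∈ K)
    (hρχ : ∀ u ω, F.χ (ρ u ω) = F.χ u + F.χ ω) : ConjIntoTranslations K ρ := by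
  let L : Subgroup (Equiv.Perm G) :=
    { carrier := {k | k ∈ K ∧ ∃ a, ∀ ω, F.χ (k ω) = F.χ ω + a}
      one_mem' := ⟨K.one_mem, 0, fun ω => by simp⟩
      mul_mem' := by
        rintro k l ⟨hk, a, ha⟩ ⟨hl, b, hb⟩
        exact ⟨K.mul_mem hk hl, b + a, fun ω => by
          rw [Equiv.Perm.mul_apply, ha, hb, add_assoc]⟩
      inv_mem' := by
        rintro k ⟨hk, a, ha⟩
        exact ⟨K.inv_mem hk, -a, fun ω => by
          have := ha (k⁻¹ ω)
          rw [perm_apply_inv] at this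
          rw [this, add_neg_cancel_right]⟩ }
  have hLK : L ≤ K := fun k hk => hk.1
  refine ConjIntoTranslations.mono hLK (F.conjIntoTranslations_of_shifts (K := L) hp hodd ?_
    (fun g => ⟨hK g, F.χ g, fun ω => ?_⟩) (fun k hk => hk.2) hρ
    (fun u => ⟨hρK u, F.χ u, fun ω => ?_⟩) hρχ)
  · intro f hf
    refine ⟨h2 f fun a b => ?_, F.χ (f 1), fun ω => ?_⟩
    · obtain ⟨k, hk, h⟩ := hf a b
      exact ⟨k, hk.1, h⟩
    · obtain ⟨k, ⟨-, a, ha⟩, h1, h3⟩ := hf 1 ω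
      rw [← h1, ← h3, ha, ha, χ_one, zero_add]
  · rw [Equiv.coe_mulLeft, F.χ_mul, add_comm]
  · rw [hρχ, add_comm]

/-- Every regular representation of `G` inside a two-closed group containing the translations is
conjugate, in that group, to one by translations. -/
theorem conjIntoTranslations (F : Frame p G) (hp : p.Prime) (hodd : Odd p) (h2 : TwoClosed K)
    (hK : ∀ g, Equiv.mulLeft g ∈ K) (hρ : IsRegularRep ρ) (hρK : ∀ u, ρ u ∈ K) :
    ConjIntoTranslations K ρ := by
  obtain ⟨k, hk, hker⟩ := F.exists_conjRep_ker hp hodd h2 hK hρ hρK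
  refine ConjIntoTranslations.of_conjRep hk ?_
  have hρ₁ := hρ.conjRep k
  have hρ₁K := conjRep_mem hρK hk
  obtain ⟨l, hl, hker₁, ht⟩ := F.exists_conjRep_shift hK hρ₁ hρ₁K hker
  refine ConjIntoTranslations.of_conjRep hl ?_
  have hρ₂ := hρ₁.conjRep l
  have hρ₂K := conjRep_mem hρ₁K hl
  generalize Paper.conjRep l (Paper.conjRep k ρ) = τ at *
  rcases ht with ht | ht
  · refine F.conjIntoTranslations_of_χ_rep hp hodd h2 hK hρ₂ hρ₂K ?_
    let M : Subgroup G :=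
      { carrier := {u | ∀ ω, F.χ (τ u ω) = F.χ u + F.χ ω}
        one_mem' := fun ω => by simp
        mul_mem' := fun {a b} ha hb ω => by
          rw [map_mul, Equiv.Perm.mul_apply, ha, hb, F.χ_mul, add_assoc]
        inv_mem' := fun {a} ha ω => by
          have := ha (τ a⁻¹ ω)
          rw [← Equiv.Perm.mul_apply, ← map_mul, mul_inv_cancel, map_one, Equiv.Perm.one_apply]
            at this
          rw [this, χ_inv, neg_add_cancel_left] }
    exact fun u => F.forall_of_ker_of_t (M := M)
      (fun u hu ω => by rw [hker₁ u hu, show F.χ u = 0 from hu, zero_add])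
      (fun ω => by rw [ht, F.χ_t, add_comm]) u
  · suffices h : ConjIntoTranslations K (τ.comp invMonoidHom) by
      obtain ⟨m, hm, h⟩ := h
      refine ⟨m, hm, fun u => ?_⟩
      simpa using h u⁻¹
    refine F.conjIntoTranslations_of_χ_rep hp hodd h2 hK
      (fun a => (hρ₂ a).comp (Equiv.inv G).bijective) (fun u => hρ₂K _) ?_
    let M : Subgroup G :=
      { carrier := {u | ∀ ω, F.χ (τ u⁻¹ ω) = F.χ u + F.χ ω}
        one_mem' := fun ω => by simp
        mul_mem' := fun {a b} ha hb ω => by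
          rw [mul_inv, map_mul, Equiv.Perm.mul_apply, ha, hb, F.χ_mul, add_assoc]
        inv_mem' := fun {a} ha ω => by
          have := ha (τ a⁻¹⁻¹ ω)
          rw [← Equiv.Perm.mul_apply, ← map_mul, mul_inv_cancel, map_one, Equiv.Perm.one_apply]
            at this
          rw [this, χ_inv, neg_add_cancel_left] }
    exact fun u => F.forall_of_ker_of_t (M := M)
      (fun u hu ω => by
        rw [hker₁ u⁻¹ (F.ker.inv_mem hu), show F.χ u = 0 from hu, zero_add])
      (fun ω => by
        have := ht (τ F.t⁻¹ ω)
        rw [← Equiv.Perm.mul_apply, ← map_mul, mul_inv_cancel, map_one, Equiv.Perm.one_apply]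
            at this
        rw [this, F.χ_t, add_sub_cancel]) u

end Frame

/-- The frame of `C₄ × C_p × C_p`. -/
def Frame.ofEquiv {p : ℕ} {G : Type*} [CommGroup G]
    (e : G ≃* Multiplicative (ZMod 4) × Multiplicative (ZMod p) × Multiplicative (ZMod p)) :
    Frame p G where
  χ g := (e g).1.toAdd
  χ_mul a b := by rw [map_mul]; rfl
  t := e.symm (Multiplicative.ofAdd 1, 1)
  χ_t := by rw [e.apply_symm_apply]; rfl
  t_pow := by
    rw [← map_pow, MulEquiv.map_eq_one_iff, Prod.pow_mk, one_pow]
    exact Prod.ext (show Multiplicative.ofAdd (1 : ZMod 4) ^ 4 = 1 by decide) rfl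
  pow_eq_one u hu := by
    have h : ∀ x : Multiplicative (ZMod p), x ^ p = 1 := fun x =>
      Multiplicative.toAdd.injective (by simp)
    have h1 : (e u).1 = 1 := hu
    apply e.injective
    rw [map_pow, map_one]
    refine Prod.ext ?_ (Prod.ext (h _) (h _))
    rw [Prod.pow_fst, h1, one_pow]
    rfl
  card_ker := by
    have h : {u // (e u).1.toAdd = 0} ≃ Multiplicative (ZMod p) × Multiplicative (ZMod p) :=
      { toFun := fun u => (e u.1).2
        invFun := fun x => ⟨e.symm (1, x), by rw [e.apply_symm_apply]; rfl⟩
        left_inv := by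
          rintro ⟨u, hu⟩
          apply Subtype.ext
          apply e.injective
          change e (e.symm _) = e u
          rw [e.apply_symm_apply]
          exact Prod.ext hu.symm rfl
        right_inv := fun x => by
          change (e (e.symm _)).2 = x
          rw [e.apply_symm_apply] }
    rw [Nat.card_congr h, Nat.card_prod, pow_two, Nat.card_congr Multiplicative.toAdd, Nat.card_zmod]

theorem image_rel_eq_iff {G : Type*} [Group G] {f : Equiv.Perm G} {X Y : Set G} :
    Prod.map f f '' Rel X = Rel Y ↔ ∀ a b, b * a⁻¹ ∈ X ↔ f b * (f a)⁻¹ ∈ Y := by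
  constructor
  · intro h a b
    have h1 : (f a, f b) ∈ Prod.map f f '' Rel X ↔ (f a, f b) ∈ Rel Y := by rw [h]
    refine Iff.trans ?_ h1
    constructor
    · exact fun hab => ⟨(a, b), hab, rfl⟩
    · rintro ⟨⟨c, d⟩, hcd, h2⟩
      obtain ⟨hc, hd⟩ := Prod.ext_iff.1 h2
      rw [← f.injective hc, ← f.injective hd]
      exact hcd
  · intro h
    ext ⟨c, d⟩
    obtain ⟨a, rfl⟩ := f.surjective c
    obtain ⟨b, rfl⟩ := f.surjective d
    constructor
    · rintro ⟨⟨a', b'⟩, hab, h2⟩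
      rw [← h2]
      exact (h a' b').1 hab
    · exact fun hab => ⟨(a, b), (h a b).2 hab, rfl⟩

theorem vBasic_eq_range_orbital {G : Type*} [Group G] (K : Subgroup (Equiv.Perm G)) :
    VBasic K = Set.range (orbital K) := by
  refine congrArg Set.range (funext fun x => Set.ext fun g => ⟨?_, ?_⟩)
  · rintro ⟨⟨⟨k, hk⟩, h⟩, rfl⟩
    exact ⟨k, hk, h, rfl⟩
  · rintro ⟨k, hk, h, rfl⟩
    exact ⟨⟨⟨k, hk⟩, h⟩, rfl⟩

theorem vBasic_rightTranslations (G : Type*) [Group G] :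
    VBasic (rightTranslations G) = Set.range fun x : G => ({x} : Set G) := by
  rw [vBasic_eq_range_orbital]
  refine congrArg Set.range (funext fun x => Set.ext fun g => ⟨?_, ?_⟩)
  · rintro ⟨_, ⟨a, rfl⟩, h, rfl⟩
    have h1 : a = 1 := by simpa using h
    simp [h1]
  · rintro rfl
    exact mem_orbital_self _ _

theorem mem_rightTranslations_iff {G : Type*} [Group G] (f : Equiv.Perm G) :
    f ∈ rightTranslations G ↔ ∀ x, Prod.map f f '' Rel ({x} : Set G) = Rel {x} := by
  simp only [image_rel_eq_iff, Set.mem_singleton_iff]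
  constructor
  · rintro ⟨g, rfl⟩ x a b
    simp
  · intro h
    refine ⟨f 1, Equiv.ext fun b => ?_⟩
    have h1 := (h b 1 b).1 (by simp)
    rw [mul_inv_eq_iff_eq_mul] at h1
    exact h1.symm

theorem inSup2_rightTranslations (G : Type*) [Group G] [Finite G] :
    InSup2 (rightTranslations G) := by
  refine ⟨le_refl (rightTranslations G), Set.ext fun f => ?_⟩
  rw [SetLike.mem_coe, mem_rightTranslations_iff, vBasic_rightTranslations]
  rw [Set.mem_ofPred, Set.forall_mem_range]

section

variable {G : Type*} [CommGroup G]

theorem mulRight_eq_mulLeft (g : G) : Equiv.mulRight g = Equiv.mulLeft g :=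
  Equiv.ext fun x => mul_comm x g

theorem InSup.mulLeft_mem {K : Subgroup (Equiv.Perm G)} (hK : InSup K) (g : G) :
    Equiv.mulLeft g ∈ K := hK ⟨g, mulRight_eq_mulLeft g⟩

theorem InSup2.twoClosed [Finite G] {K : Subgroup (Equiv.Perm G)} (hK : InSup2 K) :
    TwoClosed K := by
  intro f hf
  rw [← SetLike.mem_coe, hK.2, vBasic_eq_range_orbital]
  rintro _ ⟨x, rfl⟩
  rw [image_rel_eq_iff]
  intro a b
  obtain ⟨k, hk, ha, hb⟩ := hf a b
  rw [← ha, ← hb]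
  exact (orbital_diffInvariant hK.1.mulLeft_mem x).iff hk a b

theorem gComplete_rightTranslations {K : Subgroup (Equiv.Perm G)} (hK : InSup K)
    (h : ∀ ρ : G →* Equiv.Perm G, IsRegularRep ρ → (∀ u, ρ u ∈ K) → ConjIntoTranslations K ρ) :
    GComplete (rightTranslations G) K := by
  refine ⟨hK, ?_⟩
  rintro R hR hreg ⟨e⟩
  have hb : ∀ a, Function.Bijective fun r : R => (r : Equiv.Perm G) a := fun a =>
    (Function.bijective_iff_existsUnique _).2 fun b => hreg a b
  obtain ⟨k, hk, h⟩ := h (R.subtype.comp e.symm.toMonoidHom)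
    (fun a => (hb a).comp e.symm.bijective) fun u => hR (e.symm u).2
  refine ⟨k, hk, fun r hr => ?_⟩
  obtain ⟨g, hg⟩ := h (e ⟨r, hr⟩)
  refine ⟨g, ?_⟩
  beta_reduce
  rw [mulRight_eq_mulLeft, ← hg]
  simp

end

/-- The S-ring all of whose basic sets are singletons is a CI-S-ring. -/
theorem SRing.isCI_of_basic_eq_range_singleton {G : Type*} [Group G] [Finite G] {A : SRing G}
    (hA : A.basic = Set.range fun x : G => ({x} : Set G)) : A.IsCI := by
  have haut : ∀ f, f ∈ A.autSet ↔ f ∈ rightTranslations G := fun f => by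
    rw [mem_rightTranslations_iff, autSet, Set.mem_ofPred, hA]
    exact Set.forall_mem_range
  apply Set.Subset.antisymm
  · rintro _ ⟨s, hs, _, ⟨φ, rfl⟩, rfl⟩
    obtain ⟨c, rfl⟩ := (haut s).1 hs
    refine ⟨A, ?_⟩
    have himg : ∀ x : G, Prod.map (Equiv.mulRight c * φ.toEquiv : Equiv.Perm G)
        (Equiv.mulRight c * φ.toEquiv : Equiv.Perm G) '' Rel ({x} : Set G) = Rel {φ x} := by
      intro x
      rw [image_rel_eq_iff]
      intro a b
      change b * a⁻¹ = x ↔ φ b * c * (φ a * c)⁻¹ = φ x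
      rw [mul_inv_rev, mul_assoc, mul_inv_cancel_left, ← map_inv, ← map_mul]
      exact φ.injective.eq_iff.symm
    ext Z
    rw [hA]
    constructor
    · rintro ⟨_, ⟨x, rfl⟩, rfl⟩
      exact ⟨_, ⟨φ x, rfl⟩, (himg x).symm⟩
    · rintro ⟨_, ⟨y, rfl⟩, rfl⟩
      refine ⟨_, ⟨φ.symm y, rfl⟩, (himg _).trans ?_⟩
      rw [φ.apply_symm_apply]
  · rintro f ⟨B, hB⟩
    have hmul : ∀ x a, f (x * a) * (f 1)⁻¹ = f x * (f 1)⁻¹ * (f a * (f 1)⁻¹) := by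
      intro x a
      obtain ⟨Y, -, hY⟩ : Prod.map f f '' Rel ({x} : Set G) ∈ Rel '' B.basic := by
        rw [← hB, hA]
        exact ⟨_, ⟨x, rfl⟩, rfl⟩
      have h1 := image_rel_eq_iff.1 hY.symm
      have h2 : f x * (f 1)⁻¹ ∈ Y := (h1 1 x).1 (by simp)
      obtain ⟨b, hb⟩ := f.surjective (f x * (f 1)⁻¹ * f a)
      have h3 : b * a⁻¹ = x := (h1 a b).2 (by rwa [hb, mul_inv_cancel_right])
      rw [← h3, inv_mul_cancel_right, hb, h3, mul_assoc]
    refine ⟨Equiv.mulRight (f 1), (haut _).2 ⟨f 1, rfl⟩, _,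
      ⟨MulEquiv.mk' (f.trans (Equiv.mulRight (f 1)⁻¹)) hmul, rfl⟩, ?_⟩
    ext x
    exact inv_mul_cancel_right _ _

/-- Let `p` be an odd prime and `G = C₄ × C_p × C_p`. Then for
every `K ∈ Sup₂^min(G_r)`, the S-ring `V(K,G)` is a CI-S-ring. -/
theorem stmt2 (p : ℕ) (hp : p.Prime) (hodd : Odd p)
    (G : Type*) [CommGroup G] [Finite G]
    (hG : Nonempty (G ≃* Multiplicative (ZMod 4) × Multiplicative (ZMod p) × Multiplicative (ZMod p)))
    (K : Subgroup (Equiv.Perm G)) (hK : InSup2Min K)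
    (A : SRing G) (hA : A.basic = VBasic K) :
    A.IsCI := by
  obtain ⟨e⟩ := hG
  obtain ⟨hK2, hmin⟩ := hK
  have h := hmin _ (inSup2_rightTranslations G) (gComplete_rightTranslations hK2.1 fun ρ hρ hρK =>
    (Frame.ofEquiv e).conjIntoTranslations hp hodd hK2.twoClosed hK2.1.mulLeft_mem hρ hρK)
  exact SRing.isCI_of_basic_eq_range_singleton (by rw [hA, ← h, vBasic_rightTranslations])

end Paper
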